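/- Let ℓ ≥ 2, m = 2^ℓ − 2 and k = 2^{ℓ−1}. For every convex body K ⊆ ℝ^m there exist k pairwise distinct affine hyperplanes H_1, …, H_k in ℝ^m, each meeting the interior of K, whose centers of mass coincide: m(H_1) = ⋯ = m(H_k). -/

import Mathlib

open MeasureTheory RealInnerProductSpace

/-- The center of mass of `K ∩ H` with respect to `(m-1)`-dimensional Hausdorff measure. -/
noncomputable def centerOfMass (m : ℕ) (K H : Set (EuclideanSpace ℝ (Fin m))) :
    EuclideanSpace ℝ (Fin m) :=
  ((μH[(m : ℝ) - 1] (K ∩ H)).toReal)⁻¹ • ∫ x in K ∩ H, x ∂(μH[(m : ℝ) - 1])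

/-- `H` is an affine hyperplane in `ℝ^m`. -/
def IsAffineHyperplane {m : ℕ} (H : Set (EuclideanSpace ℝ (Fin m))) : Prop :=
  ∃ w : EuclideanSpace ℝ (Fin m), w ≠ 0 ∧ ∃ t : ℝ, H = {x | ⟪x, w⟫ = t}

/-- The action of a signed permutation on coordinate vectors. -/
def signedPerm {I R : Type*} [Ring R] (τ : Equiv.Perm I) (ε : I → ℤˣ) (x : I → R) : I → R :=
  fun j => ((ε j : ℤ) : R) * x (τ j)

/-- A top dimensional simplex of the triangulation of the prism over the grid cube `[-2 M, 2 M]^I`: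
the centre of a grid cell, a corner of it, and an order in which the coordinates are moved from the
corner to the centre. -/
abbrev PrismSimplex (I : Type) [Fintype I] (M : ℕ) : Type :=
  (I → Fin (2 * M)) × (Option I → ℤˣ) × (Fin (Fintype.card I + 1) ≃ Option I)

namespace PrismSimplex

variable {I : Type} [Fintype I] [DecidableEq I] {M : ℕ}

/-- The centre of the grid cell with index `z`. -/
def center (z : I → Fin (2 * M)) : Option I → ℤ
  | none => 1
  | some i => 2 * (z i : ℤ) + 1 - 2 * M

/-- The vertices of a prism simplex. -/
def vert (σ : PrismSimplex I M) (k : Fin (Fintype.card I + 2)) (i : Option I) : ℤ :=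
  center σ.1 i + if (σ.2.2.symm i).val < k.val then 0 else (σ.2.1 i : ℤ)

/-- The facet opposite to a vertex. -/
def face (σ : PrismSimplex I M) (k : Fin (Fintype.card I + 2)) (l : Fin (Fintype.card I + 1)) :
    Option I → ℤ :=
  vert σ (k.succAbove l)

/-- A signed permutation of `I` acting on the vertices of the prism. -/
def act (τ : Equiv.Perm I) (ε : I → ℤˣ) (x : Option I → ℤ) : Option I → ℤ
  | none => x none
  | some j => (ε j : ℤ) * x (some (τ j))

lemma abs_vert_le {J : Type} [Fintype J] (σ : PrismSimplex J M)
    (k : Fin (Fintype.card J + 2)) (i : J) :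
    |vert σ k (some i)| ≤ 2 * M := by
  have := (σ.1 i).isLt
  rcases Int.units_eq_one_or (σ.2.1 (some i)) with hs | hs <;> simp only [vert, center, hs] <;>
    split_ifs <;> rw [abs_le] <;> push_cast <;> omega

/-- Flip the sign at one coordinate. -/
def flipSign (s : Option I → ℤˣ) (i : Option I) : Option I → ℤˣ :=
  Function.update s i (-(s i))

lemma flipSign_flipSign {J : Type} [DecidableEq J] (s : Option J → ℤˣ) (i : Option J) :
    flipSign (flipSign s i) i = s := by
  ext j
  by_cases h : j = i
  · subst h; simp [flipSign]
  · simp [flipSign, h]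

lemma flipSign_ne {J : Type} [DecidableEq J] (s : Option J → ℤˣ) (i : Option J) :
    flipSign s i ≠ s := by
  intro h
  have := congrFun h i
  simp only [flipSign, Function.update_self] at this
  rcases Int.units_eq_one_or (s i) with h1 | h1 <;> rw [h1] at this <;> simp at this

variable (h : (Fin (Fintype.card I + 1) → Option I → ℤ) → ZMod 2)

lemma sum_face_zero : ∑ σ : PrismSimplex I M, h (face σ 0) = 0 := by
  refine Finset.sum_involution (fun σ _ => (σ.1, flipSign σ.2.1 (σ.2.2 0), σ.2.2)) ?_ ?_ ?_ ?_
  · intro σ _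
    have : face (σ.1, flipSign σ.2.1 (σ.2.2 0), σ.2.2) 0 = face σ 0 := by
      funext l i
      simp only [face, vert, Fin.zero_succAbove, Fin.val_succ]
      by_cases hi : i = σ.2.2 0
      · subst hi; simp
      · simp [flipSign, hi]
    rw [this]
    exact CharTwo.add_self_eq_zero _
  · intro σ _ _ he
    exact flipSign_ne _ _ (congrArg (fun t => t.2.1) he)
  · intro σ _; exact Finset.mem_univ _
  · intro σ _
    simp [flipSign_flipSign]

lemma sum_face_mid (k : Fin (Fintype.card I + 2)) (h0 : k.val ≠ 0)
    (h1 : k.val < Fintype.card I + 1) : ∑ σ : PrismSimplex I M, h (face σ k) = 0 := by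
  let a : Fin (Fintype.card I + 1) := ⟨k.val - 1, by omega⟩
  let b : Fin (Fintype.card I + 1) := ⟨k.val, h1⟩
  have hab : a ≠ b := by simp [a, b, Fin.ext_iff]; omega
  refine Finset.sum_involution (fun σ _ => (σ.1, σ.2.1, (Equiv.swap a b).trans σ.2.2)) ?_ ?_ ?_ ?_
  · intro σ _
    have : face (σ.1, σ.2.1, (Equiv.swap a b).trans σ.2.2) k = face σ k := by
      funext l i
      simp only [face, vert, Equiv.symm_trans_apply, Equiv.symm_swap]
      have hk : (k.succAbove l).val ≠ k.val := fun h => Fin.succAbove_ne k l (Fin.ext h)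
      congr 2
      apply propext
      set p := σ.2.2.symm i
      by_cases hpa : p = a
      · rw [hpa, Equiv.swap_apply_left]; simp only [a, b]; omega
      · by_cases hpb : p = b
        · rw [hpb, Equiv.swap_apply_right]; simp only [a, b]; omega
        · rw [Equiv.swap_apply_of_ne_of_ne hpa hpb]
    rw [this]
    exact CharTwo.add_self_eq_zero _
  · intro σ _ _ he
    have := congrArg (fun t => t.2.2 a) he
    simp only [Equiv.trans_apply, Equiv.swap_apply_left] at this
    exact hab (σ.2.2.injective this).symm
  · intro σ _; exact Finset.mem_univ _
  · intro σ _
    simp [← Equiv.trans_assoc]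

/-- The cell across the wall in direction `i` on the side `u`, if there is one. -/
def stepCell (z : Fin (2 * M)) (u : ℤˣ) : Fin (2 * M) :=
  if h : 0 ≤ (z : ℤ) + u ∧ (z : ℤ) + u < 2 * M then ⟨((z : ℤ) + u).toNat, by omega⟩ else z

/-- Move a simplex across the wall in direction `i`. -/
def push (i : I) (σ : PrismSimplex I M) : PrismSimplex I M :=
  (Function.update σ.1 i (stepCell (σ.1 i) (σ.2.1 (some i))), flipSign σ.2.1 (some i), σ.2.2)

/-- Apply a signed permutation to a simplex. -/
def reflect (τ : Equiv.Perm I) (ε : I → ℤˣ) (σ : PrismSimplex I M) : PrismSimplex I M :=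
  (fun j => if ε j = 1 then σ.1 (τ j) else Fin.rev (σ.1 (τ j)),
    fun o => o.elim (σ.2.1 none) (fun j => ε j * σ.2.1 (some (τ j))),
    σ.2.2.trans τ.symm.optionCongr)

lemma vert_reflect {J : Type} [Fintype J] (τ : Equiv.Perm J) (ε : J → ℤˣ) (σ : PrismSimplex J M)
    (k : Fin (Fintype.card J + 2)) : vert (reflect τ ε σ) k = act τ ε (vert σ k) := by
  funext o
  cases o with
  | none => simp [vert, reflect, act, center]
  | some j =>
    have e1 : ((σ.2.2.trans τ.symm.optionCongr).symm (some j)) = σ.2.2.symm (some (τ j)) := by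
      simp
    simp only [vert, reflect, act, center, e1, Option.elim]
    rcases Int.units_eq_one_or (ε j) with h1 | h1
    · simp [h1]
    · have : ¬ ((-1 : ℤˣ) = 1) := by decide
      simp only [h1, this, if_false, Fin.val_rev]
      have := (σ.1 (τ j)).isLt
      split_ifs <;> push_cast [Nat.cast_sub (show (σ.1 (τ j)).val + 1 ≤ 2 * M by omega)] <;> ring

lemma reflect_reflect {J : Type} [Fintype J] {τ : Equiv.Perm J} {ε : J → ℤˣ} (h1 : ∀ j, τ (τ j) = j)
    (h2 : ∀ j, ε j * ε (τ j) = 1) (σ : PrismSimplex J M) :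
    reflect τ ε (reflect τ ε σ) = σ := by
  obtain ⟨z, s, e⟩ := σ
  simp only [reflect]
  refine Prod.ext ?_ (Prod.ext ?_ ?_)
  · funext j
    have := h2 j
    simp only [h1]
    rcases Int.units_eq_one_or (ε j) with h | h <;> rw [h] at this <;>
      rcases Int.units_eq_one_or (ε (τ j)) with h' | h' <;> rw [h'] at this <;>
      simp [h, h'] at this ⊢
  · funext o
    cases o with
    | none => rfl
    | some j => simp [h1, ← mul_assoc, h2]
  · ext1 l
    simp only [Equiv.trans_apply]
    have h1' : ∀ j, τ.symm (τ.symm j) = j := fun j => by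
      rw [Equiv.symm_apply_eq, Equiv.symm_apply_eq, h1]
    cases e l <;> simp [h1', Equiv.optionCongr]

lemma push_push {i : I} {σ : PrismSimplex I M}
    (hi : 0 ≤ (σ.1 i : ℤ) + σ.2.1 (some i) ∧ (σ.1 i : ℤ) + σ.2.1 (some i) < 2 * M) :
    push i (push i σ) = σ := by
  obtain ⟨z, s, e⟩ := σ
  simp only at hi
  refine Prod.ext ?_ (Prod.ext ?_ rfl)
  · funext j
    by_cases hj : j = i
    · subst hj
      simp only [push, Function.update_self, flipSign]
      apply Fin.ext
      have h1 := (z j).isLt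
      simp only [stepCell, dif_pos hi]
      rw [dif_pos]
      · push_cast; omega
      · push_cast; omega
    · simp [push, hj]
  · simp [push, flipSign_flipSign]

lemma vert_push {i : I} {σ : PrismSimplex I M}
    (hi : 0 ≤ (σ.1 i : ℤ) + σ.2.1 (some i) ∧ (σ.1 i : ℤ) + σ.2.1 (some i) < 2 * M)
    {k : Fin (Fintype.card I + 2)} (hk : ¬ (σ.2.2.symm (some i)).val < k.val) :
    vert (push i σ) k = vert σ k := by
  obtain ⟨z, s, e⟩ := σ
  simp only at hi hk
  funext o
  by_cases ho : o = some i
  · subst ho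
    simp only [vert, push, hk, if_false, center, Function.update_self, flipSign, stepCell,
      dif_pos hi]
    push_cast; omega
  · cases o with
    | none => simp [vert, push, flipSign, center]
    | some j =>
      have : j ≠ i := fun h => ho (by rw [h])
      simp [vert, push, flipSign, center, this]

lemma sum_face_last (i : I) (τ : Equiv.Perm I) (ε : I → ℤˣ) (h1 : ∀ j, τ (τ j) = j)
    (h2 : ∀ j, ε j * ε (τ j) = 1) (h3 : τ i = i) (h4 : ε i = -1)
    (hh : ∀ f : Fin (Fintype.card I + 1) → Option I → ℤ, (∀ l j, |f l (some j)| ≤ 2 * M) →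
      (∀ l, |f l (some i)| = 2 * M) → h (fun l => act τ ε (f l)) = h f) :
    ∑ σ : PrismSimplex I M with σ.2.2 (Fin.last _) = some i, h (face σ (Fin.last _)) = 0 := by
  classical
  let B : PrismSimplex I M → Prop := fun σ =>
    0 ≤ (σ.1 i : ℤ) + σ.2.1 (some i) ∧ (σ.1 i : ℤ) + σ.2.1 (some i) < 2 * M
  have key : ∀ σ : PrismSimplex I M, σ.2.2 (Fin.last _) = some i → ∀ l : Fin (Fintype.card I + 1),
      ¬ (σ.2.2.symm (some i)).val < ((Fin.last (Fintype.card I + 1)).succAbove l).val := by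
    intro σ hσ l
    have : σ.2.2.symm (some i) = Fin.last _ := by rw [← hσ]; simp
    rw [this]
    simp only [Fin.succAbove_last, Fin.val_castSucc, Fin.val_last]
    omega
  have hBr : ∀ σ, ¬ B σ → ¬ B (reflect τ ε σ) := by
    intro σ hB
    simp only [B, reflect, h3, h4, Option.elim]
    have : ¬ ((-1 : ℤˣ) = 1) := by decide
    have hlt := (σ.1 i).isLt
    simp only [B] at hB
    rw [if_neg this, Fin.val_rev]
    rcases Int.units_eq_one_or (σ.2.1 (some i)) with hs | hs <;> rw [hs] at hB ⊢ <;>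
      simp at hB ⊢ <;> omega
  have hBp : ∀ σ, B σ → B (push i σ) := by
    intro σ hB
    have hlt := (σ.1 i).isLt
    simp only [B, push, Function.update_self, flipSign, stepCell]
    rw [dif_pos hB]
    simp only [B] at hB
    push_cast; omega
  refine Finset.sum_involution
    (fun σ _ => if B σ then push i σ else reflect τ ε σ) ?_ ?_ ?_ ?_
  · intro σ hσ
    have hσ := (Finset.mem_filter.1 hσ).2
    by_cases hB : B σ
    · rw [if_pos hB]
      have : face (push i σ) (Fin.last _) = face σ (Fin.last _) := by
        funext l
        exact vert_push hB (key σ hσ l)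
      rw [this]
      exact CharTwo.add_self_eq_zero _
    · rw [if_neg hB]
      have : face (reflect τ ε σ) (Fin.last _) = fun l => act τ ε (face σ (Fin.last _) l) := by
        funext l
        exact vert_reflect τ ε σ _
      rw [this, hh]
      · exact CharTwo.add_self_eq_zero _
      · exact fun l j => abs_vert_le σ _ j
      · intro l
        simp only [face, vert, key σ hσ l, if_false, center]
        simp only [B] at hB
        have hlt := (σ.1 i).isLt
        rcases Int.units_eq_one_or (σ.2.1 (some i)) with hs | hs <;> rw [hs] at hB ⊢ <;>
          simp at hB ⊢ <;> rw [abs_eq (by omega)] <;> omega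
  · intro σ hσ _
    by_cases hB : B σ
    · rw [if_pos hB]
      exact fun he => flipSign_ne _ _ (congrArg (fun t => t.2.1) he)
    · rw [if_neg hB]
      intro he
      have := congrArg (fun t => t.2.1 (some i)) he
      simp only [reflect, Option.elim, h3, h4] at this
      rcases Int.units_eq_one_or (σ.2.1 (some i)) with hs | hs <;> rw [hs] at this <;>
        simp at this
  · intro σ hσ
    have hσ := (Finset.mem_filter.1 hσ).2
    simp only [Finset.mem_filter, Finset.mem_univ, true_and]
    split_ifs
    · exact hσ
    · simp only [reflect, Equiv.trans_apply, hσ]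
      have : τ.symm i = i := by rw [Equiv.symm_apply_eq, h3]
      simp [this, Equiv.optionCongr]
  · intro σ hσ
    by_cases hB : B σ
    · simp only [hB, if_true]
      rw [if_pos (hBp σ hB), push_push hB]
    · simp only [hB, if_false]
      rw [if_neg (hBr σ hB), reflect_reflect h1 h2]

/-- If the facets of every simplex carry an even total weight and the weight is invariant under
the gluing of the side walls, then the floor and the ceiling carry an even total weight. -/
theorem sum_floor_ceiling (τ : I → Equiv.Perm I) (ε : I → I → ℤˣ)
    (h1 : ∀ i j, τ i (τ i j) = j) (h2 : ∀ i j, ε i j * ε i (τ i j) = 1) (h3 : ∀ i, τ i i = i)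
    (h4 : ∀ i, ε i i = -1)
    (hh : ∀ i, ∀ f : Fin (Fintype.card I + 1) → Option I → ℤ, (∀ l j, |f l (some j)| ≤ 2 * M) →
      (∀ l, |f l (some i)| = 2 * M) → h (fun l => act (τ i) (ε i) (f l)) = h f)
    (hsum : ∀ σ : PrismSimplex I M, ∑ k, h (face σ k) = 0) :
    ∑ σ : PrismSimplex I M with σ.2.2 (Fin.last _) = none, h (face σ (Fin.last _)) = 0 := by
  have hall : ∑ k, ∑ σ : PrismSimplex I M, h (face σ k) = 0 := by
    rw [Finset.sum_comm]
    exact Finset.sum_eq_zero fun σ _ => hsum σ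
  have hlast : ∑ σ : PrismSimplex I M, h (face σ (Fin.last _)) = 0 := by
    rw [Finset.sum_eq_single (Fin.last _)] at hall
    · exact hall
    · intro k _ hk
      by_cases h0 : k = 0
      · rw [h0]; exact sum_face_zero h
      · refine sum_face_mid h k (fun h => h0 (Fin.ext h)) ?_
        have := k.isLt
        have : k.val ≠ Fintype.card I + 1 := fun h => hk (Fin.ext h)
        omega
    · simp
  rw [← Finset.sum_fiberwise (s := Finset.univ) (g := fun σ : PrismSimplex I M =>
    σ.2.2 (Fin.last _)), Fintype.sum_option] at hlast
  rwa [Finset.sum_eq_zero (s := (Finset.univ : Finset I)) fun i _ =>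
    sum_face_last h i (τ i) (ε i) (h1 i) (h2 i) (h3 i) (h4 i) (hh i), add_zero] at hlast

end PrismSimplex

section PositiveRelation

variable {W : Type*} [AddCommGroup W] [Module ℝ W]

/-- The vectors `a` admit a linear relation with positive coefficients. -/
def HasPosRelation {J : Type*} [Fintype J] (a : J → W) : Prop :=
  ∃ c : J → ℝ, (∀ k, 0 < c k) ∧ ∑ k, c k • a k = 0

/-- No nontrivial linear relation between the vectors `a` has two vanishing coefficients. -/
def GenericRelations {J : Type*} [Fintype J] (a : J → W) : Prop :=
  ∀ c : J → ℝ, ∑ k, c k • a k = 0 → ∀ k l, k ≠ l → c k = 0 → c l = 0 → c = 0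

open Classical in
/-- The indicator of the existence of a positive linear relation. -/
noncomputable def posRelation {J : Type*} [Fintype J] (a : J → W) : ZMod 2 :=
  if HasPosRelation a then 1 else 0

lemma hasPosRelation_succAbove_iff {n : ℕ} (a : Fin (n + 2) → W) (k : Fin (n + 2)) :
    HasPosRelation (fun l => a (k.succAbove l)) ↔
      ∃ c : Fin (n + 2) → ℝ, ∑ l, c l • a l = 0 ∧ c k = 0 ∧ ∀ l, l ≠ k → 0 < c l := by
  constructor
  · rintro ⟨c, hc, h⟩
    refine ⟨Fin.insertNth k 0 c, ?_, by simp, ?_⟩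
    · rw [Fin.sum_univ_succAbove _ k]; simpa using h
    · intro l hl
      obtain ⟨j, rfl⟩ := Fin.exists_succAbove_eq hl
      simpa using hc j
  · rintro ⟨c, h, h0, hc⟩
    refine ⟨fun l => c (k.succAbove l), fun l => hc _ (Fin.succAbove_ne k l), ?_⟩
    rw [Fin.sum_univ_succAbove _ k, h0] at h
    simpa using h

lemma hasPosRelation_comp_iff {J : Type*} [Fintype J] (a : J → W) {L : W →ₗ[ℝ] W}
    (hL : Function.Injective L) : HasPosRelation (fun k => L (a k)) ↔ HasPosRelation a := by
  have : ∀ c : J → ℝ, ∑ k, c k • L (a k) = 0 ↔ ∑ k, c k • a k = 0 := by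
    intro c
    rw [← map_eq_zero_iff L hL (x := ∑ k, c k • a k), map_sum]
    simp only [map_smul]
  simp only [HasPosRelation, this]

/-- Among the facets of a generic simplex, an even number have a positive relation. -/
theorem sum_posRelation_succAbove {n : ℕ} [FiniteDimensional ℝ W] (hn : Module.finrank ℝ W = n)
    (a : Fin (n + 2) → W) (ha : GenericRelations a) :
    ∑ k : Fin (n + 2), posRelation (fun l => a (k.succAbove l)) = 0 := by
  classical
  let G : Fin (n + 2) → Prop := fun k =>
    ∃ c : Fin (n + 2) → ℝ, ∑ l, c l • a l = 0 ∧ c k = 0 ∧ ∀ l, l ≠ k → 0 < c l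
  have hG : ∀ k, posRelation (fun l => a (k.succAbove l)) = if G k then 1 else 0 := fun k => by
    simp only [posRelation, hasPosRelation_succAbove_iff, G]
  simp only [hG]
  by_cases hex : ∃ k, G k
  swap
  · push Not at hex
    simp [hex]
  obtain ⟨k₀, c, hc, hc0, hcpos⟩ := hex
  have hcomb : ∀ (μ ν : Fin (n + 2) → ℝ) (s t : ℝ), ∑ l, μ l • a l = 0 → ∑ l, ν l • a l = 0 →
      ∑ l, (s * μ l + t * ν l) • a l = 0 := by
    intro μ ν s t hμ hν
    simp only [add_smul, mul_smul, Finset.sum_add_distrib, ← Finset.smul_sum, hμ, hν, smul_zero,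
      add_zero]
  obtain ⟨ν, hν, hν0⟩ : ∃ ν : Fin (n + 2) → ℝ, ∑ l, ν l • a l = 0 ∧ ν k₀ = 1 := by
    obtain ⟨l₀, hl₀⟩ : ∃ l₀, l₀ ≠ k₀ := exists_ne k₀
    have hdep : ¬ LinearIndependent ℝ (fun l => a (l₀.succAbove l)) := by
      intro h
      have := h.fintype_card_le_finrank
      simp [hn] at this
    obtain ⟨g, hg, i, hi⟩ := Fintype.not_linearIndependent_iff.1 hdep
    let μ : Fin (n + 2) → ℝ := Fin.insertNth l₀ 0 g
    have hμ : ∑ l, μ l • a l = 0 := by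
      rw [Fin.sum_univ_succAbove _ l₀]; simpa [μ] using hg
    have hμl : μ l₀ = 0 := by simp [μ]
    have hμk : μ k₀ ≠ 0 := by
      intro h
      have := congrFun (ha μ hμ l₀ k₀ hl₀ hμl h) (l₀.succAbove i)
      simp [μ] at this
      exact hi this
    refine ⟨fun l => (μ k₀)⁻¹ * μ l + 0 * μ l, hcomb μ μ _ _ hμ hμ, ?_⟩
    field_simp
    simp
  obtain ⟨k₁, hk₁, hmin⟩ := Finset.exists_min_image (Finset.univ.erase k₀) (fun l => ν l / c l)
    (by
      obtain ⟨l₀, hl₀⟩ : ∃ l₀, l₀ ≠ k₀ := exists_ne k₀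
      exact ⟨l₀, by simp [hl₀]⟩)
  have hk₁ : k₁ ≠ k₀ := by simpa using hk₁
  have hmin : ∀ l, l ≠ k₀ → ν k₁ / c k₁ ≤ ν l / c l := fun l hl => hmin l (by simp [hl])
  have key : ∀ k, k ≠ k₀ → (G k ↔ k = k₁) := by
    intro k hk
    constructor
    · rintro ⟨μ, hμ, hμk, hμpos⟩
      by_contra hkk
      have hck := hcpos k hk
      have hck1 := hcpos k₁ hk₁
      have hμ0 := hμpos k₀ (Ne.symm hk)
      have h1 := ha (fun l => 1 * μ l + 1 * (-(μ k₀) * ν l + (μ k₀ * ν k / c k) * c l))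
        (hcomb _ _ _ _ hμ (hcomb _ _ _ _ hν hc)) k k₀ hk
        (by rw [hμk]; field_simp; ring) (by simp [hν0, hc0])
      have h2 := congrFun h1 k₁
      simp only [Pi.zero_apply] at h2
      have h3 := hμpos k₁ (Ne.symm hkk)
      have h4 : ν k / c k * c k₁ < ν k₁ := by
        have : μ k₀ * (ν k₁ - ν k / c k * c k₁) = μ k₁ := by
          rw [mul_div_assoc] at h2; linarith
        have : 0 < ν k₁ - ν k / c k * c k₁ := by
          by_contra hneg
          push Not at hneg
          nlinarith
        linarith
      have h5 := hmin k hk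
      rw [← lt_div_iff₀ hck1] at h4
      linarith
    · rintro rfl
      have hck := hcpos k hk
      refine ⟨fun l => 1 * ν l + (-(ν k / c k)) * c l, hcomb _ _ _ _ hν hc, ?_, ?_⟩
      · field_simp; ring
      · intro l hl
        by_cases hl0 : l = k₀
        · subst hl0; simp [hν0, hc0]
        have hcl := hcpos l hl0
        have h5 := hmin l hl0
        rw [le_div_iff₀ hcl] at h5
        rcases lt_or_eq_of_le h5 with h6 | h6
        · linarith
        · exfalso
          have h7 := ha (fun l => 1 * ν l + (-(ν k / c k)) * c l) (hcomb _ _ _ _ hν hc) k l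
            (Ne.symm hl) (by field_simp; ring) (by linarith)
          have h8 := congrFun h7 k₀
          simp [hν0, hc0] at h8
  rw [← Finset.add_sum_erase _ _ (Finset.mem_univ k₀), if_pos ⟨c, hc, hc0, hcpos⟩]
  rw [Finset.sum_eq_single k₁]
  · rw [if_pos ((key k₁ hk₁).2 rfl)]; exact CharTwo.add_self_eq_zero _
  · intro k hk hkk
    have hk : k ≠ k₀ := by simpa using hk
    rw [if_neg (fun h => hkk ((key k hk).1 h))]
  · intro h; simp [hk₁] at h

end PositiveRelation

section Generic

variable {W : Type*} [NormedAddCommGroup W] [NormedSpace ℝ W] [FiniteDimensional ℝ W]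

lemma dense_setOf_linearIndependent_add {J N : Type*} [Fintype J] {e : J → N}
    (he : Function.Injective e) (hJ : Fintype.card J = Module.finrank ℝ W) (p : J → W)
    (F : J → W ≃ₗ[ℝ] W) :
    Dense {η : N → W | LinearIndependent ℝ (fun j => p j + F j (η (e j)))} := by
  classical
  let b : Module.Basis J ℝ W :=
    (Module.finBasisOfFinrankEq ℝ W hJ.symm).reindex (Fintype.equivFin J).symm
  intro η
  let u : J → W := fun j => p j + F j (η (e j))
  let T : Module.End ℝ W := b.constr ℝ u
  have hT : ∀ j, T (b j) = u j := fun j => b.constr_basis ℝ u j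
  have hd : Dense {t : ℝ | ¬ T.HasEigenvalue (-t)} := by
    have h1 : {t : ℝ | T.HasEigenvalue t}.Finite := Module.End.finite_hasEigenvalue T
    have h2 : {t : ℝ | T.HasEigenvalue (-t)}.Finite :=
      h1.preimage (f := fun t => -t) neg_injective.injOn
    exact h2.countable.dense_compl ℝ
  let path : ℝ → N → W := fun t => η + t • Function.extend e (fun j => (F j).symm (b j)) 0
  have hpath : Continuous path := by fun_prop
  have h0 : path 0 = η := by simp [path]
  rw [← h0]
  refine closure_mono ?_ (image_closure_subset_closure_image hpath ⟨0, hd 0, rfl⟩)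
  rintro _ ⟨t, ht, rfl⟩
  have h1 : (fun j => p j + F j (path t (e j))) =
      (T + t • LinearMap.id : W →ₗ[ℝ] W) ∘ b := by
    funext j
    simp [path, hT, u, add_assoc, he.extend_apply]
  change LinearIndependent ℝ _
  rw [h1]
  refine b.linearIndependent.map' _ ?_
  rw [LinearMap.ker_eq_bot']
  intro x hx
  by_contra hne
  refine ht (Module.End.hasEigenvalue_of_hasEigenvector (x := x) ⟨?_, hne⟩)
  rw [Module.End.mem_eigenspace_iff]
  simp only [LinearMap.add_apply, LinearMap.smul_apply, LinearMap.id_apply] at hx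
  rw [neg_smul]
  exact eq_neg_of_add_eq_zero_left hx

/-- Generic small perturbations make finitely many families generic simultaneously. -/
theorem exists_generic_perturbation {n : ℕ} (hn : Module.finrank ℝ W = n) {S : Type*} [Finite S]
    (p : S → Fin (n + 2) → W) (F : S → Fin (n + 2) → W ≃ₗ[ℝ] W) {δ : ℝ} (hδ : 0 < δ) :
    ∃ η : Fin (n + 2) → W, (∀ k, ‖η k‖ < δ) ∧
      ∀ s, GenericRelations (fun k => p s k + F s k (η k)) := by
  classical
  let P : Type _ := {q : Fin (n + 2) × Fin (n + 2) // q.1 ≠ q.2}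
  let J : P → Type := fun q => {j : Fin (n + 2) // j ≠ q.1.1 ∧ j ≠ q.1.2}
  have hJ : ∀ q, Fintype.card (J q) = Module.finrank ℝ W := by
    intro q
    rw [hn, Fintype.card_subtype]
    have : (Finset.univ.filter fun j : Fin (n + 2) => j ≠ q.1.1 ∧ j ≠ q.1.2) =
        Finset.univ \ {q.1.1, q.1.2} := by
      ext j; simp
    rw [this, Finset.card_sdiff_of_subset (Finset.subset_univ _), Finset.card_pair q.2]
    simp
  let A : S × P → Set (Fin (n + 2) → W) := fun sq =>
    {η | LinearIndependent ℝ (fun j : J sq.2 => p sq.1 j + F sq.1 j (η j))}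
  have hopen : ∀ sq, IsOpen (A sq) := by
    intro sq
    have h1 := isOpen_setOfPred_linearIndependent (𝕜 := ℝ) (E := W) (ι := J sq.2)
    refine h1.preimage (f := fun (η : Fin (n + 2) → W) (j : J sq.2) =>
      p sq.1 j + F sq.1 j (η j)) ?_
    refine continuous_pi fun j => continuous_const.add ?_
    exact (LinearMap.continuous_of_finiteDimensional (F sq.1 j).toLinearMap).comp
      (continuous_apply _)
  have hdense : ∀ sq, Dense (A sq) := by
    intro sq
    exact dense_setOf_linearIndependent_add Subtype.val_injective (hJ sq.2) (fun j => p sq.1 j)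
      (fun j => F sq.1 j)
  have hall : Dense (⋂ sq, A sq) := dense_iInter_of_isOpen hopen hdense
  obtain ⟨η, hη, hd⟩ := hall.exists_dist_lt 0 hδ
  refine ⟨η, ?_, ?_⟩
  · rw [dist_zero_left, pi_norm_lt_iff hδ] at hd
    exact hd
  · intro s c hc k l hkl hk hl
    have h1 := Set.mem_iInter.1 hη (s, ⟨(k, l), hkl⟩)
    have h2 := Fintype.linearIndependent_iff.1 h1 (fun j => c j) (by
      rw [← hc, ← Finset.sum_subtype (Finset.univ.filter fun j => j ≠ k ∧ j ≠ l) (by simp)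
        (fun j => c j • (p s j + F s j (η j)))]
      refine Finset.sum_subset (Finset.subset_univ _) fun j _ hj => ?_
      have : c j = 0 := by
        by_contra hne
        refine hj (Finset.mem_filter.2 ⟨Finset.mem_univ _, ?_, ?_⟩)
        · rintro rfl; exact hne hk
        · rintro rfl; exact hne hl
      rw [this, zero_smul])
    funext j
    by_cases hjk : j = k
    · rw [hjk, hk]; rfl
    by_cases hjl : j = l
    · rw [hjl, hl]; rfl
    exact h2 ⟨j, hjk, hjl⟩

end Generic

section Stability

variable {W : Type*} [NormedAddCommGroup W] [NormedSpace ℝ W] {J : Type*} [Fintype J]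

/-- The vectors `a` contain the origin in their convex hull. -/
def HasConvexRelation (a : J → W) : Prop :=
  ∃ c ∈ stdSimplex ℝ J, ∑ k, c k • a k = 0

lemma HasPosRelation.hasConvexRelation [Nonempty J] {a : J → W} (h : HasPosRelation a) :
    HasConvexRelation a := by
  obtain ⟨c, hc, hs⟩ := h
  have hpos : 0 < ∑ k, c k := Finset.sum_pos (fun k _ => hc k) Finset.univ_nonempty
  refine ⟨fun k => (∑ k, c k)⁻¹ * c k, ⟨fun k => ?_, ?_⟩, ?_⟩
  · have := hc k; positivity
  · rw [← Finset.mul_sum, inv_mul_cancel₀ hpos.ne']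
  · simp only [mul_smul, ← Finset.smul_sum, hs, smul_zero]

lemma norm_sum_smul_sub_le {a a' : J → W} {c : J → ℝ} {δ C : ℝ} (hc : ∀ k, |c k| ≤ C)
    (hC : 0 ≤ C) (h : ∀ k, ‖a' k - a k‖ ≤ δ) (h0 : ∑ k, c k • a' k = 0) :
    ‖∑ k, c k • a k‖ ≤ Fintype.card J * (C * δ) := by
  have : ∑ k, c k • a k = - ∑ k, c k • (a' k - a k) := by
    simp only [smul_sub, Finset.sum_sub_distrib, h0]; simp
  rw [this, norm_neg]
  refine (norm_sum_le _ _).trans ?_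
  refine (Finset.sum_le_card_nsmul _ _ (C * δ) fun k _ => ?_).trans (by simp)
  rw [norm_smul]
  exact mul_le_mul (hc k) (h k) (norm_nonneg _) hC

lemma exists_stable_not_hasPosRelation [Nonempty J] {a : J → W} (h : ¬ HasConvexRelation a) :
    ∃ δ > 0, ∀ a' : J → W, (∀ k, ‖a' k - a k‖ ≤ δ) → ¬ HasPosRelation a' := by
  classical
  have hne : (stdSimplex ℝ J).Nonempty := ⟨_, single_mem_stdSimplex ℝ (Classical.arbitrary J)⟩
  have hcont : Continuous fun c : J → ℝ => ‖∑ k, c k • a k‖ := by fun_prop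
  obtain ⟨c₀, hc₀, hmin⟩ := (isCompact_stdSimplex ℝ J).exists_isMinOn hne hcont.continuousOn
  have hpos : 0 < ‖∑ k, c₀ k • a k‖ := by
    rw [norm_pos_iff]; exact fun h0 => h ⟨c₀, hc₀, h0⟩
  have hcard : (0 : ℝ) < Fintype.card J := by exact_mod_cast Fintype.card_pos
  refine ⟨‖∑ k, c₀ k • a k‖ / (2 * Fintype.card J), by positivity, fun a' ha' hp => ?_⟩
  obtain ⟨c, hc, hs⟩ := hp.hasConvexRelation
  have h1 : ∀ k, |c k| ≤ 1 := fun k => by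
    rw [abs_of_nonneg (hc.1 k), ← hc.2]
    exact Finset.single_le_sum (fun i _ => hc.1 i) (Finset.mem_univ k)
  have h2 := norm_sum_smul_sub_le h1 zero_le_one ha' hs
  have h3 : ‖∑ k, c₀ k • a k‖ ≤ ‖∑ k, c k • a k‖ := hmin hc
  have h4 : (Fintype.card J : ℝ) * (1 * (‖∑ k, c₀ k • a k‖ / (2 * Fintype.card J))) =
    ‖∑ k, c₀ k • a k‖ / 2 := by field_simp
  linarith

lemma exists_stable_hasPosRelation [FiniteDimensional ℝ W] {a : J → W}
    (hJ : Fintype.card J = Module.finrank ℝ W + 1)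
    (h : ∀ c : J → ℝ, ∑ k, c k • a k = 0 → ∀ k l, c k = c l) :
    ∃ δ > 0, ∀ a' : J → W, (∀ k, ‖a' k - a k‖ ≤ δ) → HasPosRelation a' := by
  classical
  let Z : Set (J → ℝ) := Metric.sphere 0 1 ∩ ({c | ∃ k, c k ≤ 0} ∩ {c | ∃ k, 0 ≤ c k})
  have hZ : IsCompact Z := by
    refine (isCompact_sphere _ _).inter_right (IsClosed.inter ?_ ?_)
    · have : {c : J → ℝ | ∃ k, c k ≤ 0} = ⋃ k, {c | c k ≤ 0} := by ext; simp
      rw [this]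
      exact isClosed_iUnion_of_finite fun k => isClosed_le (continuous_apply k) continuous_const
    · have : {c : J → ℝ | ∃ k, 0 ≤ c k} = ⋃ k, {c | 0 ≤ c k} := by ext; simp
      rw [this]
      exact isClosed_iUnion_of_finite fun k => isClosed_le continuous_const (continuous_apply k)
  have hcont : Continuous fun c : J → ℝ => ‖∑ k, c k • a k‖ := by fun_prop
  obtain ⟨δ, hδ, hlow⟩ : ∃ δ > 0, ∀ c ∈ Z, δ ≤ ‖∑ k, c k • a k‖ := by
    rcases Z.eq_empty_or_nonempty with he | hne
    · exact ⟨1, one_pos, by simp [he]⟩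
    · obtain ⟨c₀, hc₀, hmin⟩ := hZ.exists_isMinOn hne hcont.continuousOn
      refine ⟨_, norm_pos_iff.2 fun h0 => ?_, hmin⟩
      obtain ⟨hs, ⟨k, hk⟩, ⟨l, hl⟩⟩ := hc₀
      have hkl := h c₀ h0 k l
      have : c₀ = 0 := by
        funext j
        have := h c₀ h0 j k
        simp only [Pi.zero_apply]
        linarith
      rw [this] at hs
      simp at hs
  have hcard : (0 : ℝ) < Fintype.card J := by rw [hJ]; positivity
  refine ⟨δ / (2 * Fintype.card J), by positivity, fun a' ha' => ?_⟩
  have hdep : ¬ LinearIndependent ℝ a' := by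
    intro hli
    have := hli.fintype_card_le_finrank
    omega
  obtain ⟨g, hg, i, hi⟩ := Fintype.not_linearIndependent_iff.1 hdep
  have hgn : 0 < ‖g‖ := norm_pos_iff.2 fun h0 => hi (by rw [h0]; rfl)
  let c : J → ℝ := ‖g‖⁻¹ • g
  have hcn : ‖c‖ = 1 := by simp [c, norm_smul, hgn.ne']
  have hc0 : ∑ k, c k • a' k = 0 := by
    simp only [c, Pi.smul_apply, smul_eq_mul, mul_smul, ← Finset.smul_sum, hg, smul_zero]
  have h1 : ∀ k, |c k| ≤ 1 := fun k => by
    rw [← hcn]; exact norm_le_pi_norm c k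
  have h2 := norm_sum_smul_sub_le h1 zero_le_one ha' hc0
  have h4 : (Fintype.card J : ℝ) * (1 * (δ / (2 * Fintype.card J))) = δ / 2 := by field_simp
  have hnot : c ∉ Z := fun hc => by
    have := hlow c hc
    linarith
  simp only [Z, Set.mem_inter_iff, mem_sphere_zero_iff_norm, hcn, true_and, not_and_or] at hnot
  rcases hnot with h3 | h3
  · refine ⟨c, fun k => ?_, hc0⟩
    by_contra hk
    exact h3 ⟨k, not_lt.1 hk⟩
  · refine ⟨-c, fun k => ?_, by simp [hc0]⟩
    by_contra hk
    refine h3 ⟨k, ?_⟩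
    simpa using hk

end Stability

namespace PrismSimplex

variable {I : Type} [Fintype I] {M : ℕ}

lemma vert_lt (σ : PrismSimplex I M) {k : Fin (Fintype.card I + 2)} {i : Option I}
    (h : (σ.2.2.symm i).val < k.val) : vert σ k i = center σ.1 i := by
  simp [vert, h]

lemma vert_ge (σ : PrismSimplex I M) {k : Fin (Fintype.card I + 2)} {i : Option I}
    (h : k.val ≤ (σ.2.2.symm i).val) : vert σ k i = center σ.1 i + σ.2.1 i := by
  simp [vert, not_lt.2 h]

/-- The number of odd coordinates. -/
def oddCount (x : Option I → ℤ) : ℕ := (Finset.univ.filter fun o => Odd (x o)).card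

lemma odd_center {J : Type} (z : J → Fin (2 * M)) (o : Option J) : Odd (center z o) := by
  cases o with
  | none => exact odd_one
  | some i => exact ⟨z i - M, by simp only [center]; ring⟩

lemma odd_vert_iff (σ : PrismSimplex I M) (k : Fin (Fintype.card I + 2)) (o : Option I) :
    Odd (vert σ k o) ↔ (σ.2.2.symm o).val < k.val := by
  by_cases h : (σ.2.2.symm o).val < k.val
  · simp [vert_lt σ h, h, odd_center]
  · simp only [vert_ge σ (not_lt.1 h), h, iff_false, Int.not_odd_iff_even]
    refine (odd_center _ _).add_odd ?_
    rcases Int.units_eq_one_or (σ.2.1 o) with hs | hs <;> simp [hs]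

lemma oddCount_vert (σ : PrismSimplex I M) (k : Fin (Fintype.card I + 2)) :
    oddCount (vert σ k) = k.val := by
  simp only [oddCount, odd_vert_iff]
  have : (Finset.univ.filter fun o => (σ.2.2.symm o).val < k.val) =
      (Finset.univ.filter fun l : Fin (Fintype.card I + 1) => l.val < k.val).map
        σ.2.2.toEmbedding := by
    ext o; simp
  rw [this, Finset.card_map, Fin.card_filter_val_lt]
  have := k.isLt
  omega

lemma oddCount_act (τ : Equiv.Perm I) (ε : I → ℤˣ) (x : Option I → ℤ) :
    oddCount (act τ ε x) = oddCount x := by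
  have h : ∀ o, Odd (act τ ε x o) ↔ Odd (x (τ.optionCongr o)) := by
    intro o
    cases o with
    | none => simp [act]
    | some j => rcases Int.units_eq_one_or (ε j) with hs | hs <;> simp [act, hs]
  simp only [oddCount, h]
  refine Finset.card_bij (fun o _ => τ.optionCongr o) (fun o ho => ?_)
    (fun _ _ _ _ hab => τ.optionCongr.injective hab)
    (fun o ho => ⟨τ.optionCongr.symm o, ?_, Equiv.apply_symm_apply _ _⟩)
  · simpa only [Finset.mem_filter, Finset.mem_univ, true_and] using ho
  · simpa only [Finset.mem_filter, Finset.mem_univ, true_and, Equiv.apply_symm_apply] using ho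

end PrismSimplex

/-- The partial sums of a family of weights. -/
def partialWeight {N : ℕ} (c : Fin N → ℝ) (p : Fin N) : ℝ :=
  ∑ l, if p.val < l.val then 0 else c l

lemma partialWeight_const {N : ℕ} (t : ℝ) (p : Fin N) :
    partialWeight (fun _ => t) p = (p.val + 1) * t := by
  have h : ∀ l : Fin N, (if p.val < l.val then 0 else t) = if l.val < p.val + 1 then t else 0 := by
    intro l; split_ifs <;> first | rfl | omega
  simp only [partialWeight, h]
  rw [← Finset.sum_filter, Finset.sum_const, Fin.card_filter_val_lt, nsmul_eq_mul]
  rw [min_eq_right (by have := p.isLt; omega)]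
  push_cast; ring

lemma partialWeight_nonneg {N : ℕ} {c : Fin N → ℝ} (hc : ∀ l, 0 ≤ c l) (p : Fin N) :
    0 ≤ partialWeight c p :=
  Finset.sum_nonneg fun l _ => by split_ifs <;> simp [hc]

lemma partialWeight_mono {N : ℕ} {c : Fin N → ℝ} (hc : ∀ l, 0 ≤ c l) :
    Monotone (partialWeight c) := by
  intro p p' h
  refine Finset.sum_le_sum fun l _ => ?_
  have : p.val ≤ p'.val := h
  split_ifs <;> first | exact le_rfl | exact hc l | omega

lemma partialWeight_le_sum {N : ℕ} {c : Fin N → ℝ} (hc : ∀ l, 0 ≤ c l) (p : Fin N) :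
    partialWeight c p ≤ ∑ l, c l :=
  Finset.sum_le_sum fun l _ => by split_ifs <;> simp [hc]

lemma partialWeight_sub {N : ℕ} {c : Fin N → ℝ} {p p' : Fin N} (h : p'.val = p.val + 1) :
    partialWeight c p' - partialWeight c p = c p' := by
  simp only [partialWeight, ← Finset.sum_sub_distrib]
  rw [Finset.sum_eq_single p']
  · simp [h]
  · intro l _ hl
    have : l.val ≠ p'.val := fun h => hl (Fin.ext h)
    split_ifs <;> first | ring1 | omega
  · simp

lemma partialWeight_last {N : ℕ} (c : Fin (N + 1) → ℝ) :
    partialWeight c (Fin.last N) = ∑ l, c l := by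
  refine Finset.sum_congr rfl fun l _ => ?_
  rw [if_neg]
  have := l.isLt
  simp only [Fin.val_last]; omega

lemma partialWeight_zero {N : ℕ} (c : Fin (N + 1) → ℝ) : partialWeight c 0 = c 0 := by
  rw [partialWeight, Finset.sum_eq_single 0]
  · simp
  · intro l _ hl
    rw [if_pos]
    exact Fin.pos_iff_ne_zero.2 hl
  · simp

lemma eq_zero_of_partialWeight_eq_zero {N : ℕ} {c : Fin N → ℝ} (h : ∀ p, partialWeight c p = 0) :
    c = 0 := by
  cases N with
  | zero => exact Subsingleton.elim _ _
  | succ N =>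
    funext p
    refine Fin.cases ?_ (fun q => ?_) p
    · rw [← partialWeight_zero c, h]; rfl
    · rw [← partialWeight_sub (c := c) (p := q.castSucc) (p' := q.succ) (by simp), h, h]; simp

namespace PrismSimplex

variable {I : Type} [Fintype I] {M : ℕ}

lemma sum_mul_face_last (σ : PrismSimplex I M) (c : Fin (Fintype.card I + 1) → ℝ) (o : Option I) :
    ∑ l, c l * (face σ (Fin.last _) l o : ℝ) =
      (∑ l, c l) * center σ.1 o + (σ.2.1 o : ℤ) * partialWeight c (σ.2.2.symm o) := by
  simp only [face, vert, partialWeight, Finset.mul_sum, Finset.sum_mul, ← Finset.sum_add_distrib]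
  refine Finset.sum_congr rfl fun l _ => ?_
  simp only [Fin.succAbove_last, Fin.val_castSucc]
  split_ifs <;> push_cast <;> ring

lemma symm_some_lt {σ : PrismSimplex I M} (h : σ.2.2 (Fin.last _) = none) (i : I) :
    (σ.2.2.symm (some i)).val < Fintype.card I := by
  have h1 := (σ.2.2.symm (some i)).isLt
  have h2 : (σ.2.2.symm (some i)).val ≠ Fintype.card I := by
    intro h3
    have : σ.2.2.symm (some i) = Fin.last _ := Fin.ext h3
    rw [Equiv.symm_apply_eq, h] at this
    simp at this
  omega

lemma symm_none {σ : PrismSimplex I M} (h : σ.2.2 (Fin.last _) = none) :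
    σ.2.2.symm none = Fin.last _ := by
  rw [Equiv.symm_apply_eq, h]

/-- The floor simplices have affinely independent vertices. -/
lemma face_last_affine {σ : PrismSimplex I M} (h : σ.2.2 (Fin.last _) = none)
    {c : Fin (Fintype.card I + 1) → ℝ} (h0 : ∑ l, c l = 0)
    (h1 : ∀ i : I, ∑ l, c l * (face σ (Fin.last _) l (some i) : ℝ) = 0) : c = 0 := by
  refine eq_zero_of_partialWeight_eq_zero fun p => ?_
  obtain ⟨o, rfl⟩ := σ.2.2.symm.surjective p
  cases o with
  | none => rw [symm_none h, partialWeight_last, h0]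
  | some i =>
    have := h1 i
    rw [sum_mul_face_last, h0, zero_mul, zero_add] at this
    rcases Int.units_eq_one_or (σ.2.1 (some i)) with hs | hs <;> simpa [hs] using this

/-- The barycentre of a floor simplex lies in no other floor simplex. -/
lemma eq_of_barycenter_mem {σ σ' : PrismSimplex I M} (h : σ.2.2 (Fin.last _) = none)
    (h' : σ'.2.2 (Fin.last _) = none) (hs : σ.2.1 none = σ'.2.1 none)
    {c : Fin (Fintype.card I + 1) → ℝ} (hc : c ∈ stdSimplex ℝ (Fin (Fintype.card I + 1)))
    (hb : ∀ i : I, ∑ l, c l * (face σ (Fin.last _) l (some i) : ℝ) =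
      ∑ l, ((Fintype.card I + 1 : ℝ))⁻¹ * (face σ' (Fin.last _) l (some i) : ℝ)) : σ = σ' := by
  have hn : (0 : ℝ) < (Fintype.card I : ℝ) + 1 := by positivity
  have key : ∀ i : I, σ.1 i = σ'.1 i ∧ σ.2.1 (some i) = σ'.2.1 (some i) ∧
      partialWeight c (σ.2.2.symm (some i)) =
        ((σ'.2.2.symm (some i)).val + 1) * ((Fintype.card I : ℝ) + 1)⁻¹ := by
    intro i
    have h1 := hb i
    rw [sum_mul_face_last, sum_mul_face_last σ' (fun _ => ((Fintype.card I : ℝ) + 1)⁻¹), hc.2,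
      partialWeight_const] at h1
    have h2 : ∑ _l : Fin (Fintype.card I + 1), ((Fintype.card I : ℝ) + 1)⁻¹ = 1 := by
      simp; field_simp
    rw [h2] at h1
    have hm0 := partialWeight_nonneg hc.1 (σ.2.2.symm (some i))
    have hm1 := partialWeight_le_sum hc.1 (σ.2.2.symm (some i))
    rw [hc.2] at hm1
    set μ := partialWeight c (σ.2.2.symm (some i))
    have hlt : ((σ'.2.2.symm (some i)).val : ℝ) < Fintype.card I := by
      exact_mod_cast symm_some_lt h' i
    set μ' := (((σ'.2.2.symm (some i)).val : ℝ) + 1) * ((Fintype.card I : ℝ) + 1)⁻¹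
    have hm0' : 0 < μ' := by positivity
    have hm1' : μ' < 1 := by
      change _ * _ < _
      rw [← div_eq_mul_inv, div_lt_one hn]; linarith
    simp only [center] at h1
    push_cast at h1
    have hz : ∀ a b : ℤ, (2 * (a : ℝ) - 2 * b < 2) → (2 * (b : ℝ) - 2 * a < 2) → a = b := by
      intro a b h3 h4
      have h3 : 2 * a - 2 * b < 2 := by exact_mod_cast h3
      have h4 : 2 * b - 2 * a < 2 := by exact_mod_cast h4
      omega
    have hzz : ((σ.1 i).val : ℤ) = (σ'.1 i).val := by
      apply hz <;> push_cast <;>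
      rcases Int.units_eq_one_or (σ.2.1 (some i)) with hs | hs <;>
      rcases Int.units_eq_one_or (σ'.2.1 (some i)) with hs' | hs' <;>
      rw [hs, hs'] at h1 <;> push_cast at h1 <;> linarith
    have hzr : ((σ.1 i).val : ℝ) = (σ'.1 i).val := by exact_mod_cast hzz
    refine ⟨Fin.ext (by exact_mod_cast hzz), ?_⟩
    rcases Int.units_eq_one_or (σ.2.1 (some i)) with hs | hs <;>
    rcases Int.units_eq_one_or (σ'.2.1 (some i)) with hs' | hs' <;>
    rw [hs, hs'] at h1 ⊢ <;> push_cast at h1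
    · exact ⟨rfl, by linarith⟩
    · exfalso; linarith
    · exfalso; linarith
    · exact ⟨rfl, by linarith⟩
  refine Prod.ext (funext fun i => (key i).1) (Prod.ext (funext fun o => ?_) ?_)
  · cases o with
    | none => exact hs
    | some i => exact (key i).2.1
  · have hmono : StrictMono fun p => σ.2.2.symm (σ'.2.2 p) := by
      intro p p' hpp
      obtain ⟨o, rfl⟩ := σ'.2.2.symm.surjective p
      obtain ⟨o', rfl⟩ := σ'.2.2.symm.surjective p'
      simp only [Equiv.apply_symm_apply]
      cases o with
      | none =>
        rw [symm_none h'] at hpp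
        exact absurd hpp (not_lt.2 (Fin.le_last _))
      | some i =>
        cases o' with
        | none =>
          rw [symm_none h]
          exact symm_some_lt h i
        | some j =>
          by_contra hle
          have h1 := partialWeight_mono hc.1 (not_lt.1 hle)
          rw [(key i).2.2, (key j).2.2] at h1
          have h2 : ((σ'.2.2.symm (some i)).val : ℝ) < (σ'.2.2.symm (some j)).val := by
            exact_mod_cast hpp
          have h3 : 0 < ((Fintype.card I : ℝ) + 1)⁻¹ := by positivity
          nlinarith
    have hid : ∀ p, σ.2.2.symm (σ'.2.2 p) = p := by
      intro p
      have := Subsingleton.elim (hmono.orderIsoOfSurjective _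
        (σ.2.2.symm.surjective.comp σ'.2.2.surjective)) (OrderIso.refl _)
      exact congrArg (fun f => f p) this
    ext1 p
    have := hid p
    rw [Equiv.symm_apply_eq] at this
    exact this.symm

end PrismSimplex

/-- The cube `[-1, 1]^I`. -/
def unitCube (I : Type) : Set (I → ℝ) := {x | ∀ i, |x i| ≤ 1}

lemma isCompact_unitCube (I : Type) [Fintype I] : IsCompact (unitCube I) := by
  have : unitCube I = Set.pi Set.univ fun _ => Set.Icc (-1 : ℝ) 1 := by
    ext x; simp [unitCube, abs_le, Pi.le_def, forall_and]
  rw [this]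
  exact isCompact_univ_pi fun _ => isCompact_Icc

lemma exists_mesh_not_hasConvexRelation {X W : Type*} [PseudoMetricSpace X] [NormedAddCommGroup W]
    [NormedSpace ℝ W] {C : Set X} (hC : IsCompact C) {Ψ : X → W} (hΨ : ContinuousOn Ψ C)
    (h0 : ∀ x ∈ C, Ψ x ≠ 0) :
    ∃ ω > 0, ∀ (n : ℕ) (a : Fin (n + 1) → X), (∀ k, a k ∈ C) → (∀ k l, dist (a k) (a l) ≤ ω) →
      ¬ HasConvexRelation fun k => Ψ (a k) := by
  rcases C.eq_empty_or_nonempty with rfl | hne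
  · exact ⟨1, one_pos, fun n a ha => absurd (ha 0) (by simp)⟩
  obtain ⟨x₀, hx₀, hmin⟩ := hC.exists_isMinOn hne hΨ.norm
  have hδ : 0 < ‖Ψ x₀‖ := norm_pos_iff.2 (h0 x₀ hx₀)
  obtain ⟨ω, hω, hunif⟩ := Metric.uniformContinuousOn_iff.1
    (hC.uniformContinuousOn_of_continuous hΨ) ‖Ψ x₀‖ hδ
  refine ⟨ω / 2, by positivity, ?_⟩
  rintro n a ha hd ⟨c, hc, hs⟩
  have h1 : Ψ (a 0) = ∑ k, c k • (Ψ (a 0) - Ψ (a k)) := by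
    simp only [smul_sub, Finset.sum_sub_distrib, hs, ← Finset.sum_smul, hc.2]; simp
  have h2 : ∀ k, ‖Ψ (a 0) - Ψ (a k)‖ < ‖Ψ x₀‖ := fun k => by
    rw [← dist_eq_norm]
    exact hunif _ (ha 0) _ (ha k) ((hd 0 k).trans_lt (by linarith))
  have h3 : ‖Ψ (a 0)‖ < ‖Ψ x₀‖ := by
    obtain ⟨j, hj⟩ : ∃ j, 0 < c j := by
      by_contra! hcon
      have : ∑ k, c k ≤ 0 := Finset.sum_nonpos fun k _ => hcon k
      rw [hc.2] at this
      linarith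
    calc ‖Ψ (a 0)‖ ≤ ∑ k, ‖c k • (Ψ (a 0) - Ψ (a k))‖ := by
          conv_lhs => rw [h1]
          exact norm_sum_le _ _
      _ = ∑ k, c k * ‖Ψ (a 0) - Ψ (a k)‖ := Finset.sum_congr rfl fun k _ => by
          rw [norm_smul, Real.norm_of_nonneg (hc.1 k)]
      _ < ∑ k, c k * ‖Ψ x₀‖ := Finset.sum_lt_sum
          (fun k _ => mul_le_mul_of_nonneg_left (h2 k).le (hc.1 k))
          ⟨j, Finset.mem_univ _, mul_lt_mul_of_pos_left (h2 j) hj⟩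
      _ = ‖Ψ x₀‖ := by rw [← Finset.sum_mul, hc.2, one_mul]
  have h4 : ‖Ψ x₀‖ ≤ ‖Ψ (a 0)‖ := hmin (ha 0)
  linarith

lemma not_hasConvexRelation_of_sign {I J : Type*} [Fintype I] [Fintype J] {a : J → I → ℝ} (i : I)
    {u : ℝ} (h : ∀ k, 0 < a k i * u) : ¬ HasConvexRelation a := by
  rintro ⟨c, hc, hs⟩
  have h1 : ∑ k, c k * (a k i * u) = 0 := by
    have := congrFun hs i
    simp only [Finset.sum_apply, Pi.smul_apply, smul_eq_mul, Pi.zero_apply] at this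
    simp only [← mul_assoc, ← Finset.sum_mul, this, zero_mul]
  have h2 := (Finset.sum_eq_zero_iff_of_nonneg fun k _ => mul_nonneg (hc.1 k) (h k).le).1 h1
  have h3 : ∑ k, c k = 0 := Finset.sum_eq_zero fun k hk => by
    have := h2 k hk
    rcases mul_eq_zero.1 this with h | h'
    · exact h
    · exact absurd h' (h k).ne'
  rw [hc.2] at h3
  exact one_ne_zero h3

/-- Gluing data for the cube: for every coordinate `i`, an involution of the cube by a signed
permutation of the coordinates which exchanges the two facets of direction `i`, together with a
linear automorphism of the target space. -/
structure CubeGluing (I : Type) where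
  perm : I → Equiv.Perm I
  sign : I → I → ℤˣ
  perm_perm : ∀ i j, perm i (perm i j) = j
  sign_mul : ∀ i j, sign i j * sign i (perm i j) = 1
  perm_self : ∀ i, perm i i = i
  sign_self : ∀ i, sign i i = -1
  rep : I → (I → ℝ) ≃ₗ[ℝ] (I → ℝ)

namespace CubeGluing

variable {I : Type} (G : CubeGluing I)

/-- The gluing map at the facets of direction `i`. -/
def glue (i : I) (x : I → ℝ) : I → ℝ := signedPerm (G.perm i) (G.sign i) x

/-- Compatibility of a map on the cube with the gluing. -/
def Compatible (Φ : (I → ℝ) → I → ℝ) : Prop :=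
  ∀ i, ∀ x ∈ unitCube I, |x i| = 1 → Φ (G.glue i x) = G.rep i (Φ x)

end CubeGluing

namespace PrismSimplex

variable {I : Type} [Fintype I] {M : ℕ}

/-- The point of the unit cube corresponding to a grid vertex. -/
noncomputable def gridPoint (M : ℕ) (x : Option I → ℤ) : I → ℝ := fun i => x (some i) / (2 * M)

lemma gridPoint_act {J : Type} (τ : Equiv.Perm J) (ε : J → ℤˣ) (x : Option J → ℤ) :
    gridPoint M (act τ ε x) = signedPerm τ ε (gridPoint M x) := by
  funext i
  simp only [gridPoint, act, signedPerm]
  push_cast; ring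

lemma gridPoint_mem {J : Type} (hM : 0 < M) {x : Option J → ℤ} (h : ∀ j, |x (some j)| ≤ 2 * M) :
    gridPoint M x ∈ unitCube J := by
  intro i
  have hM' : (0 : ℝ) < 2 * M := by positivity
  have : |(x (some i) : ℝ)| ≤ 2 * M := by exact_mod_cast h i
  simp only [gridPoint]
  rw [abs_div, abs_of_pos hM', div_le_one hM']
  exact this

lemma abs_vert_sub_center (σ : PrismSimplex I M) (k : Fin (Fintype.card I + 2)) (o : Option I) :
    |(vert σ k o : ℝ) - center σ.1 o| ≤ 1 := by
  rcases Int.units_eq_one_or (σ.2.1 o) with hs | hs <;> simp only [vert, hs] <;> split_ifs <;> simp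

lemma abs_vert_sub_vert (σ : PrismSimplex I M) (k l : Fin (Fintype.card I + 2)) (o : Option I) :
    |(vert σ k o : ℝ) - vert σ l o| ≤ 1 := by
  rcases Int.units_eq_one_or (σ.2.1 o) with hs | hs <;> simp only [vert, hs] <;>
    split_ifs <;> simp

lemma dist_gridPoint_vert (hM : 0 < M) (σ : PrismSimplex I M) (k l : Fin (Fintype.card I + 2)) :
    dist (gridPoint M (vert σ k)) (gridPoint M (vert σ l)) ≤ 1 / (2 * M) := by
  have hM' : (0 : ℝ) < 2 * M := by positivity
  rw [dist_pi_le_iff (by positivity)]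
  intro i
  simp only [gridPoint, Real.dist_eq]
  rw [← sub_div, abs_div, abs_of_pos hM']
  exact (div_le_div_iff_of_pos_right hM').2 (abs_vert_sub_vert σ k l _)

/-- A floor simplex with prescribed cell. -/
noncomputable def floorSimplex (z : I → Fin (2 * M)) : PrismSimplex I M :=
  (z, fun _ => -1, finSuccEquivLast.trans (Fintype.equivFin I).symm.optionCongr)

lemma floorSimplex_last (z : I → Fin (2 * M)) : (floorSimplex z).2.2 (Fin.last _) = none := by
  simp [floorSimplex]

lemma exists_cell_near (hM : 0 < M) {t : ℝ} (ht : |t| < 1) :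
    ∃ z : Fin (2 * M), |(2 * (z : ℝ) + 1 - 2 * M) - 2 * M * t| ≤ 1 := by
  obtain ⟨h1, h2⟩ := abs_lt.1 ht
  have hM' : (0 : ℝ) < M := by positivity
  have h3 : (0 : ℝ) ≤ M * (t + 1) := by nlinarith
  have h4 := Nat.floor_le h3
  have h5 := Nat.lt_floor_add_one (M * (t + 1) : ℝ)
  refine ⟨⟨⌊(M * (t + 1) : ℝ)⌋₊, ?_⟩, ?_⟩
  · rw [Nat.floor_lt h3]; push_cast; nlinarith
  · rw [abs_le]; simp only; constructor <;> linarith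

end PrismSimplex

open PrismSimplex in
/-- A compatible map without zeros cannot exist in the presence of a compatible model map with a
single nondegenerate zero, provided the gluing is compatible with a frame field `F`. -/
theorem CubeGluing.exists_zero {I : Type} [Fintype I] [DecidableEq I] (G : CubeGluing I)
    (F : (I → ℝ) → (I → ℝ) ≃ₗ[ℝ] (I → ℝ))
    (hF : ∀ i, ∀ x ∈ unitCube I, |x i| = 1 → ∀ w, F (G.glue i x) w = G.rep i (F x w))
    (hFn : ∀ x w, ‖F x w‖ ≤ ‖w‖) {Φ₀ Φ : (I → ℝ) → I → ℝ}
    (hΦ₀c : ContinuousOn Φ₀ (unitCube I)) (hΦc : ContinuousOn Φ (unitCube I))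
    (hΦ₀ : G.Compatible Φ₀) (hΦ : G.Compatible Φ) {p₀ : I → ℝ} {r : ℝ} (hr : 0 < r)
    (hp₀ : ∀ i, |p₀ i| + 2 * r < 1) (hzero : ∀ x ∈ unitCube I, Φ₀ x = 0 → x = p₀)
    (hsign : ∀ x, (∀ i, |x i - p₀ i| ≤ 2 * r) → ∀ i, x i ≠ p₀ i → 0 < Φ₀ x i * (x i - p₀ i)) :
    ∃ x ∈ unitCube I, Φ x = 0 := by
  classical
  by_contra! hne
  set n := Fintype.card I with hn
  obtain ⟨ω₁, hω₁, hmesh₁⟩ := exists_mesh_not_hasConvexRelation (isCompact_unitCube I) hΦc hne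
  let C : Set (I → ℝ) := unitCube I ∩ {x | ∃ i, r ≤ |x i - p₀ i|}
  have hC : IsCompact C := by
    refine (isCompact_unitCube I).inter_right ?_
    have : {x : I → ℝ | ∃ i, r ≤ |x i - p₀ i|} = ⋃ i, {x | r ≤ |x i - p₀ i|} := by ext; simp
    rw [this]
    exact isClosed_iUnion_of_finite fun i => isClosed_le continuous_const (by fun_prop)
  obtain ⟨ω₂, hω₂, hmesh₂⟩ := exists_mesh_not_hasConvexRelation hC
    (hΦ₀c.mono Set.inter_subset_left) (by
      rintro x ⟨hx, i, hi⟩ h0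
      rw [hzero x hx h0] at hi
      simp at hi; linarith)
  obtain ⟨M, hM, hMω₁, hMω₂, hMr⟩ : ∃ M : ℕ, 0 < M ∧ 1 / (2 * (M : ℝ)) ≤ ω₁ ∧
      1 / (2 * (M : ℝ)) ≤ ω₂ ∧ 1 / (2 * (M : ℝ)) ≤ r / 4 := by
    have h0 : Filter.Tendsto (fun M : ℕ => 1 / (2 * (M : ℝ))) Filter.atTop (nhds 0) := by
      refine tendsto_const_nhds.div_atTop ?_
      exact tendsto_natCast_atTop_atTop.const_mul_atTop two_pos
    have h4 : (0 : ℝ) < r / 4 := by positivity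
    obtain ⟨M, h⟩ := ((Filter.eventually_gt_atTop 0).and ((h0.eventually_le_const hω₁).and
      ((h0.eventually_le_const hω₂).and (h0.eventually_le_const h4)))).exists
    exact ⟨M, h⟩
  have hM' : (0 : ℝ) < 2 * M := by positivity
  have hp1 : ∀ i, |p₀ i| < 1 := fun i => by have := hp₀ i; linarith
  choose z hz using fun i => exists_cell_near hM (hp1 i)
  let σ₀ : PrismSimplex I M := floorSimplex z
  have hσ₀ : σ₀.2.2 (Fin.last _) = none := floorSimplex_last z
  have hvp : ∀ k i, |gridPoint M (vert σ₀ k) i - p₀ i| ≤ 2 * (1 / (2 * M)) := by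
    intro k i
    have h1 := abs_vert_sub_center σ₀ k (some i)
    have h2 := hz i
    have h3 : (center σ₀.1 (some i) : ℝ) = 2 * (z i : ℝ) + 1 - 2 * M := by
      simp [σ₀, floorSimplex, center]
    rw [h3] at h1
    have h4 : gridPoint M (vert σ₀ k) i - p₀ i =
        ((vert σ₀ k (some i) : ℝ) - 2 * M * p₀ i) / (2 * M) := by
      simp only [gridPoint]; field_simp
    rw [h4, abs_div, abs_of_pos hM', mul_one_div]
    refine div_le_div_of_nonneg_right ?_ hM'.le
    calc |(vert σ₀ k (some i) : ℝ) - 2 * M * p₀ i|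
        ≤ |(vert σ₀ k (some i) : ℝ) - (2 * (z i : ℝ) + 1 - 2 * M)| +
          |(2 * (z i : ℝ) + 1 - 2 * M) - 2 * M * p₀ i| := abs_sub_le _ _ _
      _ ≤ 2 := by linarith
  let f₀ : Fin (n + 1) → I → ℝ := fun l => gridPoint M (face σ₀ (Fin.last _) l)
  let q : I → ℝ := ∑ l, ((n : ℝ) + 1)⁻¹ • f₀ l
  have hcard : ∑ _l : Fin (n + 1), ((n : ℝ) + 1)⁻¹ = 1 := by
    have : (0 : ℝ) < n + 1 := by positivity
    simp; field_simp
  have hq : ∀ i, |q i - p₀ i| ≤ 2 * (1 / (2 * M)) := by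
    intro i
    have h1 : q i - p₀ i = ∑ l, ((n : ℝ) + 1)⁻¹ * (f₀ l i - p₀ i) := by
      simp only [mul_sub, Finset.sum_sub_distrib, ← Finset.sum_mul, hcard]
      simp [q]
    rw [h1]
    calc |∑ l, ((n : ℝ) + 1)⁻¹ * (f₀ l i - p₀ i)|
        ≤ ∑ l, |((n : ℝ) + 1)⁻¹ * (f₀ l i - p₀ i)| := Finset.abs_sum_le_sum_abs _ _
      _ ≤ ∑ _l : Fin (n + 1), ((n : ℝ) + 1)⁻¹ * (2 * (1 / (2 * M))) := by
          refine Finset.sum_le_sum fun l _ => ?_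
          rw [abs_mul, abs_of_pos (show 0 < ((n : ℝ) + 1)⁻¹ by positivity)]
          exact mul_le_mul_of_nonneg_left (hvp _ i) (by positivity)
      _ = 2 * (1 / (2 * M)) := by rw [← Finset.sum_mul, hcard, one_mul]
  let φ : (Option I → ℤ) → I → ℝ := fun x =>
    if x none = 0 then
      if ∀ i, |gridPoint M x i - p₀ i| ≤ r then gridPoint M x - q else Φ₀ (gridPoint M x)
    else Φ (gridPoint M x)
  have hnone : ∀ σ : PrismSimplex I M, σ.2.2 (Fin.last _) = none → ∀ l,
      face σ (Fin.last _) l none = 1 + σ.2.1 none := by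
    intro σ hσ l
    refine vert_ge σ ?_
    rw [symm_none hσ]
    simp only [Fin.succAbove_last, Fin.val_castSucc, Fin.val_last]
    have := l.isLt
    omega
  have hcube : ∀ (σ : PrismSimplex I M) k, gridPoint M (vert σ k) ∈ unitCube I := fun σ k =>
    gridPoint_mem hM fun j => abs_vert_le σ k j
  have hother : ∀ σ : PrismSimplex I M, σ.2.2 (Fin.last _) = none → σ ≠ σ₀ →
      ¬ HasConvexRelation fun l => φ (face σ (Fin.last _) l) := by
    intro σ hσ hne
    rcases Int.units_eq_one_or (σ.2.1 none) with hs | hs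
    · have h1 : ∀ l, φ (face σ (Fin.last _) l) = Φ (gridPoint M (face σ (Fin.last _) l)) := by
        intro l
        simp only [φ]
        rw [if_neg]
        rw [hnone σ hσ, hs]; decide
      simp only [h1]
      exact hmesh₁ n _ (fun k => hcube σ _)
        fun k l => (dist_gridPoint_vert hM σ _ _).trans hMω₁
    · have h1 : ∀ l, φ (face σ (Fin.last _) l) =
          if ∀ i, |gridPoint M (face σ (Fin.last _) l) i - p₀ i| ≤ r then
            gridPoint M (face σ (Fin.last _) l) - q
          else Φ₀ (gridPoint M (face σ (Fin.last _) l)) := by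
        intro l
        simp only [φ]
        rw [if_pos]
        rw [hnone σ hσ, hs]; decide
      by_cases hin : ∀ l, ∀ i, |gridPoint M (face σ (Fin.last _) l) i - p₀ i| ≤ r
      · have h2 : ∀ l, φ (face σ (Fin.last _) l) = gridPoint M (face σ (Fin.last _) l) - q :=
          fun l => by rw [h1, if_pos (hin l)]
        simp only [h2]
        rintro ⟨c, hc, hrel⟩
        refine hne (eq_of_barycenter_mem hσ hσ₀ (by rw [hs]; rfl) hc fun i => ?_)
        have h3 := congrFun hrel i
        simp only [smul_sub, Finset.sum_sub_distrib, ← Finset.sum_smul, hc.2, one_smul] at h3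
        simp only [Pi.sub_apply, Finset.sum_apply, Pi.smul_apply, smul_eq_mul, q, f₀, gridPoint,
          Pi.zero_apply, mul_div_assoc', ← Finset.sum_div] at h3
        rwa [← sub_div, div_eq_zero_iff, or_iff_left hM'.ne', sub_eq_zero] at h3
      push Not at hin
      obtain ⟨l₁, i, hi⟩ := hin
      by_cases hout : ∀ l, ¬ ∀ i, |gridPoint M (face σ (Fin.last _) l) i - p₀ i| ≤ r
      · have h2 : ∀ l, φ (face σ (Fin.last _) l) = Φ₀ (gridPoint M (face σ (Fin.last _) l)) :=
          fun l => by rw [h1, if_neg (hout l)]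
        simp only [h2]
        refine hmesh₂ n _ (fun k => ⟨hcube σ _, ?_⟩)
          fun k l => (dist_gridPoint_vert hM σ _ _).trans hMω₂
        have := hout k
        push Not at this
        obtain ⟨i, hi⟩ := this
        exact ⟨i, hi.le⟩
      push Not at hout
      obtain ⟨l₂, hl₂⟩ := hout
      have hd : ∀ l l' j, |gridPoint M (face σ (Fin.last _) l) j -
          gridPoint M (face σ (Fin.last _) l') j| ≤ r / 4 := by
        intro l l' j
        rw [← Real.dist_eq]
        exact (dist_le_pi_dist _ _ j).trans ((dist_gridPoint_vert hM σ _ _).trans hMr)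
      refine not_hasConvexRelation_of_sign i
        (u := gridPoint M (face σ (Fin.last _) l₁) i - p₀ i) fun l => ?_
      have hd1 := abs_le.1 (hd l l₁ i)
      have hqi := abs_le.1 (hq i)
      rw [h1]
      split_ifs with hl
      · simp only [Pi.sub_apply]
        rcases lt_abs.1 hi with h | h
        · exact mul_pos (by linarith) (by linarith)
        · exact mul_pos_of_neg_of_neg (by linarith) (by linarith)
      · have h3 : ∀ j, |gridPoint M (face σ (Fin.last _) l) j - p₀ j| ≤ 2 * r := by
          intro j
          have h4 := abs_le.1 (hd l l₂ j)
          have h5 := abs_le.1 (hl₂ j)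
          rw [abs_le]; constructor <;> linarith
        rcases lt_abs.1 hi with h | h
        · have h6 := hsign _ h3 i (fun h => by linarith)
          have h7 : 0 < gridPoint M (face σ (Fin.last _) l) i - p₀ i := by linarith
          exact mul_pos (pos_of_mul_pos_left h6 h7.le) (by linarith)
        · have h6 := hsign _ h3 i (fun h => by linarith)
          have h7 : gridPoint M (face σ (Fin.last _) l) i - p₀ i < 0 := by linarith
          exact mul_pos_of_neg_of_neg (neg_of_mul_pos_left h6 h7.le) (by linarith)
  have hself : ∀ l, φ (face σ₀ (Fin.last _) l) = gridPoint M (face σ₀ (Fin.last _) l) - q := by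
    intro l
    simp only [φ]
    rw [if_pos, if_pos]
    · intro i
      have := hvp ((Fin.last _).succAbove l) i
      simp only [face]
      linarith
    · rw [hnone σ₀ hσ₀]; rfl
  have hself' : ∀ c : Fin (n + 1) → ℝ, ∑ l, c l • φ (face σ₀ (Fin.last _) l) = 0 →
      ∀ k l, c k = c l := by
    intro c hc
    let t : ℝ := (∑ l, c l) * ((n : ℝ) + 1)⁻¹
    have h0 : (fun l => c l - t) = 0 := by
      refine face_last_affine hσ₀ ?_ fun i => ?_
      · have : (0 : ℝ) < n + 1 := by positivity
        rw [Finset.sum_sub_distrib, sub_eq_zero, Finset.sum_const, Finset.card_univ,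
          Fintype.card_fin, nsmul_eq_mul]
        rw [show ((Fintype.card I + 1 : ℕ) : ℝ) = (n : ℝ) + 1 by push_cast; rfl]
        simp only [t]
        field_simp
        rfl
      · have h3 := congrFun hc i
        simp only [hself, smul_sub, Finset.sum_sub_distrib, ← Finset.sum_smul] at h3
        simp only [Pi.sub_apply, Finset.sum_apply, Pi.smul_apply, smul_eq_mul, q, f₀, gridPoint,
          Pi.zero_apply, mul_div_assoc', ← Finset.sum_div] at h3
        rw [← sub_div, div_eq_zero_iff, or_iff_left hM'.ne'] at h3
        simp only [sub_mul, Finset.sum_sub_distrib]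
        rw [← h3]
        congr 1
        rw [Finset.mul_sum]
        exact Finset.sum_congr rfl fun l _ => by simp only [t]; ring
    intro k l
    have hk := congrFun h0 k
    have hl := congrFun h0 l
    simp only [Pi.zero_apply] at hk hl
    linarith
  have hstable : ∀ σ : PrismSimplex I M, ∃ δ > 0, σ.2.2 (Fin.last _) = none →
      ∀ a' : Fin (n + 1) → I → ℝ, (∀ l, ‖a' l - φ (face σ (Fin.last _) l)‖ ≤ δ) →
        posRelation a' = if σ = σ₀ then 1 else 0 := by
    intro σ
    by_cases hσ : σ.2.2 (Fin.last _) = none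
    · by_cases h : σ = σ₀
      · subst h
        obtain ⟨δ, hδ, h1⟩ := exists_stable_hasPosRelation (by simp [hn]) hself'
        exact ⟨δ, hδ, fun _ a' ha' => by simp [posRelation, h1 a' ha']⟩
      · obtain ⟨δ, hδ, h1⟩ := exists_stable_not_hasPosRelation (hother σ hσ h)
        exact ⟨δ, hδ, fun _ a' ha' => by simp [posRelation, h1 a' ha', h]⟩
    · exact ⟨1, one_pos, fun h => absurd h hσ⟩
  choose δ hδ hst using hstable
  obtain ⟨δ₀, hδ₀, hδ₀le⟩ : ∃ δ₀ > 0, ∀ σ, δ₀ ≤ δ σ := by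
    have h1 : ∀ᶠ t in nhdsWithin (0 : ℝ) (Set.Ioi 0), ∀ σ, t ≤ δ σ := by
      rw [Filter.eventually_all]
      exact fun σ => nhdsWithin_le_nhds (eventually_le_nhds (hδ σ))
    obtain ⟨t, h2, h3⟩ := (h1.and self_mem_nhdsWithin).exists
    exact ⟨t, h3, h2⟩
  obtain ⟨η, hη, hgen⟩ := exists_generic_perturbation (W := I → ℝ) (n := n) (by simp [hn])
    (fun (σ : PrismSimplex I M) k => φ (vert σ k)) (fun σ k => F (gridPoint M (vert σ k))) hδ₀
  let ηe : ℕ → I → ℝ := fun c => if h : c < n + 2 then η ⟨c, h⟩ else 0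
  let ψ : (Option I → ℤ) → I → ℝ := fun x => φ x + F (gridPoint M x) (ηe (oddCount x))
  have hψ : ∀ (σ : PrismSimplex I M) k, ψ (vert σ k) =
      φ (vert σ k) + F (gridPoint M (vert σ k)) (η k) := by
    intro σ k
    have h1 : ηe k.val = η k := dif_pos k.isLt
    simp only [ψ, oddCount_vert, h1]
  have hact : ∀ (i : I) (x : Option I → ℤ), (∀ j, |x (some j)| ≤ 2 * M) → |x (some i)| = 2 * M →
      ψ (act (G.perm i) (G.sign i) x) = G.rep i (ψ x) := by
    intro i x hx hxi
    have hmem := gridPoint_mem hM hx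
    have hwall : ∀ y : Option I → ℤ, |y (some i)| = 2 * M → |gridPoint M y i| = 1 := by
      intro y hy
      have : |(y (some i) : ℝ)| = 2 * M := by exact_mod_cast hy
      simp only [gridPoint]
      rw [abs_div, this, abs_of_pos hM', div_self hM'.ne']
    have hbox : ∀ y : Option I → ℤ, |y (some i)| = 2 * M →
        ¬ ∀ j, |gridPoint M y j - p₀ j| ≤ r := by
      intro y hy h
      have h1 := hwall y hy
      have h2 := h i
      have h3 := hp₀ i
      have h4 := abs_sub_abs_le_abs_sub (gridPoint M y i) (p₀ i)
      linarith
    have hy : |act (G.perm i) (G.sign i) x (some i)| = 2 * M := by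
      simp only [act, G.perm_self, G.sign_self]
      simpa using hxi
    have hg : gridPoint M (act (G.perm i) (G.sign i) x) = G.glue i (gridPoint M x) :=
      gridPoint_act _ _ _
    have hφ : φ (act (G.perm i) (G.sign i) x) = G.rep i (φ x) := by
      have h1 : act (G.perm i) (G.sign i) x none = x none := rfl
      simp only [φ, h1]
      rw [if_neg (hbox x hxi), if_neg (hbox _ hy), hg]
      split_ifs
      · exact hΦ₀ i _ hmem (hwall x hxi)
      · exact hΦ i _ hmem (hwall x hxi)
    simp only [ψ, oddCount_act, hφ, hg, map_add]
    rw [hF i _ hmem (hwall x hxi)]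
  have hfin := sum_floor_ceiling (M := M) (fun f => posRelation fun l => ψ (f l)) G.perm G.sign
    G.perm_perm G.sign_mul G.perm_self G.sign_self (by
      intro i f hf hfi
      simp only [hact i _ (hf _) (hfi _)]
      have := hasPosRelation_comp_iff (fun l => ψ (f l)) (L := (G.rep i).toLinearMap)
        (G.rep i).injective
      simp only [LinearEquiv.coe_coe] at this
      simp only [posRelation, this]) (by
      intro σ
      refine sum_posRelation_succAbove (W := I → ℝ) (by simp) (fun k => ψ (vert σ k)) ?_
      simp only [hψ]
      exact hgen σ)
  rw [Finset.sum_congr rfl (g := fun σ => if σ = σ₀ then (1 : ZMod 2) else 0)] at hfin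
  · simp [Finset.sum_ite_eq', hσ₀] at hfin
  · intro σ hσ
    refine hst σ (Finset.mem_filter.1 hσ).2 _ fun l => ?_
    simp only [face, hψ, add_sub_cancel_left]
    exact (hFn _ _).trans ((hη _).le.trans (hδ₀le σ))

/-- The leaves of the complete binary tree of depth `D`. -/
def Leaf : ℕ → Type
  | 0 => Unit
  | D + 1 => Leaf D ⊕ Leaf D

/-- The inner nodes of the complete binary tree of depth `D`. -/
def Node : ℕ → Type
  | 0 => Empty
  | D + 1 => Option (Node D ⊕ Node D)

instance Leaf.instDecidableEq : ∀ D, DecidableEq (Leaf D)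
  | 0 => inferInstanceAs (DecidableEq Unit)
  | D + 1 => by
    have := Leaf.instDecidableEq D
    exact inferInstanceAs (DecidableEq (Leaf D ⊕ Leaf D))

instance Leaf.instFintype : ∀ D, Fintype (Leaf D)
  | 0 => inferInstanceAs (Fintype Unit)
  | D + 1 => by
    have := Leaf.instFintype D
    exact inferInstanceAs (Fintype (Leaf D ⊕ Leaf D))

instance Node.instDecidableEq : ∀ D, DecidableEq (Node D)
  | 0 => inferInstanceAs (DecidableEq Empty)
  | D + 1 => by
    have := Node.instDecidableEq D
    exact inferInstanceAs (DecidableEq (Option (Node D ⊕ Node D)))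

instance Node.instFintype : ∀ D, Fintype (Node D)
  | 0 => inferInstanceAs (Fintype Empty)
  | D + 1 => by
    have := Node.instFintype D
    exact inferInstanceAs (Fintype (Option (Node D ⊕ Node D)))

/-- A leaf of the left subtree. -/
def Leaf.inl {D : ℕ} (l : Leaf D) : Leaf (D + 1) := Sum.inl l

/-- A leaf of the right subtree. -/
def Leaf.inr {D : ℕ} (l : Leaf D) : Leaf (D + 1) := Sum.inr l

/-- Case distinction on the position of a leaf. -/
@[elab_as_elim]
def Leaf.casesSide {D : ℕ} {motive : Leaf (D + 1) → Sort*} (left : ∀ l, motive (Leaf.inl l))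
    (right : ∀ l, motive (Leaf.inr l)) : ∀ l, motive l
  | Sum.inl l => left l
  | Sum.inr l => right l

lemma Leaf.sum_succ {D : ℕ} {V : Type*} [AddCommMonoid V] (f : Leaf (D + 1) → V) :
    ∑ l, f l = (∑ l : Leaf D, f (.inl l)) + ∑ l : Leaf D, f (.inr l) :=
  Fintype.sum_sum_type (α₁ := Leaf D) (α₂ := Leaf D) f

lemma Leaf.card : ∀ D, Fintype.card (Leaf D) = 2 ^ D
  | 0 => rfl
  | D + 1 => by
    have h : Fintype.card (Leaf (D + 1)) = Fintype.card (Leaf D) + Fintype.card (Leaf D) :=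
      Fintype.card_sum (α := Leaf D) (β := Leaf D)
    rw [h, Leaf.card D, pow_succ]; ring

/-- The leftmost leaf. -/
def Leaf.first : ∀ D, Leaf D
  | 0 => ()
  | D + 1 => Sum.inl (Leaf.first D)

namespace Node

/-- The root of a tree. -/
def root {D : ℕ} : Node (D + 1) := none

/-- A node of the left subtree. -/
def left {D : ℕ} (a : Node D) : Node (D + 1) := some (Sum.inl a)

/-- A node of the right subtree. -/
def right {D : ℕ} (a : Node D) : Node (D + 1) := some (Sum.inr a)

/-- Case distinction on the position of a node. -/
@[elab_as_elim]
def casesPos {D : ℕ} {motive : Node (D + 1) → Sort*} (root : motive root)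
    (left : ∀ a, motive (left a)) (right : ∀ a, motive (right a)) : ∀ a, motive a
  | none => root
  | some (Sum.inl a) => left a
  | some (Sum.inr a) => right a

section
variable {D : ℕ} {motive : Node (D + 1) → Sort*} (h₀ : motive root)
    (h₁ : ∀ a, motive (left a)) (h₂ : ∀ a, motive (right a))

@[simp] lemma casesPos_root : casesPos h₀ h₁ h₂ root = h₀ := rfl
@[simp] lemma casesPos_left (a : Node D) : casesPos h₀ h₁ h₂ (left a) = h₁ a := rfl
@[simp] lemma casesPos_right (a : Node D) : casesPos h₀ h₁ h₂ (right a) = h₂ a := rfl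

end

@[simp] lemma left_inj {D : ℕ} {a b : Node D} : left a = left b ↔ a = b :=
  ⟨fun h => Sum.inl.inj (Option.some.inj h), congrArg _⟩
@[simp] lemma right_inj {D : ℕ} {a b : Node D} : right a = right b ↔ a = b :=
  ⟨fun h => Sum.inr.inj (Option.some.inj h), congrArg _⟩
@[simp] lemma left_ne_right {D : ℕ} {a b : Node D} : left a ≠ right b :=
  fun h => Sum.inl_ne_inr (Option.some.inj h)
@[simp] lemma right_ne_left {D : ℕ} {a b : Node D} : right a ≠ left b :=
  fun h => Sum.inr_ne_inl (Option.some.inj h)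
@[simp] lemma left_ne_root {D : ℕ} {a : Node D} : left a ≠ root := Option.some_ne_none _
@[simp] lemma right_ne_root {D : ℕ} {a : Node D} : right a ≠ root := Option.some_ne_none _
@[simp] lemma root_ne_left {D : ℕ} {a : Node D} : root ≠ left a := left_ne_root.symm
@[simp] lemma root_ne_right {D : ℕ} {a : Node D} : root ≠ right a := right_ne_root.symm

instance : IsEmpty (Node 0) := inferInstanceAs (IsEmpty Empty)

/-- The permutation of the nodes that exchanges the subtrees below a given node. -/
def swap : ∀ {D : ℕ}, Node D → Node D → Node D
  | 0, _, a => a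
  | _ + 1, j, a => casesPos (motive := fun _ => Node _)
      (casesPos (motive := fun _ => Node _) root right left a)
      (fun j' => casesPos (motive := fun _ => Node _) root (fun a' => left (swap j' a')) right a)
      (fun j' => casesPos (motive := fun _ => Node _) root left (fun a' => right (swap j' a')) a) j

section
variable {D : ℕ} (j a : Node D)

@[simp] lemma swap_root_root : swap (root (D := D)) root = root := rfl
@[simp] lemma swap_root_left : swap root (left a) = right a := rfl
@[simp] lemma swap_root_right : swap root (right a) = left a := rfl
@[simp] lemma swap_left_root : swap (left j) root = root := rfl
@[simp] lemma swap_left_left : swap (left j) (left a) = left (swap j a) := rfl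
@[simp] lemma swap_left_right : swap (left j) (right a) = right a := rfl
@[simp] lemma swap_right_root : swap (right j) root = root := rfl
@[simp] lemma swap_right_left : swap (right j) (left a) = left a := rfl
@[simp] lemma swap_right_right : swap (right j) (right a) = right (swap j a) := rfl

end

lemma swap_swap : ∀ {D : ℕ} (j a : Node D), swap j (swap j a) = a
  | 0, j, _ => isEmptyElim j
  | D + 1, j, a => by
    induction j using casesPos <;> induction a using casesPos <;> simp [swap_swap]

lemma swap_self : ∀ {D : ℕ} (j : Node D), swap j j = j
  | 0, j => isEmptyElim j
  | D + 1, j => by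
    have ih := fun j => swap_self (D := D) j
    induction j using casesPos <;> simp [ih]

/-- `swap` as an involutive permutation. -/
def swapPerm {D : ℕ} (j : Node D) : Equiv.Perm (Node D) :=
  ⟨swap j, swap j, swap_swap j, swap_swap j⟩

/-- The sign pattern of a flip at a single node. -/
def flipSign {D : ℕ} (j a : Node D) : ℤˣ := if a = j then -1 else 1

lemma flipSign_mul_flipSign_swap {D : ℕ} (j a : Node D) :
    flipSign j a * flipSign j (swap j a) = 1 := by
  have h : swap j a = j ↔ a = j := by
    constructor
    · intro h
      rw [← swap_swap j a, h, swap_self]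
    · rintro rfl
      exact swap_self a
  simp only [flipSign, h]
  split_ifs <;> simp

/-- The relabelling of the nodes determined by a choice of sign at every node. -/
def relabel : ∀ {D : ℕ}, (Node D → ℤˣ) → Node D → Node D
  | 0, _, a => a
  | _ + 1, s, a => casesPos (motive := fun _ => Node _) root
      (fun a' => if s root = 1 then left (relabel (fun b => s (left b)) a')
        else right (relabel (fun b => s (left b)) a'))
      (fun a' => if s root = 1 then right (relabel (fun b => s (right b)) a')
        else left (relabel (fun b => s (right b)) a')) a

section
variable {D : ℕ} (s : Node (D + 1) → ℤˣ) (a : Node D)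

@[simp] lemma relabel_root : relabel s root = root := rfl
lemma relabel_left : relabel s (left a) =
    if s root = 1 then left (relabel (fun b => s (left b)) a)
      else right (relabel (fun b => s (left b)) a) := rfl
lemma relabel_right : relabel s (right a) =
    if s root = 1 then right (relabel (fun b => s (right b)) a)
      else left (relabel (fun b => s (right b)) a) := rfl

end

lemma relabel_injective : ∀ {D : ℕ} (s : Node D → ℤˣ), Function.Injective (relabel s)
  | 0, _ => fun a => isEmptyElim a
  | D + 1, s => by
    intro a b
    have hl := relabel_injective (fun b => s (left b))
    have hr := relabel_injective (fun b => s (right b))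
    by_cases hs : s root = 1 <;> induction a using casesPos <;> induction b using casesPos <;>
      simp [relabel_left, relabel_right, hs, hl.eq_iff, hr.eq_iff]

/-- `relabel` as a permutation. -/
noncomputable def relabelPerm {D : ℕ} (s : Node D → ℤˣ) : Equiv.Perm (Node D) :=
  Equiv.ofBijective (relabel s) (Finite.injective_iff_bijective.1 (relabel_injective s))

lemma relabel_swap : ∀ {D : ℕ} (s : Node D → ℤˣ) (j a : Node D),
    relabel (fun b => flipSign j b * s (swap j b)) a = relabel s (swap j a)
  | 0, _, j, _ => isEmptyElim j
  | D + 1, s, j, a => by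
    have hu : ∀ u : ℤˣ, -u = 1 ↔ ¬ u = 1 := by decide
    have ih := fun s j a => relabel_swap (D := D) s j a
    have hflip : ∀ j b : Node D, flipSign (left j) (left b) = flipSign j b := by simp [flipSign]
    have hflip' : ∀ j b : Node D, flipSign (right j) (right b) = flipSign j b := by simp [flipSign]
    induction j using casesPos with
    | root =>
      induction a using casesPos with
      | root => rfl
      | left a =>
        simp only [relabel_left, relabel_right, swap_root_left, swap_root_root]
        simp [flipSign, hu]
      | right a =>
        simp only [relabel_left, relabel_right, swap_root_right, swap_root_root]
        simp [flipSign, hu]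
    | left j =>
      induction a using casesPos with
      | root => rfl
      | left a =>
        have h1 : flipSign (left j) root = 1 := by simp [flipSign]
        simp only [relabel_left, swap_left_left, swap_left_root, hflip, h1, one_mul]
        rw [ih (fun b => s (left b))]
      | right a =>
        simp only [relabel_right, swap_left_right, swap_left_root]
        simp [flipSign]
    | right j =>
      induction a using casesPos with
      | root => rfl
      | left a =>
        simp only [relabel_left, swap_right_left, swap_right_root]
        simp [flipSign]
      | right a =>
        have h1 : flipSign (right j) root = 1 := by simp [flipSign]
        simp only [relabel_right, swap_right_right, swap_right_root, hflip', h1, one_mul]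
        rw [ih (fun b => s (right b))]

end Node

namespace Leaf

open Node

/-- The permutation of the leaves that exchanges the subtrees below a given node. -/
def swap : ∀ {D : ℕ}, Node D → Leaf D → Leaf D
  | 0, _, l => l
  | _ + 1, j, l => casesPos (motive := fun _ => Leaf _)
      (casesSide (motive := fun _ => Leaf _) inr inl l)
      (fun j' => casesSide (motive := fun _ => Leaf _) (fun l' => inl (swap j' l')) inr l)
      (fun j' => casesSide (motive := fun _ => Leaf _) inl (fun l' => inr (swap j' l')) l) j

section
variable {D : ℕ} (j : Node D) (l : Leaf D)

@[simp] lemma swap_root_inl : swap root (inl l) = inr l := rfl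
@[simp] lemma swap_root_inr : swap root (inr l) = inl l := rfl
@[simp] lemma swap_left_inl : swap (left j) (inl l) = inl (swap j l) := rfl
@[simp] lemma swap_left_inr : swap (left j) (inr l) = inr l := rfl
@[simp] lemma swap_right_inl : swap (right j) (inl l) = inl l := rfl
@[simp] lemma swap_right_inr : swap (right j) (inr l) = inr (swap j l) := rfl

end

section offset

variable {V : Type*} [NormedAddCommGroup V] [NormedSpace ℝ V]

/-- A hierarchical family of small vectors on the leaves: crossing a node `a` to the left or to the
right adds or subtracts a multiple of `v a`. -/
def offset (ε : ℝ) : ∀ {D : ℕ}, (Node D → V) → Leaf D → V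
  | 0, _, _ => 0
  | _ + 1, v, l => casesSide (motive := fun _ => V)
      (fun l => ε • (v root + offset ε (fun a => v (left a)) l))
      (fun l => ε • (-v root + offset ε (fun a => v (right a)) l)) l

lemma offset_inl {D : ℕ} (ε : ℝ) (v : Node (D + 1) → V) (l : Leaf D) :
    offset ε v (inl l) = ε • (v root + offset ε (fun a => v (left a)) l) :=
  rfl

lemma offset_inr {D : ℕ} (ε : ℝ) (v : Node (D + 1) → V) (l : Leaf D) :
    offset ε v (inr l) = ε • (-v root + offset ε (fun a => v (right a)) l) :=
  rfl

lemma offset_swap (ε : ℝ) : ∀ {D : ℕ} (v : Node D → V) (j : Node D) (l : Leaf D),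
    offset ε (fun a => (flipSign j a : ℤ) • v (Node.swap j a)) l = offset ε v (swap j l)
  | 0, _, j, _ => isEmptyElim j
  | D + 1, v, j, l => by
    have ih := fun v j l => offset_swap ε (D := D) v j l
    have hflip : ∀ j b : Node D, flipSign (left j) (left b) = flipSign j b := by simp [flipSign]
    have hflip' : ∀ j b : Node D, flipSign (right j) (right b) = flipSign j b := by simp [flipSign]
    induction j using casesPos with
    | root =>
      induction l using casesSide <;> simp [offset_inl, offset_inr, flipSign]
    | left j =>
      have h1 : flipSign (left j) root = 1 := by simp [flipSign]
      induction l using casesSide with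
      | left l =>
        simp only [offset_inl, swap_left_left, swap_left_root, hflip, h1, swap_left_inl]
        rw [ih (fun b => v (left b))]
        simp
      | right l => simp [offset_inr, flipSign]
    | right j =>
      have h1 : flipSign (right j) root = 1 := by simp [flipSign]
      induction l using casesSide with
      | left l => simp [offset_inl, flipSign]
      | right l =>
        simp only [offset_inr, swap_right_right, swap_right_root, hflip', h1, swap_right_inr]
        rw [ih (fun b => v (right b))]
        simp

lemma norm_offset_le {ε C : ℝ} (hε : 0 ≤ ε) (hε' : ε ≤ 1 / 2) (hC : 0 ≤ C) :
    ∀ {D : ℕ} (v : Node D → V) (_ : ∀ a, ‖v a‖ ≤ C) (l : Leaf D), ‖offset ε v l‖ ≤ 2 * ε * C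
  | 0, _, _, _ => by simp only [offset, norm_zero]; positivity
  | D + 1, v, hv, l => by
    have key : ∀ u w : V, ‖u‖ ≤ C → ‖w‖ ≤ 2 * ε * C → ‖ε • (u + w)‖ ≤ 2 * ε * C := by
      intro u w hu hw
      rw [norm_smul, Real.norm_of_nonneg hε]
      have h1 : ‖u + w‖ ≤ C + 2 * ε * C := (norm_add_le _ _).trans (add_le_add hu hw)
      have h2 : 2 * ε * C ≤ C := by nlinarith
      nlinarith
    induction l using casesSide with
    | left l => exact key _ _ (hv _) (norm_offset_le hε hε' hC _ (fun a => hv _) l)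
    | right l =>
      exact key _ _ (by rw [norm_neg]; exact hv _)
        (norm_offset_le hε hε' hC _ (fun a => hv _) l)

lemma offset_injective {ε C c : ℝ} (hε : 0 < ε) (hε' : ε ≤ 1 / 2) (hc : 2 * ε * C < c) :
    ∀ {D : ℕ} (v : Node D → V) (_ : ∀ a, ‖v a‖ ≤ C) (_ : ∀ a, c ≤ ‖v a‖),
      Function.Injective (offset ε v)
  | 0, _, _, _ => fun _ _ _ => rfl
  | D + 1, v, hv, hv' => by
    have hC : 0 ≤ C := (norm_nonneg _).trans (hv root)
    have hl := norm_offset_le hε.le hε' hC (fun a => v (left a)) (fun a => hv _)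
    have hr := norm_offset_le hε.le hε' hC (fun a => v (right a)) (fun a => hv _)
    have key : ∀ l l' : Leaf D, offset ε v (inl l) ≠
        offset ε v (inr l' : Leaf D ⊕ Leaf D) := by
      intro l l' h
      have h1 := smul_right_injective V hε.ne' h
      have h2 : (2 : ℝ) • v root =
          offset ε (fun a => v (right a)) l' - offset ε (fun a => v (left a)) l := by
        rw [two_smul, eq_sub_iff_add_eq, add_assoc]
        change v root + offset ε (fun a => v (left a)) l =
          -v root + offset ε (fun a => v (right a)) l' at h1
        rw [h1]; abel
      have h3 := congrArg norm h2
      rw [norm_smul, Real.norm_of_nonneg two_pos.le] at h3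
      have h4 := norm_sub_le (offset ε (fun a => v (right a)) l') (offset ε (fun a => v (left a)) l)
      linarith [hl l, hr l', hv' root]
    intro l l' h
    induction l using casesSide <;> rename_i l <;> induction l' using casesSide <;> rename_i l'
    · have := offset_injective hε hε' hc _ (fun a => hv _) (fun a => hv' _)
        (add_left_cancel (smul_right_injective V hε.ne' h))
      rw [this]
    · exact absurd h (key _ _)
    · exact absurd h.symm (key _ _)
    · have := offset_injective hε hε' hc _ (fun a => hv _) (fun a => hv' _)
        (add_left_cancel (smul_right_injective V hε.ne' h))
      rw [this]

lemma continuousOn_offset {X : Type*} [TopologicalSpace X] {S : Set X} (ε : ℝ) :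
    ∀ {D : ℕ} {v : X → Node D → V} (_ : ∀ a, ContinuousOn (fun x => v x a) S) (l : Leaf D),
      ContinuousOn (fun x => offset ε (v x) l) S
  | 0, _, _, _ => continuousOn_const
  | _ + 1, _, hv, .inl l =>
    ((hv root).add (continuousOn_offset ε (fun a => hv (left a)) l)).const_smul ε
  | _ + 1, _, hv, .inr l =>
    ((hv root).neg.add (continuousOn_offset ε (fun a => hv (right a)) l)).const_smul ε

lemma map_offset {W : Type*} [NormedAddCommGroup W] [NormedSpace ℝ W] (T : V →ₗ[ℝ] W) (ε : ℝ) :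
    ∀ {D : ℕ} (v : Node D → V) (l : Leaf D), T (offset ε v l) = offset ε (fun a => T (v a)) l
  | 0, _, _ => map_zero T
  | _ + 1, v, .inl l => by
    rw [offset_inl, offset_inl, map_smul, map_add, map_offset T]
  | _ + 1, v, .inr l => by
    rw [offset_inr, offset_inr, map_smul, map_add, map_neg, map_offset T]

lemma offset_zero (ε : ℝ) : ∀ {D : ℕ} (l : Leaf D), offset ε (fun _ => (0 : V)) l = 0
  | 0, _ => rfl
  | _ + 1, .inl l => by
    rw [offset_inl, offset_zero]; simp
  | _ + 1, .inr l => by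
    rw [offset_inr, offset_zero]; simp

end offset

section diff

variable {V : Type*} [NormedAddCommGroup V]

/-- The differences between the sums over the two subtrees below each node. -/
def diff : ∀ {D : ℕ}, (Leaf D → V) → Node D → V
  | 0, _, _ => 0
  | _ + 1, f, a => casesPos (motive := fun _ => V)
      ((∑ l : Leaf _, f (inl l)) - ∑ l : Leaf _, f (inr l))
      (diff fun l => f (inl l)) (diff fun l => f (inr l)) a

lemma sum_swap : ∀ {D : ℕ} (f : Leaf D → V) (j : Node D), ∑ l, f (swap j l) = ∑ l, f l
  | 0, _, j => isEmptyElim j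
  | D + 1, f, j => by
    rw [sum_succ, sum_succ]
    induction j using casesPos with
    | root => simp only [swap_root_inl, swap_root_inr, add_comm]
    | left j =>
      simp only [swap_left_inl, swap_left_inr]
      rw [sum_swap (fun l => f (inl l))]
    | right j =>
      simp only [swap_right_inl, swap_right_inr]
      rw [sum_swap (fun l => f (inr l))]

@[simp] lemma diff_root {D : ℕ} (f : Leaf (D + 1) → V) :
    diff f root = (∑ l : Leaf D, f (inl l)) - ∑ l : Leaf D, f (inr l) := rfl

@[simp] lemma diff_left {D : ℕ} (f : Leaf (D + 1) → V) (a : Node D) :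
    diff f (left a) = diff (fun l => f (inl l)) a := rfl

@[simp] lemma diff_right {D : ℕ} (f : Leaf (D + 1) → V) (a : Node D) :
    diff f (right a) = diff (fun l => f (inr l)) a := rfl

lemma diff_swap : ∀ {D : ℕ} (f : Leaf D → V) (j a : Node D),
    diff (fun l => f (swap j l)) a = (flipSign j a : ℤ) • diff f (Node.swap j a)
  | 0, _, j, _ => isEmptyElim j
  | D + 1, f, j, a => by
    have hflip : ∀ j b : Node D, flipSign (left j) (left b) = flipSign j b := by simp [flipSign]
    have hflip' : ∀ j b : Node D, flipSign (right j) (right b) = flipSign j b := by simp [flipSign]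
    have ih := fun f j a => diff_swap (D := D) f j a
    induction j using casesPos with
    | root => induction a using casesPos <;> simp [flipSign]
    | left j =>
      induction a using casesPos with
      | root => simp [flipSign, sum_swap (fun l => f (inl l))]
      | left a => simp only [hflip, diff_left, swap_left_inl, ih (fun l => f (inl l)),
          swap_left_left]
      | right a => simp [flipSign]
    | right j =>
      induction a using casesPos with
      | root => simp [flipSign, sum_swap (fun l => f (inr l))]
      | left a => simp [flipSign]
      | right a =>
        simp only [hflip', diff_right, swap_right_inr, ih (fun l => f (inr l)), swap_right_right]

lemma eq_of_diff_eq_zero [NormedSpace ℝ V] :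
    ∀ {D : ℕ} (f : Leaf D → V) (_ : ∀ a, diff f a = 0) (l l' : Leaf D),
    f l = f l'
  | 0, _, _, _, _ => rfl
  | D + 1, f, h, l, l' => by
    have hl := eq_of_diff_eq_zero (fun l => f (inl l)) (fun a => h (left a))
    have hr := eq_of_diff_eq_zero (fun l => f (inr l)) (fun a => h (right a))
    have key : ∀ l l' : Leaf D, f (inl l) = f (inr l') := by
      intro l l'
      have h0 : (∑ l : Leaf D, f (inl l)) - ∑ l : Leaf D, f (inr l) = 0 := h root
      rw [Finset.sum_congr rfl fun x _ => hl x l, Finset.sum_congr rfl fun x _ => hr x l',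
        Finset.sum_const, Finset.sum_const, ← smul_sub, ← Nat.cast_smul_eq_nsmul ℝ,
        smul_eq_zero] at h0
      rcases h0 with h0 | h0
      · simp [Finset.card_univ, Leaf.card] at h0
      · exact sub_eq_zero.1 h0
    induction l using casesSide <;> rename_i l <;> induction l' using casesSide <;> rename_i l'
    · exact hl _ _
    · exact key _ _
    · exact (key _ _).symm
    · exact hr _ _

lemma continuousOn_diff {X : Type*} [TopologicalSpace X] {S : Set X} :
    ∀ {D : ℕ} {f : X → Leaf D → V} (_ : ∀ l, ContinuousOn (fun x => f x l) S) (a : Node D),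
      ContinuousOn (fun x => diff (f x) a) S
  | 0, _, _, a => isEmptyElim a
  | D + 1, f, hf, a => by
    induction a using casesPos with
    | root =>
      exact (continuousOn_finsetSum _ fun l _ => hf (inl l)).sub
        (continuousOn_finsetSum _ fun l _ => hf (inr l))
    | left a => exact continuousOn_diff (fun l => hf (inl l)) a
    | right a => exact continuousOn_diff (fun l => hf (inr l)) a

end diff

end Leaf

namespace Node

/-- The sign by which `haarSum`, `haarDiff` and `treeMatrix` change under the sign change
`facetSign j` of the parameters. -/
def facetChar : ∀ {D : ℕ}, Node D → ℤˣ
  | 0, _ => 1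
  | _ + 1, j => casesPos (motive := fun _ => ℤˣ) (-1) facetChar (fun _ => 1) j

/-- The sign change of the parameters associated with the facets of direction `j`. -/
def facetSign : ∀ {D : ℕ}, Node D → Node D → ℤˣ
  | 0, _, _ => 1
  | _ + 1, j, a => casesPos (motive := fun _ => ℤˣ)
      (casesPos (motive := fun _ => ℤˣ) (-1) (fun _ => 1) (fun _ => 1) a)
      (fun j' => casesPos (motive := fun _ => ℤˣ) (facetChar j') (facetSign j') (fun _ => 1) a)
      (fun j' => casesPos (motive := fun _ => ℤˣ) (facetChar j') (fun _ => 1) (facetSign j') a) j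

section
variable {D : ℕ} (j a : Node D)

@[simp] lemma facetChar_root : facetChar (root (D := D)) = -1 := rfl
@[simp] lemma facetChar_left : facetChar (left j) = facetChar j := rfl
@[simp] lemma facetChar_right : facetChar (right j) = 1 := rfl
@[simp] lemma facetSign_root_root : facetSign (root (D := D)) root = -1 := rfl
@[simp] lemma facetSign_root_left : facetSign root (left a) = 1 := rfl
@[simp] lemma facetSign_root_right : facetSign root (right a) = 1 := rfl
@[simp] lemma facetSign_left_root : facetSign (left j) root = facetChar j := rfl
@[simp] lemma facetSign_left_left : facetSign (left j) (left a) = facetSign j a := rfl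
@[simp] lemma facetSign_left_right : facetSign (left j) (right a) = 1 := rfl
@[simp] lemma facetSign_right_root : facetSign (right j) root = facetChar j := rfl
@[simp] lemma facetSign_right_left : facetSign (right j) (left a) = 1 := rfl
@[simp] lemma facetSign_right_right : facetSign (right j) (right a) = facetSign j a := rfl

end

lemma facetSign_self : ∀ {D : ℕ} (j : Node D), facetSign j j = -1
  | 0, j => isEmptyElim j
  | D + 1, j => by
    have ih := fun j => facetSign_self (D := D) j
    induction j using casesPos <;> simp [ih]

/-- The sign change `facetSign j` as a map of the parameters. -/
def facetMap {D : ℕ} (j : Node D) (t : Node D → ℝ) (a : Node D) : ℝ :=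
  ((facetSign j a : ℤ) : ℝ) * t a

section
variable {D : ℕ} (j : Node D) (t : Node (D + 1) → ℝ)

@[simp] lemma facetMap_root_root : facetMap root t root = -t root := by simp [facetMap]
lemma facetMap_root_left :
    (fun a => facetMap root t (left a)) = fun a => t (left a) := by simp [facetMap]
lemma facetMap_root_right :
    (fun a => facetMap root t (right a)) = fun a => t (right a) := by simp [facetMap]
@[simp] lemma facetMap_left_root :
    facetMap (left j) t root = ((facetChar j : ℤ) : ℝ) * t root := rfl
lemma facetMap_left_left :
    (fun a => facetMap (left j) t (left a)) = facetMap j (fun a => t (left a)) := rfl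
lemma facetMap_left_right :
    (fun a => facetMap (left j) t (right a)) = fun a => t (right a) := by simp [facetMap]
@[simp] lemma facetMap_right_root :
    facetMap (right j) t root = ((facetChar j : ℤ) : ℝ) * t root := rfl
lemma facetMap_right_left :
    (fun a => facetMap (right j) t (left a)) = fun a => t (left a) := by simp [facetMap]
lemma facetMap_right_right :
    (fun a => facetMap (right j) t (right a)) = facetMap j (fun a => t (right a)) := rfl

end

/-- A partition of unity on the tree, summed up. -/
def haarSum : ∀ {D : ℕ}, (Node D → ℝ) → ℝ
  | 0, _ => 1
  | _ + 1, t => (1 - |t root|) * haarSum (fun a => t (left a)) +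
      t root * haarSum fun a => t (right a)

/-- The Haar coefficients of the partition of unity on the tree. -/
def haarDiff : ∀ {D : ℕ}, (Node D → ℝ) → Node D → ℝ
  | 0, _, _ => 0
  | _ + 1, t, a => casesPos (motive := fun _ => ℝ)
      (t root * haarSum (fun a => t (right a)) - (1 - |t root|) * haarSum fun a => t (left a))
      (fun a => (1 - |t root|) * haarDiff (fun a => t (left a)) a)
      (fun a => t root * haarDiff (fun a => t (right a)) a) a

section
variable {D : ℕ} (t : Node (D + 1) → ℝ) (a : Node D)

lemma haarSum_succ : haarSum t = (1 - |t root|) * haarSum (fun a => t (left a)) +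
    t root * haarSum fun a => t (right a) := rfl
lemma haarDiff_root : haarDiff t root = t root * haarSum (fun a => t (right a)) -
    (1 - |t root|) * haarSum fun a => t (left a) := rfl
lemma haarDiff_left :
    haarDiff t (left a) = (1 - |t root|) * haarDiff (fun a => t (left a)) a := rfl
lemma haarDiff_right : haarDiff t (right a) = t root * haarDiff (fun a => t (right a)) a := rfl

end

lemma unit_mul_self (u : ℤˣ) : ((u : ℤ) : ℝ) * ((u : ℤ) : ℝ) = 1 := by
  rcases Int.units_eq_one_or u with rfl | rfl <;> simp

lemma abs_unit_mul (u : ℤˣ) (x : ℝ) : |((u : ℤ) : ℝ) * x| = |x| := by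
  rcases Int.units_eq_one_or u with rfl | rfl <;> simp

lemma haarSum_facetMap : ∀ {D : ℕ} (j : Node D) (t : Node D → ℝ), |t j| = 1 →
    haarSum (facetMap j t) = ((facetChar j : ℤ) : ℝ) * haarSum t
  | 0, j, _, _ => isEmptyElim j
  | D + 1, j, t, ht => by
    have ih := fun j t => haarSum_facetMap (D := D) j t
    induction j using casesPos with
    | root => simp [haarSum_succ, ht, facetMap_root_left, facetMap_root_right]
    | left j =>
      simp only [haarSum_succ, facetMap_left_root, facetMap_left_left, facetMap_left_right,
        abs_unit_mul, facetChar_left, ih j (fun a => t (left a)) ht]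
      ring
    | right j =>
      simp only [haarSum_succ, facetMap_right_root, facetMap_right_left, facetMap_right_right,
        abs_unit_mul, facetChar_right, Units.val_one, Int.cast_one, ih j (fun a => t (right a)) ht]
      linear_combination (t root * haarSum fun a => t (right a)) * unit_mul_self (facetChar j)

lemma haarDiff_facetMap : ∀ {D : ℕ} (j : Node D) (t : Node D → ℝ), |t j| = 1 → ∀ a,
    haarDiff (facetMap j t) a = ((facetChar j : ℤ) : ℝ) * haarDiff t a
  | 0, j, _, _, _ => isEmptyElim j
  | D + 1, j, t, ht, a => by
    have ih := fun j t h a => haarDiff_facetMap (D := D) j t h a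
    induction j using casesPos with
    | root =>
      induction a using casesPos <;>
        simp [haarDiff_root, haarDiff_left, haarDiff_right, ht, facetMap_root_left,
          facetMap_root_right]
    | left j =>
      induction a using casesPos <;>
      simp only [haarDiff_root, haarDiff_left, haarDiff_right, facetMap_left_root,
        facetMap_left_left, facetMap_left_right, abs_unit_mul, facetChar_left,
        ih j (fun a => t (left a)) ht, haarSum_facetMap j (fun a => t (left a)) ht] <;> ring
    | right j =>
      induction a using casesPos with
      | root =>
        simp only [haarDiff_root, facetMap_right_root, facetMap_right_left, facetMap_right_right,
          abs_unit_mul, facetChar_right, Units.val_one, Int.cast_one,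
          haarSum_facetMap j (fun a => t (right a)) ht]
        linear_combination (t root * haarSum fun a => t (right a)) * unit_mul_self (facetChar j)
      | left a =>
        simp only [haarDiff_left, facetMap_right_root, facetMap_right_left,
          abs_unit_mul, facetChar_right]
        simp
      | right a =>
        simp only [haarDiff_right, facetMap_right_root, facetMap_right_right,
          facetChar_right, Units.val_one, Int.cast_one, ih j (fun a => t (right a)) ht]
        linear_combination (t root * haarDiff (fun a => t (right a)) a) *
          unit_mul_self (facetChar j)

lemma eq_half_of_haarDiff_eq_zero : ∀ {D : ℕ} (t : Node D → ℝ), (∀ a, |t a| ≤ 1) →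
    (∀ a, haarDiff t a = 0) → (∀ a, t a = 1 / 2) ∧ haarSum t = 1
  | 0, _, _, _ => ⟨fun a => isEmptyElim a, rfl⟩
  | D + 1, t, ht, h => by
    have ihl := eq_half_of_haarDiff_eq_zero (fun a => t (left a)) (fun a => ht _)
    have ihr := eq_half_of_haarDiff_eq_zero (fun a => t (right a)) (fun a => ht _)
    have h0 := h root
    have hl := fun a => h (left a)
    have hr := fun a => h (right a)
    simp only [haarDiff_root, haarDiff_left, haarDiff_right, mul_eq_zero] at h0 hl hr
    have hl' : 1 - |t root| ≠ 0 → (∀ a, t (left a) = 1 / 2) ∧ haarSum (fun a => t (left a)) = 1 :=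
      fun hc => ihl fun a => (hl a).resolve_left hc
    have hr' : t root ≠ 0 → (∀ a, t (right a) = 1 / 2) ∧ haarSum (fun a => t (right a)) = 1 :=
      fun hc => ihr fun a => (hr a).resolve_left hc
    have hs : t root ≠ 0 := by
      intro hs
      have := (hl' (by simp [hs])).2
      simp [hs, this] at h0
    have hc : 1 - |t root| ≠ 0 := by
      intro hc
      simp [hc, (hr' hs).2, hs] at h0
    rw [(hl' hc).2, (hr' hs).2] at h0
    have h1 : t root = 1 / 2 := by
      rcases abs_cases (t root) with ⟨h1, _⟩ | ⟨h1, _⟩ <;> rw [h1] at h0 <;> linarith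
    refine ⟨fun a => ?_, ?_⟩
    · induction a using casesPos with
      | root => exact h1
      | left a => exact (hl' hc).1 a
      | right a => exact (hr' hs).1 a
    · rw [haarSum_succ, (hl' hc).2, (hr' hs).2, h1]
      norm_num [abs_of_pos]

lemma haarSum_eq_one : ∀ {D : ℕ} (t : Node D → ℝ), (∀ a, 0 < t a ∧ t a < 1) → haarSum t = 1
  | 0, _, _ => rfl
  | D + 1, t, ht => by
    rw [haarSum_succ, haarSum_eq_one _ (fun a => ht _), haarSum_eq_one _ (fun a => ht _),
      abs_of_pos (ht _).1]
    ring

lemma haarDiff_mul_sub_half_pos : ∀ {D : ℕ} (t : Node D → ℝ), (∀ a, 0 < t a ∧ t a < 1) →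
    ∀ a, t a ≠ 1 / 2 → 0 < haarDiff t a * (t a - 1 / 2)
  | 0, _, _, a, _ => isEmptyElim a
  | D + 1, t, ht, a, ha => by
    have h0 := ht root
    induction a using casesPos with
    | root =>
      rw [haarDiff_root, haarSum_eq_one _ (fun a => ht _), haarSum_eq_one _ (fun a => ht _),
        abs_of_pos (ht _).1]
      have := sq_pos_of_ne_zero (sub_ne_zero.2 ha)
      nlinarith
    | left a =>
      rw [haarDiff_left, mul_assoc, abs_of_pos h0.1]
      exact mul_pos (by linarith [h0.2]) (haarDiff_mul_sub_half_pos _ (fun a => ht _) a ha)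
    | right a =>
      rw [haarDiff_right, mul_assoc]
      exact mul_pos h0.1 (haarDiff_mul_sub_half_pos _ (fun a => ht _) a ha)

lemma continuous_haarSum : ∀ {D : ℕ}, Continuous (haarSum (D := D))
  | 0 => continuous_const
  | D + 1 => by
    have ih := continuous_haarSum (D := D)
    simp only [funext haarSum_succ]
    fun_prop

lemma continuous_haarDiff : ∀ {D : ℕ} (a : Node D), Continuous fun t => haarDiff t a
  | 0, a => isEmptyElim a
  | D + 1, a => by
    have ih := continuous_haarSum (D := D)
    have ih' := fun a => continuous_haarDiff (D := D) a
    induction a using casesPos with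
    | root => simp only [haarDiff_root]; fun_prop
    | left a =>
      simp only [haarDiff_left]
      exact (by fun_prop : Continuous fun t : Node (D + 1) → ℝ => 1 - |t root|).mul
        ((ih' a).comp (by fun_prop : Continuous fun (t : Node (D + 1) → ℝ) a => t (left a)))
    | right a =>
      simp only [haarDiff_right]
      exact (by fun_prop : Continuous fun t : Node (D + 1) → ℝ => t root).mul
        ((ih' a).comp (by fun_prop : Continuous fun (t : Node (D + 1) → ℝ) a => t (right a)))

open Matrix in
/-- One step in the construction of `treeMatrix`. -/
noncomputable def rotationBlock {X : Type*} [Fintype X] (θ : ℝ) (A B : Matrix X X ℝ) :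
    Matrix (X ⊕ X) (X ⊕ X) ℝ :=
  fromBlocks (Real.cos θ • A) (Real.sin θ • B) (-(Real.sin θ • Bᵀ)) (Real.cos θ • (Bᵀ * Aᵀ * B))

open Matrix in
lemma rotationBlock_mul_transpose {X : Type*} [Fintype X] [DecidableEq X] (θ : ℝ)
    {A B : Matrix X X ℝ} (hA : A * Aᵀ = 1) (hB : B * Bᵀ = 1) :
    rotationBlock θ A B * (rotationBlock θ A B)ᵀ = 1 := by
  have hA' : Aᵀ * A = 1 := mul_eq_one_comm.1 hA
  have hB' : Bᵀ * B = 1 := mul_eq_one_comm.1 hB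
  have h1 : B * (Bᵀ * (A * B)) = A * B := by rw [← Matrix.mul_assoc, hB, Matrix.one_mul]
  have h2 : Bᵀ * (Aᵀ * (B * Bᵀ)) = Bᵀ * Aᵀ := by rw [hB, Matrix.mul_one]
  have h3 : Bᵀ * (Aᵀ * (B * (Bᵀ * (A * B)))) = 1 := by
    rw [h1, ← Matrix.mul_assoc Aᵀ, hA', Matrix.one_mul, hB']
  have hcs : Real.cos θ * Real.cos θ + Real.sin θ * Real.sin θ = 1 := by
    have := Real.cos_sq_add_sin_sq θ
    nlinarith
  rw [rotationBlock, fromBlocks_transpose, fromBlocks_multiply, ← fromBlocks_one]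
  congr 1
  · simp only [transpose_smul, smul_mul, Matrix.mul_smul, hA, hB, smul_smul, ← add_smul, hcs,
      one_smul]
  · simp only [transpose_smul, transpose_neg, transpose_mul, transpose_transpose, smul_mul,
      Matrix.mul_smul, Matrix.mul_assoc, h1, smul_smul, Matrix.mul_neg]
    rw [mul_comm]; simp
  · simp only [transpose_smul, smul_mul, Matrix.mul_smul, Matrix.mul_assoc, h2, smul_smul,
      Matrix.neg_mul, smul_neg]
    rw [mul_comm]; simp
  · simp only [transpose_smul, transpose_neg, transpose_mul, transpose_transpose, smul_mul,
      Matrix.mul_smul, Matrix.mul_assoc, h3, hB', smul_smul, Matrix.mul_neg, Matrix.neg_mul,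
      smul_neg, neg_neg, ← add_smul]
    rw [add_comm, hcs, one_smul]

open Matrix in
/-- An orthogonal matrix depending on parameters at the nodes of a tree, which changes sign
according to `facetChar` under the maps `facetMap`. -/
noncomputable def treeMatrix : ∀ {D : ℕ}, (Node D → ℝ) → Matrix (Leaf D) (Leaf D) ℝ
  | 0, _ => 1
  | D + 1, t => (rotationBlock (Real.pi / 2 * t root) (treeMatrix fun a => t (left a))
      (treeMatrix fun a => t (right a)) : Matrix (Leaf D ⊕ Leaf D) (Leaf D ⊕ Leaf D) ℝ)

lemma treeMatrix_succ {D : ℕ} (t : Node (D + 1) → ℝ) : treeMatrix t =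
    (rotationBlock (Real.pi / 2 * t root) (treeMatrix fun a => t (left a))
      (treeMatrix fun a => t (right a)) : Matrix (Leaf D ⊕ Leaf D) (Leaf D ⊕ Leaf D) ℝ) := rfl

open Matrix in
lemma treeMatrix_mul_transpose : ∀ {D : ℕ} (t : Node D → ℝ), treeMatrix t * (treeMatrix t)ᵀ = 1
  | 0, _ => by simp [treeMatrix]
  | D + 1, t =>
    rotationBlock_mul_transpose (X := Leaf D) _ (treeMatrix_mul_transpose _)
      (treeMatrix_mul_transpose _)

open Matrix in
lemma treeMatrix_facetMap : ∀ {D : ℕ} (j : Node D) (t : Node D → ℝ), |t j| = 1 →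
    treeMatrix (facetMap j t) = ((facetChar j : ℤ) : ℝ) • treeMatrix t
  | 0, j, _, _ => isEmptyElim j
  | D + 1, j, t, ht => by
    have ih := fun j t => treeMatrix_facetMap (D := D) j t
    have hu : ∀ (u : ℤˣ) (θ : ℝ), Real.cos (Real.pi / 2 * (u * θ)) = Real.cos (Real.pi / 2 * θ) ∧
        Real.sin (Real.pi / 2 * (u * θ)) = u * Real.sin (Real.pi / 2 * θ) := by
      intro u θ
      rcases Int.units_eq_one_or u with rfl | rfl <;> simp
    rw [treeMatrix_succ, treeMatrix_succ]
    change _ = ((facetChar j : ℤ) : ℝ) • (rotationBlock _ _ _ :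
      Matrix (Leaf D ⊕ Leaf D) (Leaf D ⊕ Leaf D) ℝ)
    simp only [rotationBlock, fromBlocks_smul]
    induction j using casesPos with
    | root =>
      have hc : Real.cos (Real.pi / 2 * t root) = 0 := by
        rw [← Real.cos_abs, abs_mul, ht, abs_of_pos (by positivity), mul_one, Real.cos_pi_div_two]
      simp [hc, facetMap_root_left, facetMap_root_right]
    | left j =>
      simp only [facetMap_left_root, facetMap_left_left, facetMap_left_right, facetChar_left,
        ih j (fun a => t (left a)) ht, (hu _ _).1, (hu _ _).2, transpose_smul, smul_mul,
        Matrix.mul_smul, smul_smul, smul_neg]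
      simp only [mul_comm]
    | right j =>
      simp only [facetMap_right_root, facetMap_right_left, facetMap_right_right, facetChar_right,
        ih j (fun a => t (right a)) ht, (hu _ _).1, (hu _ _).2, transpose_smul, smul_mul,
        Matrix.mul_smul, smul_smul, smul_neg]
      have h1 : ∀ x : ℝ, ((facetChar j : ℤ) : ℝ) * x * ((facetChar j : ℤ) : ℝ) = x := fun x => by
        linear_combination x * unit_mul_self (facetChar j)
      have h2 : ∀ x : ℝ, x * (((facetChar j : ℤ) : ℝ) * ((facetChar j : ℤ) : ℝ)) = x := fun x => by
        linear_combination x * unit_mul_self (facetChar j)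
      simp [h1, h2]

lemma continuous_treeMatrix : ∀ {D : ℕ}, Continuous (treeMatrix (D := D))
  | 0 => continuous_const
  | D + 1 => by
    have ih := continuous_treeMatrix (D := D)
    have hl : Continuous fun t : Node (D + 1) → ℝ => treeMatrix fun a => t (left a) :=
      ih.comp (by fun_prop)
    have hr : Continuous fun t : Node (D + 1) → ℝ => treeMatrix fun a => t (right a) :=
      ih.comp (by fun_prop)
    have h0 : Continuous fun t : Node (D + 1) → ℝ => Real.pi / 2 * t root := by fun_prop
    exact Continuous.matrix_fromBlocks ((Real.continuous_cos.comp h0).smul hl)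
      ((Real.continuous_sin.comp h0).smul hr)
      ((Real.continuous_sin.comp h0).smul hr.matrix_transpose).neg
      ((Real.continuous_cos.comp h0).smul
        ((hr.matrix_transpose.matrix_mul hl.matrix_transpose).matrix_mul hr))

end Node

/-- A signed permutation of the coordinates as a linear automorphism. -/
def signedPermEquiv {I : Type*} (τ : Equiv.Perm I) (ε : I → ℤˣ) : (I → ℝ) ≃ₗ[ℝ] (I → ℝ) where
  toFun := signedPerm τ ε
  map_add' x y := by funext i; simp [signedPerm, mul_add]
  map_smul' c x := by funext i; simp [signedPerm, mul_left_comm]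
  invFun x i := ((ε (τ.symm i) : ℤ) : ℝ) * x (τ.symm i)
  left_inv x := by
    funext i
    simp only [signedPerm, Equiv.apply_symm_apply, ← mul_assoc, Node.unit_mul_self, one_mul]
  right_inv x := by
    funext i
    simp only [signedPerm, Equiv.symm_apply_apply, ← mul_assoc, Node.unit_mul_self, one_mul]

lemma signedPermEquiv_apply {I : Type*} (τ : Equiv.Perm I) (ε : I → ℤˣ) (x : I → ℝ) (i : I) :
    signedPermEquiv τ ε x i = ((ε i : ℤ) : ℝ) * x (τ i) := rfl

lemma norm_signedPermEquiv_le {I : Type*} [Fintype I] (τ : Equiv.Perm I) (ε : I → ℤˣ)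
    (x : I → ℝ) : ‖signedPermEquiv τ ε x‖ ≤ ‖x‖ := by
  refine (pi_norm_le_iff_of_nonneg (norm_nonneg _)).2 fun i => ?_
  rw [signedPermEquiv_apply, Real.norm_eq_abs, Node.abs_unit_mul]
  exact norm_le_pi_norm x _

open Classical in
/-- A choice of sign for vectors, which is odd away from zero. -/
noncomputable def oddSign {I : Type*} (x : I → ℝ) : ℤˣ :=
  if h : (Function.support x).Nonempty then if 0 < x h.some then 1 else -1 else 1

lemma oddSign_neg {I : Type*} {x : I → ℝ} (hx : x ≠ 0) : oddSign (-x) = -oddSign x := by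
  have h := Function.support_nonempty_iff.2 hx
  have h0 : x h.some ≠ 0 := h.some_mem
  have h1 : (Function.support (-x)).Nonempty := by rwa [Function.support_neg]
  have h2 : h1.some = h.some := by congr 1; exact Function.support_neg x
  simp only [oddSign, h, h1, dif_pos, h2, Pi.neg_apply]
  rcases lt_or_gt_of_ne h0 with h3 | h3
  · simp [h3, not_lt.2 h3.le]
  · simp [h3, h3.le]

lemma oddSign_unit_smul {I : Type*} (u : ℤˣ) {x : I → ℝ} (hx : u = 1 ∨ x ≠ 0) :
    oddSign ((u : ℤ) • x) = u * oddSign x := by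
  rcases Int.units_eq_one_or u with rfl | rfl
  · simp
  · have := oddSign_neg (hx.resolve_left (by decide))
    simpa using this

namespace Node

variable {D : ℕ}

/-- The action of a flip at the node `j` on families indexed by the nodes. -/
def flipVec {V : Type*} [AddCommGroup V] (j : Node D) (w : Node D → V) (a : Node D) : V :=
  (flipSign j a : ℤ) • w (swap j a)

section gluing

variable {Y : Type}

/-- The gluing of the parameter cube of the tree. -/
def treeGluing (D : ℕ) (Y : Type) : CubeGluing ((Node D × Y) ⊕ Node D) where
  perm := Sum.elim
    (fun p => Equiv.sumCongr (Equiv.prodCongr (swapPerm p.1) (Equiv.refl Y)) (Equiv.refl _))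
    (fun _ => Equiv.refl _)
  sign := Sum.elim (fun p => Sum.elim (fun q => flipSign p.1 q.1) fun _ => 1)
    (fun j => Sum.elim (fun _ => 1) (facetSign j))
  perm_perm := by
    rintro (⟨j, y⟩ | j) (⟨a, z⟩ | a) <;> simp [swapPerm, swap_swap]
  sign_mul := by
    rintro (⟨j, y⟩ | j) (⟨a, z⟩ | a) <;> simp [swapPerm, flipSign_mul_flipSign_swap]
  perm_self := by
    rintro (⟨j, y⟩ | j) <;> simp [swapPerm, swap_self]
  sign_self := by
    rintro (⟨j, y⟩ | j) <;> simp [flipSign, facetSign_self]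
  rep := Sum.elim
    (fun p => signedPermEquiv
      (Equiv.sumCongr (Equiv.prodCongr (swapPerm p.1) (Equiv.refl Y)) (swapPerm p.1))
      (Sum.elim (fun q => flipSign p.1 q.1) (flipSign p.1)))
    (fun j => signedPermEquiv (Equiv.refl _) (Sum.elim (fun _ => 1) fun _ => facetChar j))

lemma treeGluing_rep_inl_inl (j a : Node D) (y z : Y) (u : (Node D × Y) ⊕ Node D → ℝ) :
    (treeGluing D Y).rep (Sum.inl (j, y)) u (Sum.inl (a, z)) =
      ((flipSign j a : ℤ) : ℝ) * u (Sum.inl (swap j a, z)) := rfl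

lemma treeGluing_rep_inl_inr (j a : Node D) (y : Y) (u : (Node D × Y) ⊕ Node D → ℝ) :
    (treeGluing D Y).rep (Sum.inl (j, y)) u (Sum.inr a) =
      ((flipSign j a : ℤ) : ℝ) * u (Sum.inr (swap j a)) := rfl

lemma treeGluing_rep_inr_inl (j a : Node D) (z : Y) (u : (Node D × Y) ⊕ Node D → ℝ) :
    (treeGluing D Y).rep (Sum.inr j) u (Sum.inl (a, z)) = u (Sum.inl (a, z)) := by
  simp [treeGluing, signedPermEquiv_apply]

lemma treeGluing_rep_inr_inr (j a : Node D) (u : (Node D × Y) ⊕ Node D → ℝ) :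
    (treeGluing D Y).rep (Sum.inr j) u (Sum.inr a) =
      ((facetChar j : ℤ) : ℝ) * u (Sum.inr a) := rfl

/-- The vector components of a point of the parameter cube. -/
def vecPart (x : (Node D × Y) ⊕ Node D → ℝ) (a : Node D) (y : Y) : ℝ := x (Sum.inl (a, y))

/-- The scalar components of a point of the parameter cube. -/
def scalarPart (x : (Node D × Y) ⊕ Node D → ℝ) (a : Node D) : ℝ := x (Sum.inr a)

lemma vecPart_glue_inl (j : Node D) (y : Y) (x : (Node D × Y) ⊕ Node D → ℝ) :
    vecPart ((treeGluing D Y).glue (Sum.inl (j, y)) x) = flipVec j (vecPart x) := by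
  funext a z
  simp [vecPart, CubeGluing.glue, signedPerm, treeGluing, flipVec, swapPerm]

lemma scalarPart_glue_inl (j : Node D) (y : Y) (x : (Node D × Y) ⊕ Node D → ℝ) :
    scalarPart ((treeGluing D Y).glue (Sum.inl (j, y)) x) = scalarPart x := by
  funext a
  simp [scalarPart, CubeGluing.glue, signedPerm, treeGluing]

lemma vecPart_glue_inr (j : Node D) (x : (Node D × Y) ⊕ Node D → ℝ) :
    vecPart ((treeGluing D Y).glue (Sum.inr j) x) = vecPart x := by
  funext a z
  simp [vecPart, CubeGluing.glue, signedPerm, treeGluing]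

lemma scalarPart_glue_inr (j : Node D) (x : (Node D × Y) ⊕ Node D → ℝ) :
    scalarPart ((treeGluing D Y).glue (Sum.inr j) x) = facetMap j (scalarPart x) := by
  funext a
  simp [scalarPart, CubeGluing.glue, signedPerm, treeGluing, facetMap]

/-- A map of the parameter cube with prescribed vector and scalar components. -/
def assemble (P : (Node D → Y → ℝ) → (Node D → ℝ) → Node D → Y → ℝ)
    (Q : (Node D → Y → ℝ) → (Node D → ℝ) → Node D → ℝ) (x : (Node D × Y) ⊕ Node D → ℝ) :
    (Node D × Y) ⊕ Node D → ℝ :=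
  Sum.elim (fun q => P (vecPart x) (scalarPart x) q.1 q.2) (Q (vecPart x) (scalarPart x))

variable [Fintype Y]

/-- The parameter domain. -/
def paramDomain (D : ℕ) (Y : Type) [Fintype Y] : Set ((Node D → Y → ℝ) × (Node D → ℝ)) :=
  {z | (∀ a, ‖z.1 a‖ ≤ 1) ∧ ∀ a, |z.2 a| ≤ 1}

lemma mem_paramDomain {x : (Node D × Y) ⊕ Node D → ℝ} (hx : x ∈ unitCube _) :
    (vecPart x, scalarPart x) ∈ paramDomain D Y :=
  ⟨fun a => (pi_norm_le_iff_of_nonneg zero_le_one).2 fun y => hx (Sum.inl (a, y)),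
    fun a => hx (Sum.inr a)⟩

/-- The equivariance of a pair of maps on the parameter domain. -/
structure Equivariant (P : (Node D → Y → ℝ) → (Node D → ℝ) → Node D → Y → ℝ)
    (Q : (Node D → Y → ℝ) → (Node D → ℝ) → Node D → ℝ) : Prop where
  vec_flip : ∀ w t j, (w, t) ∈ paramDomain D Y → ‖w j‖ = 1 →
    P (flipVec j w) t = flipVec j (P w t)
  scalar_flip : ∀ w t j, (w, t) ∈ paramDomain D Y → ‖w j‖ = 1 →
    Q (flipVec j w) t = flipVec j (Q w t)
  vec_facet : ∀ w t j, (w, t) ∈ paramDomain D Y → |t j| = 1 → P w (facetMap j t) = P w t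
  scalar_facet : ∀ w t j, (w, t) ∈ paramDomain D Y → |t j| = 1 → ∀ a,
    Q w (facetMap j t) a = ((facetChar j : ℤ) : ℝ) * Q w t a

lemma norm_eq_one {x : (Node D × Y) ⊕ Node D → ℝ} (hx : x ∈ unitCube _) {j : Node D}
    {y : Y} (h : |x (Sum.inl (j, y))| = 1) : ‖vecPart x j‖ = 1 :=
  le_antisymm ((mem_paramDomain hx).1 j) (h.ge.trans (norm_le_pi_norm (vecPart x j) y))

lemma Equivariant.compatible {P : (Node D → Y → ℝ) → (Node D → ℝ) → Node D → Y → ℝ}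
    {Q : (Node D → Y → ℝ) → (Node D → ℝ) → Node D → ℝ} (h : Equivariant P Q) :
    (treeGluing D Y).Compatible (assemble P Q) := by
  rintro (⟨j, y⟩ | j) x hx hxi
  · have hn := norm_eq_one hx hxi
    funext i
    rcases i with ⟨a, z⟩ | a
    · rw [treeGluing_rep_inl_inl]
      simp [assemble, vecPart_glue_inl, scalarPart_glue_inl,
        h.vec_flip _ _ j (mem_paramDomain hx) hn, flipVec]
    · rw [treeGluing_rep_inl_inr]
      simp [assemble, vecPart_glue_inl, scalarPart_glue_inl,
        h.scalar_flip _ _ j (mem_paramDomain hx) hn, flipVec]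
  · funext i
    rcases i with ⟨a, z⟩ | a
    · rw [treeGluing_rep_inr_inl]
      simp [assemble, vecPart_glue_inr, scalarPart_glue_inr,
        h.vec_facet _ _ j (mem_paramDomain hx) hxi]
    · rw [treeGluing_rep_inr_inr]
      simp [assemble, vecPart_glue_inr, scalarPart_glue_inr,
        h.scalar_facet _ _ j (mem_paramDomain hx) hxi]

lemma continuousOn_assemble {P : (Node D → Y → ℝ) → (Node D → ℝ) → Node D → Y → ℝ}
    {Q : (Node D → Y → ℝ) → (Node D → ℝ) → Node D → ℝ}
    (hP : ∀ a y, ContinuousOn (fun z : (Node D → Y → ℝ) × (Node D → ℝ) => P z.1 z.2 a y)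
      (paramDomain D Y))
    (hQ : ∀ a, ContinuousOn (fun z : (Node D → Y → ℝ) × (Node D → ℝ) => Q z.1 z.2 a)
      (paramDomain D Y)) :
    ContinuousOn (assemble P Q) (unitCube _) := by
  have hc : Continuous fun x : (Node D × Y) ⊕ Node D → ℝ => (vecPart x, scalarPart x) := by
    unfold vecPart scalarPart; fun_prop
  refine continuousOn_pi.2 fun i => ?_
  rcases i with ⟨a, y⟩ | a
  · exact (hP a y).comp hc.continuousOn fun x hx => mem_paramDomain hx
  · exact (hQ a).comp hc.continuousOn fun x hx => mem_paramDomain hx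

lemma norm_flipVec {V : Type*} [NormedAddCommGroup V] (j : Node D) (w : Node D → V) (a : Node D) :
    ‖flipVec j w a‖ = ‖w (swap j a)‖ := by
  unfold flipVec
  rcases Int.units_eq_one_or (flipSign j a) with h | h <;> simp [h]

/-- The scalar components of the model map. -/
noncomputable def modelScalar (w : Node D → Y → ℝ) (t : Node D → ℝ) (a : Node D) : ℝ :=
  (∏ j, (1 - ‖w j‖)) * haarDiff t a

lemma equivariant_model : Equivariant (D := D) (Y := Y) (fun w _ => w) modelScalar where
  vec_flip _ _ _ _ _ := rfl
  scalar_flip w t j _ h := by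
    have h0 : ∀ w : Node D → Y → ℝ, ‖w j‖ = 1 → modelScalar w t = 0 := by
      intro w hw
      funext a
      rw [modelScalar, Finset.prod_eq_zero (Finset.mem_univ j) (by rw [hw, sub_self]), zero_mul]
      rfl
    rw [h0 w h, h0 (flipVec j w) (by rw [norm_flipVec, swap_self, h])]
    funext a
    simp [flipVec]
  vec_facet _ _ _ _ _ := rfl
  scalar_facet w t j _ h a := by
    rw [modelScalar, haarDiff_facetMap j t h, modelScalar]; ring

/-- The equivariant frame. -/
noncomputable def frame (x : (Node D × Y) ⊕ Node D → ℝ) :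
    ((Node D × Y) ⊕ Node D → ℝ) ≃ₗ[ℝ] ((Node D × Y) ⊕ Node D → ℝ) :=
  signedPermEquiv
    (Equiv.sumCongr
      (Equiv.prodCongr (relabelPerm fun a => oddSign (vecPart x a)) (Equiv.refl Y))
      (relabelPerm fun a => oddSign (vecPart x a)))
    (Sum.elim (fun q => oddSign (vecPart x q.1)) fun a =>
      oddSign (vecPart x a) * oddSign fun l => treeMatrix (scalarPart x) l (Leaf.first D))

lemma frame_inl {Z : Type} (x u : (Node D × Z) ⊕ Node D → ℝ) (a : Node D) (y : Z) :
    frame x u (Sum.inl (a, y)) = ((oddSign (vecPart x a) : ℤ) : ℝ) *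
      u (Sum.inl (relabel (fun a => oddSign (vecPart x a)) a, y)) := rfl

lemma frame_inr {Z : Type} (x u : (Node D × Z) ⊕ Node D → ℝ) (a : Node D) :
    frame x u (Sum.inr a) = ((oddSign (vecPart x a) : ℤ) : ℝ) *
      ((oddSign fun l => treeMatrix (scalarPart x) l (Leaf.first D) : ℤ) : ℝ) *
      u (Sum.inr (relabel (fun a => oddSign (vecPart x a)) a)) := by
  rw [← Int.cast_mul, ← Units.val_mul]
  rfl

lemma frame_glue (i : (Node D × Y) ⊕ Node D) {x : (Node D × Y) ⊕ Node D → ℝ}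
    (hx : x ∈ unitCube _) (hxi : |x i| = 1) (u : (Node D × Y) ⊕ Node D → ℝ) :
    frame ((treeGluing D Y).glue i x) u = (treeGluing D Y).rep i (frame x u) := by
  rcases i with ⟨j, y⟩ | j
  · have hn := norm_eq_one hx hxi
    have hs : ∀ a, oddSign (flipVec j (vecPart x) a) =
        flipSign j a * oddSign (vecPart x (swap j a)) := by
      intro a
      refine oddSign_unit_smul _ ?_
      by_cases h : a = j
      · right
        rw [h, swap_self]
        intro h0
        rw [h0] at hn
        simp at hn
      · left; simp [flipSign, h]
    have hr : ∀ a, relabel (fun b => oddSign (flipVec j (vecPart x) b)) a =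
        relabel (fun b => oddSign (vecPart x b)) (swap j a) := by
      intro a
      simp only [hs]
      exact relabel_swap (fun b => oddSign (vecPart x b)) j a
    funext k
    rcases k with ⟨a, z⟩ | a
    · rw [treeGluing_rep_inl_inl, frame_inl, frame_inl, vecPart_glue_inl, hr, hs]
      simp [mul_assoc]
    · rw [treeGluing_rep_inl_inr, frame_inr, frame_inr, vecPart_glue_inl, scalarPart_glue_inl,
        hr, hs]
      simp [mul_assoc]
  · have h0 : (fun l => treeMatrix (scalarPart x) l (Leaf.first D)) ≠ 0 := by
      intro h
      have h1 := congrArg (fun A => A (Leaf.first D) (Leaf.first D))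
        (mul_eq_one_comm.1 (treeMatrix_mul_transpose (scalarPart x)))
      rw [Matrix.mul_apply, Matrix.one_apply_eq] at h1
      have h2 := fun l => congrFun h l
      simp only [Pi.zero_apply] at h2
      simp [h2] at h1
    have hs : (oddSign fun l => treeMatrix (facetMap j (scalarPart x)) l (Leaf.first D)) =
        facetChar j * oddSign fun l => treeMatrix (scalarPart x) l (Leaf.first D) := by
      rw [treeMatrix_facetMap j (scalarPart x) hxi, ← oddSign_unit_smul _ (Or.inr h0)]
      congr 1
      funext l
      simp
    funext k
    rcases k with ⟨a, z⟩ | a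
    · rw [treeGluing_rep_inr_inl, frame_inl, frame_inl, vecPart_glue_inr]
    · rw [treeGluing_rep_inr_inr, frame_inr, frame_inr, vecPart_glue_inr, scalarPart_glue_inr, hs]
      simp [mul_assoc, mul_left_comm]

theorem Equivariant.exists_zero {P : (Node D → Y → ℝ) → (Node D → ℝ) → Node D → Y → ℝ}
    {Q : (Node D → Y → ℝ) → (Node D → ℝ) → Node D → ℝ} (h : Equivariant P Q)
    (hP : ∀ a y, ContinuousOn (fun z : (Node D → Y → ℝ) × (Node D → ℝ) => P z.1 z.2 a y)
      (paramDomain D Y))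
    (hQ : ∀ a, ContinuousOn (fun z : (Node D → Y → ℝ) × (Node D → ℝ) => Q z.1 z.2 a)
      (paramDomain D Y)) :
    ∃ z ∈ paramDomain D Y, (∀ a y, P z.1 z.2 a y = 0) ∧ ∀ a, Q z.1 z.2 a = 0 := by
  classical
  let p₀ : (Node D × Y) ⊕ Node D → ℝ := Sum.elim (fun _ => 0) fun _ => 1 / 2
  obtain ⟨x, hx, hx0⟩ := (treeGluing D Y).exists_zero frame (fun i x hx hxi => frame_glue i hx hxi)
    (fun x w => norm_signedPermEquiv_le _ _ w)
    (Φ₀ := assemble (fun w _ => w) modelScalar) (Φ := assemble P Q)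
    (continuousOn_assemble (fun a y => by fun_prop) fun a =>
      (by
        have := continuous_haarDiff (D := D) a
        unfold modelScalar
        fun_prop : Continuous
          fun z : (Node D → Y → ℝ) × (Node D → ℝ) => modelScalar z.1 z.2 a).continuousOn)
    (continuousOn_assemble hP hQ) equivariant_model.compatible h.compatible (p₀ := p₀) (r := 1 / 8)
    (by norm_num)
    (by
      rintro (i | i)
      · norm_num [p₀]
      · norm_num [p₀, abs_of_pos])
    (by
      intro x hx h0
      have h1 : ∀ a y, x (Sum.inl (a, y)) = 0 := fun a y => congrFun h0 (Sum.inl (a, y))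
      have h2 : ∀ a, vecPart x a = 0 := fun a => funext fun y => h1 a y
      have h3 : ∀ a, modelScalar (vecPart x) (scalarPart x) a = 0 :=
        fun a => congrFun h0 (Sum.inr a)
      simp only [modelScalar, h2, norm_zero, sub_zero, Finset.prod_const_one, one_mul] at h3
      funext i
      rcases i with ⟨a, y⟩ | a
      · exact h1 a y
      · exact (eq_half_of_haarDiff_eq_zero _ (mem_paramDomain hx).2 h3).1 a)
    (by
      intro x hx i hi
      rcases i with ⟨a, y⟩ | a
      · have h0 : x (Sum.inl (a, y)) ≠ 0 := hi
        have h1 : assemble (fun w _ => w) modelScalar x (Sum.inl (a, y)) = x (Sum.inl (a, y)) := rfl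
        have h2 : p₀ (Sum.inl (a, y)) = 0 := rfl
        rw [h1, h2, sub_zero]
        exact mul_self_pos.2 h0
      · change 0 < modelScalar (vecPart x) (scalarPart x) a * (scalarPart x a - 1 / 2)
        have h0 : ∀ a, |scalarPart x a - 1 / 2| ≤ 2 * (1 / 8) := fun a => hx (Sum.inr a)
        have h1 : ∀ a, 0 < scalarPart x a ∧ scalarPart x a < 1 := fun a => by
          have := abs_le.1 (h0 a)
          constructor <;> linarith
        have h2 : ∀ a, ‖vecPart x a‖ ≤ 2 * (1 / 8) := fun a =>
          (pi_norm_le_iff_of_nonneg (by norm_num)).2 fun y => by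
            have : |x (Sum.inl (a, y)) - 0| ≤ 2 * (1 / 8) := hx (Sum.inl (a, y))
            rwa [sub_zero] at this
        rw [modelScalar, mul_assoc]
        exact mul_pos (Finset.prod_pos fun a _ => by linarith [h2 a])
          (haarDiff_mul_sub_half_pos _ h1 a hi))
  exact ⟨(vecPart x, scalarPart x), mem_paramDomain hx,
    fun a y => congrFun hx0 (Sum.inl (a, y)), fun a => congrFun hx0 (Sum.inr a)⟩

end gluing

end Node

section orthogonal

open Matrix

variable {ι : Type*} [Fintype ι] [DecidableEq ι] {R : Matrix ι ι ℝ}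

lemma mulVec_dotProduct_mulVec_of_orthogonal (hR : R * Rᵀ = 1) (x y : ι → ℝ) :
    (R *ᵥ x) ⬝ᵥ (R *ᵥ y) = x ⬝ᵥ y := by
  rw [dotProduct_mulVec, vecMul_mulVec, mul_eq_one_comm.1 hR, vecMul_one]

lemma norm_mulVec_le_of_orthogonal (hR : R * Rᵀ = 1) (x : ι → ℝ) :
    ‖R *ᵥ x‖ ≤ Fintype.card ι * ‖x‖ := by
  refine (pi_norm_le_iff_of_nonneg (by positivity)).2 fun i => ?_
  have h1 : (1 : ℝ) ≤ Fintype.card ι := by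
    exact_mod_cast Fintype.card_pos_iff.2 ⟨i⟩
  rw [Real.norm_eq_abs]
  refine abs_le_of_sq_le_sq ?_ (by positivity)
  calc (R *ᵥ x) i ^ 2 ≤ ∑ k, (R *ᵥ x) k ^ 2 :=
        Finset.single_le_sum (f := fun k => (R *ᵥ x) k ^ 2) (fun k _ => sq_nonneg _)
          (Finset.mem_univ i)
    _ = (R *ᵥ x) ⬝ᵥ (R *ᵥ x) := by simp only [dotProduct, sq]
    _ = ∑ k, x k ^ 2 := by
        rw [mulVec_dotProduct_mulVec_of_orthogonal hR]; simp only [dotProduct, sq]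
    _ ≤ ∑ _k : ι, ‖x‖ ^ 2 := Finset.sum_le_sum fun k _ =>
        sq_le_sq' (abs_le.1 (norm_le_pi_norm x k)).1 (abs_le.1 (norm_le_pi_norm x k)).2
    _ = Fintype.card ι * ‖x‖ ^ 2 := by simp
    _ ≤ (Fintype.card ι * ‖x‖) ^ 2 := by
        rw [mul_pow]
        refine mul_le_mul_of_nonneg_right ?_ (sq_nonneg _)
        nlinarith

lemma norm_le_mulVec_of_orthogonal (hR : R * Rᵀ = 1) (x : ι → ℝ) :
    ‖x‖ ≤ Fintype.card ι * ‖R *ᵥ x‖ := by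
  have h := norm_mulVec_le_of_orthogonal (R := Rᵀ)
    (by rw [transpose_transpose]; exact mul_eq_one_comm.1 hR) (R *ᵥ x)
  rwa [mulVec_mulVec, mul_eq_one_comm.1 hR, one_mulVec] at h

end orthogonal

namespace Node

open Matrix

variable {D : ℕ} {Y : Type}

/-- The block diagonal matrix formed by two copies of `treeMatrix`. -/
noncomputable def doubleTreeMatrix (t : Node D → ℝ) :
    Matrix (Leaf D ⊕ Leaf D) (Leaf D ⊕ Leaf D) ℝ :=
  fromBlocks (treeMatrix t) 0 0 (treeMatrix t)

lemma doubleTreeMatrix_mul_transpose (t : Node D → ℝ) :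
    doubleTreeMatrix t * (doubleTreeMatrix t)ᵀ = 1 := by
  simp [doubleTreeMatrix, fromBlocks_transpose, fromBlocks_multiply, treeMatrix_mul_transpose]

lemma doubleTreeMatrix_facetMap (j : Node D) (t : Node D → ℝ) (h : |t j| = 1) :
    doubleTreeMatrix (facetMap j t) = ((facetChar j : ℤ) : ℝ) • doubleTreeMatrix t := by
  simp [doubleTreeMatrix, treeMatrix_facetMap j t h, fromBlocks_smul]

lemma continuous_doubleTreeMatrix : Continuous (doubleTreeMatrix (D := D)) :=
  continuous_treeMatrix.matrix_fromBlocks continuous_const continuous_const continuous_treeMatrix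

/-- The base point of the family of points on the leaves. -/
noncomputable def baseVec (t : Node D → ℝ) : Leaf D ⊕ Leaf D → ℝ :=
  doubleTreeMatrix t *ᵥ Pi.single (Sum.inl (Leaf.first D)) 1

lemma baseVec_inr (t : Node D → ℝ) (l : Leaf D) : baseVec t (Sum.inr l) = 0 := by
  simp [baseVec, doubleTreeMatrix]

lemma baseVec_dotProduct_self (t : Node D → ℝ) : baseVec t ⬝ᵥ baseVec t = 1 := by
  rw [baseVec, mulVec_dotProduct_mulVec_of_orthogonal (doubleTreeMatrix_mul_transpose t)]
  simp

lemma baseVec_facetMap (j : Node D) (t : Node D → ℝ) (h : |t j| = 1) :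
    baseVec (facetMap j t) = ((facetChar j : ℤ) : ℝ) • baseVec t := by
  rw [baseVec, doubleTreeMatrix_facetMap j t h, smul_mulVec, baseVec]

lemma continuous_baseVec : Continuous (baseVec (D := D)) :=
  continuous_doubleTreeMatrix.matrix_mulVec continuous_const

lemma one_le_card_mul_norm_baseVec (t : Node D → ℝ) :
    1 ≤ Fintype.card (Leaf D ⊕ Leaf D) * ‖baseVec t‖ := by
  refine le_trans ?_ (norm_le_mulVec_of_orthogonal (doubleTreeMatrix_mul_transpose t) _)
  have := norm_le_pi_norm (Pi.single (Sum.inl (Leaf.first D)) 1 : Leaf D ⊕ Leaf D → ℝ)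
    (Sum.inl (Leaf.first D))
  simpa using this

variable [Fintype Y]

/-- The lift of a vector in the unit ball to the boundary of a double pyramid. -/
noncomputable def liftVec (w : Y → ℝ) (o : Option Y) : ℝ := o.elim (1 - ‖w‖) w

lemma continuous_liftVec : Continuous (liftVec (Y := Y)) := by
  refine continuous_pi fun o => ?_
  cases o <;> simp only [liftVec, Option.elim] <;> fun_prop

lemma liftVec_unit_smul (u : ℤˣ) {w : Y → ℝ} (h : u = 1 ∨ ‖w‖ = 1) :
    liftVec ((u : ℤ) • w) = ((u : ℤ) : ℝ) • liftVec w := by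
  rcases Int.units_eq_one_or u with rfl | rfl
  · simp
  · have h := h.resolve_left (by decide)
    funext o
    cases o <;> simp [liftVec, h]

lemma norm_liftVec_le {w : Y → ℝ} (h : ‖w‖ ≤ 1) : ‖liftVec w‖ ≤ 1 := by
  refine (pi_norm_le_iff_of_nonneg zero_le_one).2 fun o => ?_
  cases o with
  | none =>
    simp only [liftVec, Option.elim, Real.norm_eq_abs]
    rw [abs_of_nonneg (by linarith)]
    linarith [norm_nonneg w]
  | some y => exact (norm_le_pi_norm w y).trans h

lemma half_le_norm_liftVec (w : Y → ℝ) : 1 / 2 ≤ ‖liftVec w‖ := by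
  have h1 : 1 - ‖w‖ ≤ ‖liftVec w‖ := (le_abs_self _).trans (norm_le_pi_norm (liftVec w) none)
  have h2 : ‖w‖ ≤ ‖liftVec w‖ := (pi_norm_le_iff_of_nonneg (norm_nonneg _)).2 fun y =>
    norm_le_pi_norm (liftVec w) (some y)
  linarith

variable (e : Option Y ≃ Leaf D ⊕ Leaf D)

/-- The direction attached to a node. -/
noncomputable def dirVec (t : Node D → ℝ) (w : Y → ℝ) : Leaf D ⊕ Leaf D → ℝ :=
  doubleTreeMatrix t *ᵥ fun x => liftVec w (e.symm x)

lemma dirVec_unit_smul (t : Node D → ℝ) (u : ℤˣ) {w : Y → ℝ} (h : u = 1 ∨ ‖w‖ = 1) :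
    dirVec e t ((u : ℤ) • w) = (u : ℤ) • dirVec e t w := by
  rw [dirVec, liftVec_unit_smul u h, dirVec, ← Int.cast_smul_eq_zsmul ℝ, ← mulVec_smul]
  rfl

lemma dirVec_flipVec (t : Node D → ℝ) {w : Node D → Y → ℝ} {j : Node D} (h : ‖w j‖ = 1)
    (a : Node D) : dirVec e t (flipVec j w a) = flipVec j (fun a => dirVec e t (w a)) a := by
  refine dirVec_unit_smul e t _ ?_
  by_cases ha : a = j
  · right; rw [ha, swap_self, h]
  · left; simp [flipSign, ha]

lemma dirVec_facetMap (j : Node D) (t : Node D → ℝ) (h : |t j| = 1) (w : Y → ℝ) :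
    dirVec e (facetMap j t) w = ((facetChar j : ℤ) : ℝ) • dirVec e t w := by
  rw [dirVec, doubleTreeMatrix_facetMap j t h, smul_mulVec, dirVec]

lemma continuous_dirVec : Continuous fun z : (Node D → ℝ) × (Y → ℝ) => dirVec e z.1 z.2 := by
  refine (continuous_doubleTreeMatrix.comp continuous_fst).matrix_mulVec ?_
  exact continuous_pi fun x =>
    (continuous_apply (e.symm x)).comp (continuous_liftVec.comp continuous_snd)

lemma norm_liftVec_symm (w : Y → ℝ) : ‖fun x => liftVec w (e.symm x)‖ = ‖liftVec w‖ := by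
  refine le_antisymm ((pi_norm_le_iff_of_nonneg (norm_nonneg _)).2 fun x => norm_le_pi_norm _ _)
    ((pi_norm_le_iff_of_nonneg (norm_nonneg _)).2 fun o => ?_)
  have := norm_le_pi_norm (fun x => liftVec w (e.symm x)) (e o)
  simpa using this

lemma norm_dirVec_le (t : Node D → ℝ) {w : Y → ℝ} (h : ‖w‖ ≤ 1) :
    ‖dirVec e t w‖ ≤ Fintype.card (Leaf D ⊕ Leaf D) := by
  refine (norm_mulVec_le_of_orthogonal (doubleTreeMatrix_mul_transpose t) _).trans ?_
  rw [norm_liftVec_symm]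
  exact mul_le_of_le_one_right (by positivity) (norm_liftVec_le h)

lemma half_le_card_mul_norm_dirVec (t : Node D → ℝ) (w : Y → ℝ) :
    1 / 2 ≤ Fintype.card (Leaf D ⊕ Leaf D) * ‖dirVec e t w‖ := by
  refine le_trans ?_ (norm_le_mulVec_of_orthogonal (doubleTreeMatrix_mul_transpose t) _)
  rw [norm_liftVec_symm]
  exact half_le_norm_liftVec w

/-- The family of points on the leaves. -/
noncomputable def leafVec (ε : ℝ) (w : Node D → Y → ℝ) (t : Node D → ℝ) (l : Leaf D) :
    Leaf D ⊕ Leaf D → ℝ :=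
  baseVec t + Leaf.offset ε (fun a => dirVec e t (w a)) l

lemma leafVec_flipVec (ε : ℝ) {w : Node D → Y → ℝ} (t : Node D → ℝ) {j : Node D} (h : ‖w j‖ = 1)
    (l : Leaf D) : leafVec e ε (flipVec j w) t l = leafVec e ε w t (Leaf.swap j l) := by
  rw [leafVec, leafVec, ← Leaf.offset_swap]
  simp only [dirVec_flipVec e t h]
  rfl

lemma leafVec_facetMap (ε : ℝ) (w : Node D → Y → ℝ) {t : Node D → ℝ} {j : Node D} (h : |t j| = 1)
    (l : Leaf D) :
    leafVec e ε w (facetMap j t) l = ((facetChar j : ℤ) : ℝ) • leafVec e ε w t l := by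
  rw [leafVec, leafVec, smul_add, baseVec_facetMap j t h]
  congr 1
  simp only [dirVec_facetMap e j t h]
  exact (Leaf.map_offset (LinearMap.lsmul ℝ (Leaf D ⊕ Leaf D → ℝ) ((facetChar j : ℤ) : ℝ)) ε
    (fun a => dirVec e t (w a)) l).symm

lemma continuous_leafVec (ε : ℝ) (l : Leaf D) :
    Continuous fun z : (Node D → Y → ℝ) × (Node D → ℝ) => leafVec e ε z.1 z.2 l := by
  refine (continuous_baseVec.comp continuous_snd).add ?_
  rw [← continuousOn_univ]
  refine Leaf.continuousOn_offset ε (fun a => ?_) l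
  exact ((continuous_dirVec e).comp
    (continuous_snd.prodMk ((continuous_apply a).comp continuous_fst))).continuousOn

end Node

set_option maxHeartbeats 1000000 in
open Node Matrix in
/-- A continuous even map, defined on the pairs `(a, τ)` with `|τ| < r ‖a‖`, takes equal values at
`2 ^ D` pairs, no two of which are proportional. -/
theorem exists_equal_values {D m : ℕ} (hD : 1 ≤ D) (hm : m + 2 = 2 * 2 ^ D)
    (f : (Fin m → ℝ) → ℝ → Fin m → ℝ) {r : ℝ} (hr : 0 < r)
    (hf : ContinuousOn (fun z : (Fin m → ℝ) × ℝ => f z.1 z.2) {z | |z.2| < r * ‖z.1‖})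
    (heven : ∀ a τ, f (-a) (-τ) = f a τ) :
    ∃ (a : Leaf D → Fin m → ℝ) (τ : Leaf D → ℝ), (∀ l, |τ l| < r * ‖a l‖) ∧
      (∀ l l', f (a l) (τ l) = f (a l') (τ l')) ∧
      ∀ l l' (c : ℝ), a l = c • a l' → τ l = c * τ l' → l = l' := by
  set N : ℝ := (Fintype.card (Leaf D ⊕ Leaf D) : ℝ) with hN
  have hcard : Fintype.card (Leaf D ⊕ Leaf D) = 2 * 2 ^ D := by
    rw [Fintype.card_sum, Leaf.card]; ring
  have hN1 : 1 ≤ N := by rw [hN, hcard]; exact_mod_cast Nat.one_le_iff_ne_zero.2 (by positivity)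
  obtain ⟨p, q, hpq⟩ : ∃ p q : Leaf D, p ≠ q := Fintype.exists_pair_of_one_lt_card (by
    rw [Leaf.card]; exact Nat.one_lt_two_pow (by lia))
  obtain ⟨e, he₀, he₁⟩ : ∃ e : Option (Option (Fin m)) ≃ Leaf D ⊕ Leaf D,
      e none = Sum.inr q ∧ e (some none) = Sum.inr p := by
    let e₀ : Option (Option (Fin m)) ≃ Leaf D ⊕ Leaf D := Fintype.equivOfCardEq (by
      rw [hcard, ← hm]; simp)
    let e₁ := e₀.trans (Equiv.swap (e₀ none) (Sum.inr q))
    have h1 : e₁ none = Sum.inr q := by simp [e₁]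
    refine ⟨e₁.trans (Equiv.swap (e₁ (some none)) (Sum.inr p)), ?_, by simp⟩
    rw [Equiv.trans_apply, h1, Equiv.swap_apply_of_ne_of_ne]
    · rw [← h1]; exact e₁.injective.ne (by simp)
    · simpa using hpq.symm
  let ε : ℝ := r / (8 * N ^ 2 * (1 + r))
  have hε : 0 < ε := by positivity
  have hεN : 2 * ε * N = r / (4 * N * (1 + r)) := by simp only [ε]; field_simp; norm_num
  have hε2 : ε ≤ 1 / 2 := by
    rw [div_le_iff₀ (by positivity)]
    nlinarith [mul_le_mul hN1 hN1 zero_le_one (by linarith)]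
  have hεc : 2 * ε * N < 1 / (2 * N) := by
    rw [hεN, div_lt_div_iff₀ (by positivity) (by positivity)]
    nlinarith
  have hεr : 2 * ε * N < r * (1 / N - 2 * ε * N) := by
    have h1 : 2 * ε * N * (1 + r) = r / (4 * N) := by rw [hεN]; field_simp
    have h2 : r / (4 * N) < r * (1 / N) := by
      rw [mul_one_div]
      exact div_lt_div_of_pos_left hr (by positivity) (by linarith)
    nlinarith
  let A : (Leaf D ⊕ Leaf D → ℝ) → Fin m → ℝ := fun v i => v (e (some (some i)))
  let B : (Leaf D ⊕ Leaf D → ℝ) → ℝ := fun v => v (e (some none))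
  have hoff : ∀ z ∈ paramDomain D (Option (Fin m)), ∀ l,
      ‖Leaf.offset ε (fun a => dirVec e z.2 (z.1 a)) l‖ ≤ 2 * ε * N := fun z hz l =>
    Leaf.norm_offset_le hε.le hε2 (by linarith) _ (fun a => norm_dirVec_le e _ (hz.1 a)) l
  have hadm : ∀ z ∈ paramDomain D (Option (Fin m)), ∀ l,
      |B (leafVec e ε z.1 z.2 l)| < r * ‖A (leafVec e ε z.1 z.2 l)‖ := by
    intro z hz l
    have h1 := fun x => (norm_le_pi_norm _ x).trans (hoff z hz l)
    have h2 : |B (leafVec e ε z.1 z.2 l)| ≤ 2 * ε * N := by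
      simp only [B, leafVec, he₁, Pi.add_apply, baseVec_inr, zero_add]
      exact h1 _
    obtain ⟨x, hx⟩ : ∃ x, ‖baseVec z.2‖ = ‖baseVec z.2 x‖ := by
      obtain ⟨x, -, hx⟩ := Finset.exists_max_image Finset.univ (fun x => ‖baseVec z.2 x‖)
        ⟨Sum.inl (Leaf.first D), Finset.mem_univ _⟩
      exact ⟨x, le_antisymm ((pi_norm_le_iff_of_nonneg (norm_nonneg _)).2
        fun y => hx y (Finset.mem_univ _)) (norm_le_pi_norm _ x)⟩
    have hxN : 1 / N ≤ ‖baseVec z.2 x‖ := by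
      rw [← hx, div_le_iff₀' (by positivity)]
      exact one_le_card_mul_norm_baseVec z.2
    have hxr : ∀ l, x ≠ Sum.inr l := by
      rintro l rfl
      rw [baseVec_inr, norm_zero] at hxN
      have : 0 < 1 / N := by positivity
      linarith
    obtain ⟨i, hi⟩ : ∃ i, e (some (some i)) = x := by
      rcases ho : e.symm x with _ | _ | i
      · exact absurd (by rw [← he₀, ← ho, e.apply_symm_apply]) (hxr q)
      · exact absurd (by rw [← he₁, ← ho, e.apply_symm_apply]) (hxr p)
      · exact ⟨i, by rw [← ho, e.apply_symm_apply]⟩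
    have h3 : 1 / N - 2 * ε * N ≤ ‖A (leafVec e ε z.1 z.2 l)‖ := by
      refine le_trans ?_ (norm_le_pi_norm _ i)
      simp only [A, hi, leafVec, Pi.add_apply]
      have h4 := norm_sub_norm_le (baseVec z.2 x)
        (-Leaf.offset ε (fun a => dirVec e z.2 (z.1 a)) l x)
      rw [sub_neg_eq_add, norm_neg] at h4
      linarith [h1 x]
    exact h2.trans_lt (hεr.trans_le (mul_le_mul_of_nonneg_left h3 hr.le))
  let P : (Node D → Option (Fin m) → ℝ) → (Node D → ℝ) → Node D → Option (Fin m) → ℝ :=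
    fun w t a y => y.elim (dirVec e t (w a) ⬝ᵥ baseVec t) fun i =>
      Leaf.diff (fun l => f (A (leafVec e ε w t l)) (B (leafVec e ε w t l)) i) a
  let Q : (Node D → Option (Fin m) → ℝ) → (Node D → ℝ) → Node D → ℝ :=
    fun w t a => dirVec e t (w a) (Sum.inr q)
  have heq : Equivariant P Q :=
    { vec_flip := fun w t j _ h => by
        funext a y
        cases y with
        | none =>
          simp only [P, Option.elim, dirVec_flipVec e t h]
          rcases Int.units_eq_one_or (flipSign j a) with hu | hu <;> simp [flipVec, hu]
        | some i =>
          simp only [P, Option.elim, leafVec_flipVec e ε t h]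
          rw [Leaf.diff_swap (fun l => f (A (leafVec e ε w t l)) (B (leafVec e ε w t l)) i)]
          simp [flipVec]
      scalar_flip := fun w t j _ h => by
        funext a
        simp only [Q, dirVec_flipVec e t h]
        simp [flipVec]
      vec_facet := fun w t j _ h => by
        funext a y
        cases y with
        | none =>
          simp only [P, Option.elim, dirVec_facetMap e j t h, baseVec_facetMap j t h,
            smul_dotProduct, dotProduct_smul, smul_smul, unit_mul_self, one_smul]
        | some i =>
          simp only [P, Option.elim, leafVec_facetMap e ε w h]
          congr 1
          funext l
          rcases Int.units_eq_one_or (facetChar j) with hu | hu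
          · simp [hu]
          · have := heven (A (leafVec e ε w t l)) (B (leafVec e ε w t l))
            rw [← this, hu]
            simp only [Units.val_neg, Units.val_one, Int.cast_neg, Int.cast_one, neg_smul, one_smul]
            rfl
      scalar_facet := fun w t j _ h a => by
        simp only [Q, dirVec_facetMap e j t h]
        rfl }
  have hdir : ∀ a x, Continuous fun z : (Node D → Option (Fin m) → ℝ) × (Node D → ℝ) =>
      dirVec e z.2 (z.1 a) x := fun a x => (continuous_apply x).comp ((continuous_dirVec e).comp
    (continuous_snd.prodMk ((continuous_apply a).comp continuous_fst)))
  obtain ⟨⟨w, t⟩, hz, hP, hQ⟩ := heq.exists_zero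
    (by
      intro a y
      cases y with
      | none =>
        refine Continuous.continuousOn ?_
        simp only [P, Option.elim, dotProduct]
        exact continuous_finsetSum _ fun x _ => (hdir a x).mul
          ((continuous_apply x).comp (continuous_baseVec.comp continuous_snd))
      | some i =>
        refine Leaf.continuousOn_diff (fun l => ?_) a
        have hc := continuous_leafVec e ε l
        have hc' : Continuous fun z : (Node D → Option (Fin m) → ℝ) × (Node D → ℝ) =>
            (A (leafVec e ε z.1 z.2 l), B (leafVec e ε z.1 z.2 l)) := by
          simp only [A, B]; fun_prop
        exact (continuous_apply i).comp_continuousOn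
          (hf.comp hc'.continuousOn fun z hz => hadm z hz l))
    (fun a => (hdir a _).continuousOn)
  refine ⟨fun l => A (leafVec e ε w t l), fun l => B (leafVec e ε w t l), hadm _ hz, ?_, ?_⟩
  · intro l l'
    funext i
    exact Leaf.eq_of_diff_eq_zero _ (fun a => hP a (some i)) l l'
  · intro l l' c hA hB
    have h1 : ∀ l, leafVec e ε w t l (e none) = 0 := by
      intro l
      rw [he₀, leafVec, Pi.add_apply, baseVec_inr, zero_add]
      have h2 := Leaf.map_offset (LinearMap.proj (R := ℝ) (φ := fun _ => ℝ) (Sum.inr q)) ε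
        (fun a => dirVec e t (w a)) l
      simp only [LinearMap.proj_apply] at h2
      rw [h2]
      have h3 : (fun a => dirVec e t (w a) (Sum.inr q)) = fun _ => 0 := funext hQ
      rw [h3, Leaf.offset_zero]
    have h2 : ∀ l, leafVec e ε w t l ⬝ᵥ baseVec t = 1 := by
      intro l
      rw [leafVec, add_dotProduct, baseVec_dotProduct_self]
      have h2 := Leaf.map_offset ((dotProductBilin ℝ ℝ).flip (baseVec t)) ε
        (fun a => dirVec e t (w a)) l
      simp only [LinearMap.flip_apply, dotProductBilin_apply_apply] at h2
      rw [h2]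
      have h3 : (fun a => dirVec e t (w a) ⬝ᵥ baseVec t) = fun _ => 0 := funext fun a => hP a none
      rw [h3, Leaf.offset_zero, add_zero]
    have h3 : leafVec e ε w t l = c • leafVec e ε w t l' := by
      funext x
      obtain ⟨o, rfl⟩ := e.surjective x
      rcases o with _ | _ | i
      · rw [Pi.smul_apply, h1, h1, smul_zero]
      · exact hB
      · exact congrFun hA i
    have hc : c = 1 := by
      have h4 := h2 l
      rw [h3, smul_dotProduct, h2, smul_eq_mul, mul_one] at h4
      exact h4
    rw [hc, one_smul] at h3
    refine Leaf.offset_injective hε hε2 hεc _ (fun a => norm_dirVec_le e t (hz.1 a)) (fun a => ?_)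
      (add_left_cancel h3)
    rw [div_le_iff₀ (by positivity)]
    linarith [half_le_card_mul_norm_dirVec e t (w a)]

section sections

open Module Set Filter Topology

variable {E : Type*} [NormedAddCommGroup E] [InnerProductSpace ℝ E]

/-- The affine parametrization of the hyperplane `{x | ⟪x - c, a⟫ = τ}` by the vectors orthogonal
to `b`, along the direction `b`. -/
noncomputable def sectionParam (c b a : E) (τ : ℝ) (y : (ℝ ∙ b)ᗮ) : E :=
  c + (y + ((τ - ⟪(y : E), a⟫) / ⟪b, a⟫) • b)

/-- The linear part of `sectionParam`. -/
noncomputable def sectionParamLinear (b a : E) : (ℝ ∙ b)ᗮ →ₗ[ℝ] E where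
  toFun y := y + (-⟪(y : E), a⟫ / ⟪b, a⟫) • b
  map_add' x y := by
    simp only [Submodule.coe_add, inner_add_left, neg_add, add_div, add_smul]; abel
  map_smul' r x := by
    simp only [Submodule.coe_smul, inner_smul_left, RingHom.id_apply, smul_add, smul_smul]
    congr 2
    simp only [conj_trivial]; ring

lemma sectionParam_eq_add (c b a : E) (τ : ℝ) (y : (ℝ ∙ b)ᗮ) :
    sectionParam c b a τ y = sectionParam c b a τ 0 + sectionParamLinear b a y := by
  simp only [sectionParam, sectionParamLinear, LinearMap.coe_mk, AddHom.coe_mk,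
    ZeroMemClass.coe_zero, inner_zero_left, sub_div, sub_smul, neg_div, neg_smul, zero_div]
  module

lemma inner_coe_orthogonal (b : E) (y : (ℝ ∙ b)ᗮ) : ⟪(y : E), b⟫ = 0 :=
  Submodule.mem_orthogonal_singleton_iff_inner_left.1 y.2

lemma inner_sectionParam_sub {c b a : E} (h : ⟪b, a⟫ ≠ 0) (τ : ℝ) (y : (ℝ ∙ b)ᗮ) :
    ⟪sectionParam c b a τ y - c, a⟫ = τ := by
  rw [sectionParam, add_sub_cancel_left, inner_add_left, inner_smul_left]
  simp only [conj_trivial]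
  field_simp
  ring

lemma norm_coe_le_norm_sectionParam_sub (c b a : E) (τ : ℝ) (y : (ℝ ∙ b)ᗮ) :
    ‖y‖ ≤ ‖sectionParam c b a τ y - c‖ := by
  rw [sectionParam, add_sub_cancel_left]
  refine abs_le_of_sq_le_sq' ?_ (norm_nonneg _) |>.2
  have h : ⟪(y : E), ((τ - ⟪(y : E), a⟫) / ⟪b, a⟫) • b⟫ = 0 := by
    rw [inner_smul_right, inner_coe_orthogonal, mul_zero]
  have := norm_add_sq_eq_norm_sq_add_norm_sq_of_inner_eq_zero _ _ h
  rw [sq, sq, this, Submodule.coe_norm]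
  nlinarith [mul_self_nonneg ‖((τ - ⟪(y : E), a⟫) / ⟪b, a⟫) • b‖]

lemma sectionParamLinear_injective (b a : E) : Function.Injective (sectionParamLinear b a) := by
  rw [← LinearMap.ker_eq_bot, LinearMap.ker_eq_bot']
  intro y hy
  have h := norm_coe_le_norm_sectionParam_sub 0 b a 0 y
  have h2 : sectionParam 0 b a 0 y - 0 = sectionParamLinear b a y := by
    simp [sectionParam, sectionParamLinear]
  rw [h2, hy, norm_zero] at h
  exact norm_le_zero_iff.1 h

lemma range_sectionParam {c b a : E} (h : ⟪b, a⟫ ≠ 0) (τ : ℝ) :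
    range (sectionParam c b a τ) = {x | ⟪x - c, a⟫ = τ} := by
  refine Subset.antisymm (range_subset_iff.2 fun y => inner_sectionParam_sub h τ y) fun x hx => ?_
  have hb : b ≠ 0 := by rintro rfl; simp at h
  have hb2 : ⟪b, b⟫ ≠ 0 := fun h => hb (inner_self_eq_zero.1 h)
  refine ⟨⟨(x - c) - (⟪x - c, b⟫ / ⟪b, b⟫) • b, ?_⟩, ?_⟩
  · rw [Submodule.mem_orthogonal_singleton_iff_inner_left, inner_sub_left, inner_smul_left]
    simp only [conj_trivial]
    field_simp
    ring
  · have hx : ⟪x - c, a⟫ = τ := hx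
    simp only [sectionParam]
    rw [inner_sub_left ((x - c)), hx, inner_smul_left]
    simp only [conj_trivial]
    rw [sub_sub_cancel, mul_div_cancel_right₀ _ h]
    abel

lemma continuous_sectionParam_apply [FiniteDimensional ℝ E] (c b a : E) (τ : ℝ) :
    Continuous (sectionParam c b a τ) := by
  unfold sectionParam
  fun_prop

lemma sectionParam_lineMap (c b a : E) (τ : ℝ) (x y : (ℝ ∙ b)ᗮ) (s : ℝ) :
    sectionParam c b a τ (x + s • (y - x)) =
      sectionParam c b a τ x + s • (sectionParam c b a τ y - sectionParam c b a τ x) := by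
  rw [sectionParam_eq_add, sectionParam_eq_add c b a τ x, sectionParam_eq_add c b a τ y, map_add,
    map_smul, map_sub]
  module

lemma convex_preimage_sectionParam {K : Set E} (hK : Convex ℝ K) (c b a : E) (τ : ℝ) :
    Convex ℝ (sectionParam c b a τ ⁻¹' K) := by
  have : sectionParam c b a τ ⁻¹' K =
      sectionParamLinear b a ⁻¹' ((fun x => sectionParam c b a τ 0 + x) ⁻¹' K) := by
    ext y
    simp only [mem_preimage]
    rw [sectionParam_eq_add]
  rw [this]
  exact (hK.translate_preimage_right _).linear_preimage _

lemma mem_frontier_preimage_sectionParam {K : Set E} (hK : Convex ℝ K) (hKc : IsClosed K)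
    {c b a : E} {τ : ℝ} {x y : (ℝ ∙ b)ᗮ} (hx : sectionParam c b a τ x ∈ interior K)
    (hy : sectionParam c b a τ y ∈ frontier K) : y ∈ frontier (sectionParam c b a τ ⁻¹' K) := by
  refine ⟨subset_closure (hKc.frontier_subset hy), fun hint => hy.2 ?_⟩
  have hcont : Continuous fun s : ℝ => x + s • (y - x) := by fun_prop
  have h1 : ∀ᶠ s : ℝ in 𝓝 1, x + s • (y - x) ∈ sectionParam c b a τ ⁻¹' K :=
    hcont.continuousAt.eventually_mem
      (by simpa using mem_interior_iff_mem_nhds.1 hint)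
  obtain ⟨s, hs, hs1⟩ := ((h1.filter_mono nhdsWithin_le_nhds).and
    (self_mem_nhdsWithin (s := Ioi (1 : ℝ)))).exists
  have hs0 : 0 < s := zero_lt_one.trans hs1
  rw [mem_preimage, sectionParam_lineMap] at hs
  have h2 := hK.combo_interior_self_mem_interior hx hs (a := 1 - 1 / s) (b := 1 / s)
    (sub_pos.2 ((div_lt_one hs0).2 hs1)) (by positivity) (by ring)
  convert h2 using 1
  rw [smul_add, smul_smul, one_div_mul_cancel hs0.ne']
  module

lemma continuousAt_sectionParam {b : E} (hb : b ≠ 0) (c : E) (τ : ℝ) (y : (ℝ ∙ b)ᗮ) :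
    ContinuousAt (fun z : E × ℝ => sectionParam c b z.1 z.2 y) (b, τ) := by
  unfold sectionParam
  refine continuousAt_const.add (continuousAt_const.add (ContinuousAt.smul ?_ continuousAt_const))
  refine ContinuousAt.div (by fun_prop) (by fun_prop) ?_
  exact fun h => hb (inner_self_eq_zero.1 h)

variable [FiniteDimensional ℝ E] [MeasurableSpace E] [BorelSpace E]

theorem exists_hausdorffMeasure_restrict_eq {n : ℕ} (hn : finrank ℝ E = n + 1) {c b a : E}
    (h : ⟪b, a⟫ ≠ 0) (τ : ℝ) : ∃ κ : NNReal, κ ≠ 0 ∧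
      (μH[(n : ℝ)] : Measure E).restrict {x | ⟪x - c, a⟫ = τ} =
        κ • (volume : Measure (ℝ ∙ b)ᗮ).map (sectionParam c b a τ) := by
  have hb : b ≠ 0 := by rintro rfl; simp at h
  have ha : a ≠ 0 := by rintro rfl; simp at h
  have : Fact (finrank ℝ E = n + 1) := ⟨hn⟩
  have hfb := Submodule.finrank_orthogonal_span_singleton (n := n) (𝕜 := ℝ) hb
  have hfa := Submodule.finrank_orthogonal_span_singleton (n := n) (𝕜 := ℝ) ha
  let L₀ : (ℝ ∙ b)ᗮ →ₗ[ℝ] (ℝ ∙ a)ᗮ := (sectionParamLinear b a).codRestrict _ fun y => by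
    rw [Submodule.mem_orthogonal_singleton_iff_inner_left]
    have := inner_sectionParam_sub (c := 0) h 0 y
    simpa [sectionParam, sectionParamLinear] using this
  let L : (ℝ ∙ b)ᗮ ≃L[ℝ] (ℝ ∙ a)ᗮ := (L₀.linearEquivOfInjective
    (fun x y hxy => sectionParamLinear_injective b a (congrArg Subtype.val hxy))
    (hfb.trans hfa.symm)).toContinuousLinearEquiv
  let i : (ℝ ∙ a)ᗮ → E := fun g => sectionParam c b a τ 0 + g
  have hi : Isometry i := (isometry_add_left _).comp isometry_subtype_coe
  have hiL : i ∘ L = sectionParam c b a τ := by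
    funext y; exact (sectionParam_eq_add c b a τ y).symm
  have hrange : range i = {x | ⟪x - c, a⟫ = τ} := by
    rw [← range_sectionParam h, ← hiL, L.surjective.range_comp]
  have hH : (μH[(n : ℝ)] : Measure (ℝ ∙ a)ᗮ).IsAddHaarMeasure := by
    rw [← hfa]; infer_instance
  let μ := (volume : Measure (ℝ ∙ b)ᗮ).map L
  refine ⟨Measure.addHaarScalarFactor μH[(n : ℝ)] μ,
    (Measure.addHaarScalarFactor_pos_of_isAddHaarMeasure _ _).ne', ?_⟩
  rw [← hrange, ← hi.map_hausdorffMeasure (Or.inl n.cast_nonneg)]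
  conv_lhs => rw [Measure.isAddLeftInvariant_eq_smul (μH[(n : ℝ)] : Measure (ℝ ∙ a)ᗮ) μ]
  rw [Measure.map_smul, Measure.map_map hi.continuous.measurable L.continuous.measurable, hiL]

theorem continuousAt_integral_indicator_sectionParam {V : Type*} [NormedAddCommGroup V]
    [NormedSpace ℝ V] {g : E → V} (hg : Continuous g) {K : Set E} (hK : Convex ℝ K)
    (hKc : IsCompact K) {c b : E} (hb : b ≠ 0) {τ : ℝ} {x : (ℝ ∙ b)ᗮ}
    (hx : sectionParam c b b τ x ∈ interior K) :
    ContinuousAt (fun z : E × ℝ => ∫ y, K.indicator g (sectionParam c b z.1 z.2 y)) (b, τ) := by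
  obtain ⟨C, hC⟩ := hKc.exists_bound_of_continuousOn hg.continuousOn
  have hC0 : 0 ≤ C := (norm_nonneg _).trans (hC _ (interior_subset hx))
  obtain ⟨R, hR⟩ := hKc.isBounded.subset_closedBall c
  refine continuousAt_of_dominated (bound := (Metric.closedBall 0 R).indicator fun _ => C)
    (Eventually.of_forall fun z => ?_)
    (Eventually.of_forall fun z => Eventually.of_forall fun y => ?_)
    ?_ ?_
  · exact ((hg.stronglyMeasurable.indicator hKc.measurableSet).comp_measurable
      (continuous_sectionParam_apply c b z.1 z.2).measurable).aestronglyMeasurable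
  · by_cases hy : sectionParam c b z.1 z.2 y ∈ K
    · have hyR : y ∈ Metric.closedBall 0 R := by
        rw [mem_closedBall_zero_iff]
        exact (norm_coe_le_norm_sectionParam_sub c b z.1 z.2 y).trans
          (mem_closedBall_iff_norm.1 (hR hy))
      rw [indicator_of_mem hy, indicator_of_mem hyR]
      exact hC _ hy
    · rw [indicator_of_notMem hy, norm_zero]
      exact indicator_nonneg (fun _ _ => hC0) y
  · rw [integrable_indicator_iff Metric.isClosed_closedBall.measurableSet]
    exact integrableOn_const (isCompact_closedBall _ _).measure_lt_top.ne
  · have h0 := (convex_preimage_sectionParam hK c b b τ).addHaar_frontier volume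
    filter_upwards [measure_eq_zero_iff_ae_notMem.1 h0] with y hy
    have hy' : sectionParam c b b τ y ∉ frontier K := fun h =>
      hy (mem_frontier_preimage_sectionParam hK hKc.isClosed hx h)
    exact ContinuousAt.comp (f := fun z : E × ℝ => sectionParam c b z.1 z.2 y) (x := (b, τ))
      (hg.continuousOn.continuousAt_indicator hy') (continuousAt_sectionParam hb c τ y)

end sections

section centerOfMass

open Module Set Filter Topology

lemma centerOfMass_eq {m : ℕ} (hm : 1 ≤ m) {K : Set (EuclideanSpace ℝ (Fin m))}
    (hK : IsCompact K) {c b a : EuclideanSpace ℝ (Fin m)} (h : ⟪b, a⟫ ≠ 0) (τ : ℝ) :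
    centerOfMass m K {x | ⟪x - c, a⟫ = τ} =
      (∫ y, K.indicator (fun _ => (1 : ℝ)) (sectionParam c b a τ y))⁻¹ •
        ∫ y, K.indicator id (sectionParam c b a τ y) := by
  obtain ⟨n, rfl⟩ : ∃ n, m = n + 1 := ⟨m - 1, by lia⟩
  obtain ⟨κ, hκ, hrestr⟩ := exists_hausdorffMeasure_restrict_eq (n := n) (by simp) (c := c) h τ
  have hn : ((n + 1 : ℕ) : ℝ) - 1 = n := by push_cast; ring
  have hψ := continuous_sectionParam_apply c b a τ
  have h1 : ∫ y, K.indicator (fun _ => (1 : ℝ)) (sectionParam c b a τ y) =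
      (volume (sectionParam c b a τ ⁻¹' K)).toReal := by
    rw [← Measure.real, ← integral_indicator_one (hψ.measurable hK.measurableSet)]
    rfl
  have h2 : ∫ y, K.indicator id (sectionParam c b a τ y) =
      ∫ x in K, x ∂((volume : Measure (ℝ ∙ b)ᗮ).map (sectionParam c b a τ)) := by
    rw [← integral_indicator hK.measurableSet, integral_map hψ.measurable.aemeasurable]
    · rfl
    · exact (stronglyMeasurable_id.indicator hK.measurableSet).aestronglyMeasurable
  rw [centerOfMass, hn, ← Measure.restrict_apply hK.measurableSet,
    ← Measure.restrict_restrict hK.measurableSet, hrestr, h1, h2, Measure.restrict_smul,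
    integral_smul_nnreal_measure, Measure.smul_apply,
    Measure.map_apply hψ.measurable hK.measurableSet, ENNReal.smul_def, smul_eq_mul,
    ENNReal.toReal_mul, mul_inv, NNReal.smul_def, smul_smul]
  congr 1
  have : (κ : ℝ) ≠ 0 := NNReal.coe_ne_zero.2 hκ
  simp only [ENNReal.coe_toReal]
  field_simp

theorem continuousAt_centerOfMass {m : ℕ} (hm : 1 ≤ m) {K : Set (EuclideanSpace ℝ (Fin m))}
    (hK : Convex ℝ K) (hKc : IsCompact K) {c b : EuclideanSpace ℝ (Fin m)} (hb : b ≠ 0) {τ : ℝ}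
    (h : ({x | ⟪x - c, b⟫ = τ} ∩ interior K).Nonempty) :
    ContinuousAt (fun z : EuclideanSpace ℝ (Fin m) × ℝ =>
      centerOfMass m K {x | ⟪x - c, z.1⟫ = z.2}) (b, τ) := by
  have hbb : ⟪b, b⟫ ≠ 0 := fun h => hb (inner_self_eq_zero.1 h)
  obtain ⟨_, hx, hxK⟩ := h
  rw [← range_sectionParam hbb] at hx
  obtain ⟨x, rfl⟩ := hx
  have hev : ∀ᶠ z : EuclideanSpace ℝ (Fin m) × ℝ in 𝓝 (b, τ), ⟪b, z.1⟫ ≠ 0 :=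
    ContinuousAt.eventually_ne (by fun_prop) hbb
  refine ContinuousAt.congr_of_eventuallyEq ?_ (hev.mono fun z hz => centerOfMass_eq hm hKc hz z.2)
  have hpos : 0 < volume (sectionParam c b b τ ⁻¹' K) := by
    refine lt_of_lt_of_le ?_ (measure_mono (preimage_mono interior_subset))
    exact (isOpen_interior.preimage (continuous_sectionParam_apply c b b τ)).measure_pos _ ⟨x, hxK⟩
  have hfin : volume (sectionParam c b b τ ⁻¹' K) ≠ ⊤ := by
    obtain ⟨R, hR⟩ := hKc.isBounded.subset_closedBall c
    refine ne_top_of_le_ne_top (isCompact_closedBall (0 : (ℝ ∙ b)ᗮ) R).measure_lt_top.ne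
      (measure_mono fun y hy => ?_)
    rw [mem_closedBall_zero_iff]
    exact (norm_coe_le_norm_sectionParam_sub c b b τ y).trans (mem_closedBall_iff_norm.1 (hR hy))
  refine ContinuousAt.smul (f := fun z : EuclideanSpace ℝ (Fin m) × ℝ =>
    (∫ y, K.indicator (fun _ => (1 : ℝ)) (sectionParam c b z.1 z.2 y))⁻¹)
    (ContinuousAt.inv₀ ?_ ?_) ?_
  · exact continuousAt_integral_indicator_sectionParam continuous_const hK hKc hb hxK
  · have h1 : ∫ y, K.indicator (fun _ => (1 : ℝ)) (sectionParam c b b τ y) =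
        volume.real (sectionParam c b b τ ⁻¹' K) := by
      rw [← integral_indicator_one
        ((continuous_sectionParam_apply c b b τ).measurable hKc.measurableSet)]
      rfl
    exact h1.trans_ne (ENNReal.toReal_pos hpos.ne' hfin).ne'
  · exact continuousAt_integral_indicator_sectionParam continuous_id hK hKc hb hxK

end centerOfMass

lemma inter_nonempty_of_abs_lt {E : Type*} [NormedAddCommGroup E] [InnerProductSpace ℝ E]
    {U : Set E} {c a : E} {r τ : ℝ} (hU : Metric.ball c r ⊆ U) (h : |τ| < r * ‖a‖) :
    ({x | ⟪x - c, a⟫ = τ} ∩ U).Nonempty := by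
  have ha : 0 < ‖a‖ := (norm_nonneg a).lt_of_ne fun h0 => by
    rw [← h0, mul_zero] at h
    exact (abs_nonneg τ).not_gt h
  refine ⟨c + (τ / ⟪a, a⟫) • a, ?_, hU ?_⟩
  · rw [Set.mem_ofPred_eq, add_sub_cancel_left, inner_smul_left, real_inner_self_eq_norm_sq]
    simp only [conj_trivial]
    field_simp
  · rw [mem_ball_iff_norm, add_sub_cancel_left, norm_smul, norm_div, real_inner_self_eq_norm_sq,
      Real.norm_eq_abs, norm_pow, norm_norm]
    calc |τ| / ‖a‖ ^ 2 * ‖a‖ = |τ| / ‖a‖ := by field_simp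
      _ < r := (div_lt_iff₀ ha).2 h

lemma exists_smul_eq_of_hyperplane_eq {E : Type*} [NormedAddCommGroup E] [InnerProductSpace ℝ E]
    {c a b : E} {σ τ : ℝ} (hb : b ≠ 0) (hne : {x | ⟪x - c, b⟫ = τ}.Nonempty)
    (h : {x | ⟪x - c, a⟫ = σ} = {x | ⟪x - c, b⟫ = τ}) : ∃ s : ℝ, a = s • b ∧ σ = s * τ := by
  have hbb : ⟪b, b⟫ ≠ 0 := fun h => hb (inner_self_eq_zero.1 h)
  obtain ⟨x, hx⟩ := hne
  have hxa : ⟪x - c, a⟫ = σ := by rw [← h] at hx; exact hx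
  have hxb : ⟪x - c, b⟫ = τ := hx
  have horth : ∀ v, ⟪v, b⟫ = 0 → ⟪v, a⟫ = 0 := by
    intro v hv
    have h1 : x + v ∈ {x | ⟪x - c, b⟫ = τ} := by
      rw [Set.mem_ofPred_eq, add_sub_right_comm, inner_add_left, hxb, hv, add_zero]
    rw [← h, Set.mem_ofPred_eq, add_sub_right_comm, inner_add_left, hxa] at h1
    linarith
  have hv : ⟪a - (⟪a, b⟫ / ⟪b, b⟫) • b, b⟫ = 0 := by
    rw [inner_sub_left, inner_smul_left]
    simp only [conj_trivial]
    field_simp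
    ring
  have hself : a - (⟪a, b⟫ / ⟪b, b⟫) • b = 0 := by
    rw [← inner_self_eq_zero (𝕜 := ℝ), inner_sub_right, horth _ hv, inner_smul_right, hv]
    simp
  refine ⟨⟪a, b⟫ / ⟪b, b⟫, sub_eq_zero.1 hself, ?_⟩
  rw [← hxa, ← hxb, ← inner_smul_right, ← sub_eq_zero.1 hself]

/-- For `m = 2^ℓ - 2` and `k = 2^(ℓ-1)`, every convex body `K ⊆ ℝ^m` admits `k`
pairwise distinct affine hyperplanes, meeting the interior of `K`, whose centers of
mass (of the sections of `K`) coincide. -/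
theorem exists_hyperplanes_with_coinciding_barycenters
    (ℓ : ℕ) (hℓ : 2 ≤ ℓ) (K : Set (EuclideanSpace ℝ (Fin (2 ^ ℓ - 2))))
    (hKcomp : IsCompact K) (hKconv : Convex ℝ K) (hKint : (interior K).Nonempty) :
    ∃ H : Fin (2 ^ (ℓ - 1)) → Set (EuclideanSpace ℝ (Fin (2 ^ ℓ - 2))),
      Function.Injective H ∧
        (∀ i, IsAffineHyperplane (H i)) ∧
        (∀ i, (H i ∩ interior K).Nonempty) ∧
        ∀ i j, centerOfMass (2 ^ ℓ - 2) K (H i) = centerOfMass (2 ^ ℓ - 2) K (H j) := by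
  have h2ℓ : 2 ^ ℓ = 2 * 2 ^ (ℓ - 1) := by rw [← pow_succ']; congr 1; lia
  have h4 : 2 ^ 2 ≤ 2 ^ ℓ := Nat.pow_le_pow_right (by norm_num) hℓ
  generalize hm : 2 ^ ℓ - 2 = m at *
  obtain ⟨c, hc⟩ := hKint
  obtain ⟨r, hr, hrK⟩ := Metric.isOpen_iff.1 isOpen_interior c hc
  have hnorm : ∀ {a : Fin m → ℝ} {τ : ℝ}, |τ| < r * ‖a‖ → |τ| < r * ‖WithLp.toLp 2 a‖ :=
    fun {a τ} h => h.trans_le (mul_le_mul_of_nonneg_left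
      ((pi_norm_le_iff_of_nonneg (norm_nonneg _)).2 fun i =>
        PiLp.norm_apply_le (WithLp.toLp 2 a) i) hr.le)
  have hne0 : ∀ {a : Fin m → ℝ} {τ : ℝ}, |τ| < r * ‖a‖ → WithLp.toLp 2 a ≠ 0 := by
    intro a τ h h0
    have := hnorm h
    rw [h0, norm_zero, mul_zero] at this
    exact (abs_nonneg τ).not_gt this
  obtain ⟨a, τ, hadm, heq, hprop⟩ := exists_equal_values (D := ℓ - 1) (m := m) (by lia) (by lia)
    (fun a τ => WithLp.ofLp (centerOfMass m K {x | ⟪x - c, WithLp.toLp 2 a⟫ = τ})) hr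
    (by
      intro z hz
      have h1 := continuousAt_centerOfMass (c := c) (by lia) hKconv hKcomp (hne0 hz)
        (inter_nonempty_of_abs_lt hrK (hnorm hz))
      have h2 : Continuous fun z : (Fin m → ℝ) × ℝ => (WithLp.toLp 2 z.1, z.2) := by fun_prop
      exact (((PiLp.continuous_ofLp 2 _).continuousAt.comp
        (ContinuousAt.comp (f := fun z : (Fin m → ℝ) × ℝ => (WithLp.toLp 2 z.1, z.2))
          h1 h2.continuousAt))).continuousWithinAt)
    (by
      intro a τ
      simp only [WithLp.toLp_neg, inner_neg_right, neg_inj])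
  let H : Leaf (ℓ - 1) → Set (EuclideanSpace ℝ (Fin m)) :=
    fun l => {x | ⟪x - c, WithLp.toLp 2 (a l)⟫ = τ l}
  have hne : ∀ l, (H l ∩ interior K).Nonempty := fun l =>
    inter_nonempty_of_abs_lt hrK (hnorm (hadm l))
  let e : Fin (2 ^ (ℓ - 1)) ≃ Leaf (ℓ - 1) := Fintype.equivOfCardEq (by rw [Leaf.card]; simp)
  refine ⟨H ∘ e, Function.Injective.comp (fun l l' h => ?_) e.injective, fun i => ?_,
    fun i => hne _, fun i j => WithLp.ofLp_injective 2 (heq _ _)⟩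
  · obtain ⟨s, hs, hs'⟩ := exists_smul_eq_of_hyperplane_eq (hne0 (hadm l'))
      ((hne l').mono Set.inter_subset_left) h
    exact hprop l l' s (by simpa using congrArg WithLp.ofLp hs) hs'
  · refine ⟨WithLp.toLp 2 (a (e i)), hne0 (hadm _), τ (e i) + ⟪c, WithLp.toLp 2 (a (e i))⟫, ?_⟩
    ext x
    simp only [Function.comp_apply, H, Set.mem_ofPred_eq, inner_sub_left, sub_eq_iff_eq_add]
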